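/- arXiv:1103.2459 — 5 statements merged into one kernel-verified Lean document; each statement's English description precedes it below -/
import Mathlib

section
/- Let R be a commutative Noetherian regular local ring of Krull dimension ℓ, let c ≥ 0 be an integer, and let M be a finitely generated reflexive R-module which is not free and such that M_p is a free R_p-module for every prime ideal p of R with dim(R/p) > c. Then pd_R M + pd_R (M^∨) ≥ ℓ − 1 − c. -/
open CategoryTheory

/-- The `n`-th Ext group of the `R`-modules `M` and `N`. -/
noncomputable def ExtGrp (R : Type) [CommRing R] (M N : ModuleCat R) (n : ℕ) : ModuleCat R :=
  ((Ext R (ModuleCat R) n).obj (Opposite.op M)).obj N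

/-- `pdLE R M n` means that the projective dimension of `M` over `R` is at most `n`,
expressed via the vanishing of `Ext^{n+1}(M, -)`. -/
def pdLE (R : Type) [CommRing R] (M : ModuleCat R) (n : ℕ) : Prop :=
  ∀ N : ModuleCat R, Subsingleton (ExtGrp R M N (n + 1))

/-- The projective dimension of an `R`-module, as an extended natural number. -/
noncomputable def projDim (R : Type) [CommRing R] (M : ModuleCat R) : ℕ∞ :=
  sInf {n : ℕ∞ | ∃ m : ℕ, n = m ∧ pdLE R M m}

lemma aux_pd {R : Type} [CommRing R] (M : ModuleCat.{0} R) (n : ℕ) (h : pdLE R M n) :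
    HasProjectiveDimensionLT M (n + 1) := by
  let P := projectiveResolution M
  refine hasProjectiveDimensionLT_of_enoughInjectives M (n + 1) (fun Y => ?_)
  refine ⟨fun a b => ?_⟩
  suffices H : ∀ α : Abelian.Ext M Y (n + 1), α = 0 by rw [H a, H b]
  intro α
  obtain ⟨f, hf, rfl⟩ := P.extMk_surjective α (n + 2) rfl
  rw [P.extMk_eq_zero_iff f (n + 2) rfl hf n rfl]
  have h0 : Limits.IsZero ((P.complex.linearYonedaObj R Y).homology (n + 1)) :=
    (ModuleCat.isZero_iff_subsingleton.2 (h Y)).of_iso (P.isoExt (R := R) (n + 1) Y).symm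
  rw [← HomologicalComplex.exactAt_iff_isZero_homology,
    HomologicalComplex.exactAt_iff' _ n (n + 1) (n + 2) (by simp) (by simp),
    ShortComplex.moduleCat_exact_iff] at h0
  obtain ⟨g, hg⟩ := h0 f hf
  exact ⟨g, hg⟩

section
variable {R : Type} [CommRing R]
open RingTheory.Sequence

lemma aux_ext_k (k : ModuleCat.{0} R) (rs : List R) (hk : ∀ r ∈ rs, r ∈ Module.annihilator R k)  :
    ∀ (N : Type) [AddCommGroup N] [Module R N] (_ : IsWeaklyRegular N rs)
    (i : ℕ) (_ : i < rs.length), Subsingleton (Abelian.Ext k (ModuleCat.of R N) i) := by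
  induction rs with
  | nil => intro N _ _ _ i hi; simp at hi
  | cons r rs ih =>
    intro N _ _ hN i hi
    rw [isWeaklyRegular_cons_iff] at hN
    obtain ⟨h1, h2⟩ := hN
    have hS := IsSMulRegular.smulShortComplex_shortExact (M := ModuleCat.of R N) h1
    have key : ∀ x : Abelian.Ext k (ModuleCat.of R N) i,
        x.comp (Abelian.Ext.mk₀ ((ModuleCat.of R N).smulShortComplex r).f) (add_zero i) = 0 := by
      intro x
      have h0 := Abelian.Ext.postcomp_smul_id_eq_zero_of_mem_annihilator
        (M := ModuleCat.of R N) (hk r (by simp)) i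
      exact congrArg (fun φ : AddCommGrpCat.of (Abelian.Ext k (ModuleCat.of R N) i) ⟶
        AddCommGrpCat.of (Abelian.Ext k (ModuleCat.of R N) i) => φ x) h0
    suffices H : ∀ α : Abelian.Ext k (ModuleCat.of R N) i, α = 0 from
      ⟨fun a b => by rw [H a, H b]⟩
    intro α
    cases i with
    | zero =>
      have := Abelian.Ext.postcomp_mk₀_injective_of_mono k ((ModuleCat.of R N).smulShortComplex r).f
        (hf := hS.mono_f)
      apply this
      exact (key α).trans (map_zero _).symm
    | succ i =>
      obtain ⟨x, hx⟩ := Abelian.Ext.covariant_sequence_exact₁ k hS α (key α) rfl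
      have := ih (fun s hs => hk s (by simp [hs])) (QuotSMulTop r N) h2 i (by simpa using hi)
      have hx0 : x = 0 := Subsingleton.elim (α := Abelian.Ext k (ModuleCat.of R (QuotSMulTop r N)) i) _ _
      rw [← hx, hx0, Abelian.Ext.zero_comp]
      rfl

end

open IsLocalRing RingTheory.Sequence in
lemma aux_quot_ofList {A : Type} [CommRing A] [IsLocalRing A] (rs : List A)
    (hm : Ideal.ofList rs = maximalIdeal A) (J : Ideal A) [IsLocalRing (A ⧸ J)] :
    Ideal.ofList (rs.map (Ideal.Quotient.mk J)) = maximalIdeal (A ⧸ J) := by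
  rw [← Ideal.map_ofList, hm]
  have : IsLocalHom (Ideal.Quotient.mk J) :=
    IsLocalHom.of_surjective _ Ideal.Quotient.mk_surjective
  ext y
  obtain ⟨z, rfl⟩ := Ideal.Quotient.mk_surjective y
  constructor
  · intro h
    have h2 : (maximalIdeal A).map (Ideal.Quotient.mk J) ≤ maximalIdeal (A ⧸ J) :=
      ((IsLocalRing.local_hom_TFAE (Ideal.Quotient.mk J)).out 0 2).1 this
    exact h2 h
  · intro h
    exact Ideal.mem_map_of_mem _ (fun hu => h (hu.map _))

open IsLocalRing in
lemma aux_dim_le {A : Type} [CommRing A] [IsLocalRing A] [IsNoetherianRing A] (rs : List A)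
    (hm : Ideal.ofList rs = maximalIdeal A) : ringKrullDim A ≤ (rs.length : WithBot ℕ∞) := by
  classical
  refine (ringKrullDim_le_spanFinrank_maximalIdeal A).trans ?_
  have h : maximalIdeal A = Ideal.span (rs.toFinset : Set A) := by
    rw [← hm, Ideal.ofList]; congr 1; ext; simp
  have h1 : (maximalIdeal A).spanFinrank ≤ rs.length := by
    rw [h]
    refine (Submodule.spanFinrank_span_le_ncard_of_finite (Finset.finite_toSet _)).trans ?_
    rw [Set.ncard_coe_finset]
    exact List.toFinset_card_le rs
  exact_mod_cast h1

lemma aux_exists_prime {A : Type} [CommRing A] (n : ℕ) (h : (n : WithBot ℕ∞) ≤ ringKrullDim A) :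
    ∃ q : Ideal A, q.IsPrime ∧ (n : WithBot ℕ∞) ≤ ringKrullDim (A ⧸ q) := by
  rw [ringKrullDim, Order.le_krullDim_iff] at h
  obtain ⟨l, hl⟩ := h
  refine ⟨l.head.asIdeal, l.head.2, ?_⟩
  rw [ringKrullDim_quotient, Order.le_krullDim_iff]
  refine ⟨⟨l.length, fun i => ⟨l i, ?_⟩, ?_⟩, hl⟩
  · exact LTSeries.head_le l i
  · intro i
    exact l.step i

lemma aux_wb {a b : WithBot ℕ∞} {n : ℕ} (h : ((n + 1 : ℕ) : WithBot ℕ∞) ≤ a) (h' : a ≤ b + 1) :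
    (n : WithBot ℕ∞) ≤ b := by
  have := h.trans h'
  push_cast at this
  induction b with
  | bot => simp at this
  | coe b =>
    have h2 : (n : ℕ∞) + 1 ≤ b + 1 := by exact_mod_cast this
    have h3 : (n : ℕ∞) ≤ b := (ENat.add_le_add_iff_right (by simp)).1 h2
    exact_mod_cast h3

open IsLocalRing RingTheory.Sequence in
lemma aux_reg (n : ℕ) : ∀ {A : Type} [CommRing A] [IsLocalRing A] [IsNoetherianRing A] (rs : List A)
    (_ : rs.length = n)
    (_ : Ideal.ofList rs = maximalIdeal A) (_ : (n : WithBot ℕ∞) ≤ ringKrullDim A),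
    IsDomain A ∧ IsWeaklyRegular A rs := by
  induction n with
  | zero =>
    intro A _ _ _ rs hl hm hd
    obtain rfl := List.length_eq_zero_iff.1 hl
    simp only [Ideal.ofList_nil] at hm
    exact ⟨((isField_iff_maximalIdeal_eq).2 hm.symm).isDomain, IsWeaklyRegular.nil _ _⟩
  | succ n ih =>
    intro A _ _ _ rs hl hm hd
    obtain _ | ⟨x, rs⟩ := rs
    · simp at hl
    simp only [List.length_cons, Nat.add_right_cancel_iff] at hl
    have hx : x ∈ maximalIdeal A := by
      rw [← hm]; exact Ideal.subset_span (by simp)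
    have hxt : Ideal.span {x} ≠ ⊤ := fun h => by
      rw [Ideal.span_singleton_eq_top] at h; exact hx h
    have := Ideal.Quotient.nontrivial_iff.mpr hxt
    have : IsLocalRing (A ⧸ Ideal.span {x}) :=
      IsLocalRing.of_surjective' (Ideal.Quotient.mk _) Ideal.Quotient.mk_surjective
    have hm' : Ideal.ofList (rs.map (Ideal.Quotient.mk (Ideal.span {x})))
        = maximalIdeal (A ⧸ Ideal.span {x}) := by
      rw [← aux_quot_ofList _ hm (Ideal.span {x})]
      simp
    have hd' : (n : WithBot ℕ∞) ≤ ringKrullDim (A ⧸ Ideal.span {x}) := by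
      refine aux_wb hd ?_
      have := ringKrullDim_le_ringKrullDim_quotient_add_encard ({x} : Set A)
        (by simpa [IsLocalRing.ringJacobson_eq_maximalIdeal] using hx)
      simpa using this
    obtain ⟨hdom, hreg⟩ := ih _ (by simpa using hl) hm' hd'
    have hdx : ringKrullDim (A ⧸ Ideal.span {x}) ≤ n := by
      have := aux_dim_le _ hm'
      simpa [hl] using this
    obtain ⟨q, hq, hqd⟩ := aux_exists_prime (n + 1) hd
    have : IsLocalRing (A ⧸ q) :=
      IsLocalRing.of_surjective' (Ideal.Quotient.mk _) Ideal.Quotient.mk_surjective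
    have hmq := aux_quot_ofList _ hm q
    have hxq : x ∉ q := by
      intro hxq
      have h1 := aux_dim_le (rs.map (Ideal.Quotient.mk q)) (by
        rw [← hmq]; simp [Ideal.Quotient.eq_zero_iff_mem.2 hxq])
      have h2 := hqd.trans h1
      simp only [List.length_map, hl] at h2
      have h3 : n + 1 ≤ n := by exact_mod_cast h2
      omega
    have hqx : q ≤ Ideal.span {x} := by
      intro y hy
      by_contra hyx
      have h1 := ringKrullDim_quotient_succ_le_of_nonZeroDivisor
        (R := A ⧸ Ideal.span {x}) (r := Ideal.Quotient.mk _ y)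
        (mem_nonZeroDivisors_of_ne_zero (fun h => hyx (Ideal.Quotient.eq_zero_iff_mem.1 h)))
      have h2 : (n : WithBot ℕ∞) ≤ ringKrullDim ((A ⧸ q) ⧸ Ideal.span {Ideal.Quotient.mk q x}) := by
        refine aux_wb hqd ?_
        have hxm : Ideal.Quotient.mk q x ∈ maximalIdeal (A ⧸ q) := by
          rw [← hmq]; exact Ideal.subset_span (by simp)
        have := ringKrullDim_le_ringKrullDim_quotient_add_encard ({Ideal.Quotient.mk q x} : Set (A ⧸ q))
          (by simpa [IsLocalRing.ringJacobson_eq_maximalIdeal] using hxm)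
        simpa using this
      let f : A →+* ((A ⧸ q) ⧸ Ideal.span {Ideal.Quotient.mk q x}) :=
        (Ideal.Quotient.mk _).comp (Ideal.Quotient.mk q)
      have hfs : Function.Surjective f :=
        Ideal.Quotient.mk_surjective.comp Ideal.Quotient.mk_surjective
      have hfx : f x = 0 := Ideal.Quotient.eq_zero_iff_mem.2 (Ideal.mem_span_singleton_self _)
      have hfy : f y = 0 := by
        simp only [f, RingHom.comp_apply, Ideal.Quotient.eq_zero_iff_mem.2 hy, map_zero]
      let f1 : (A ⧸ Ideal.span {x}) →+* _ := Ideal.Quotient.lift (Ideal.span {x}) f (by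
        intro a ha
        obtain ⟨b, rfl⟩ := Ideal.mem_span_singleton'.1 ha
        simp [hfx])
      let f2 := Ideal.Quotient.lift (Ideal.span {Ideal.Quotient.mk (Ideal.span {x}) y}) f1 (by
        intro a ha
        obtain ⟨b, rfl⟩ := Ideal.mem_span_singleton'.1 ha
        have : f1 (Ideal.Quotient.mk _ y) = 0 := by simpa [f1] using hfy
        simp [this])
      have hf2 : Function.Surjective f2 :=
        Ideal.Quotient.lift_surjective_of_surjective _ _
          (Ideal.Quotient.lift_surjective_of_surjective _ _ hfs)
      have h3 := h2.trans (ringKrullDim_le_of_surjective f2 hf2)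
      have h4 : ((n : WithBot ℕ∞) + 1) ≤ n := (add_le_add_left h3 1).trans (h1.trans hdx)
      have h5 : n + 1 ≤ n := by exact_mod_cast h4
      omega
    have hq0 : q = ⊥ := by
      refine Submodule.eq_bot_of_le_smul_of_le_jacobson_bot (Ideal.span {x}) q
        (IsNoetherian.noetherian q) ?_ ?_
      · intro y hy
        obtain ⟨b, rfl⟩ := Ideal.mem_span_singleton'.1 (hqx hy)
        rw [mul_comm]
        exact Submodule.smul_mem_smul (Ideal.mem_span_singleton_self x)
          ((hq.mem_or_mem hy).resolve_right hxq)
      · rw [IsLocalRing.jacobson_eq_maximalIdeal _ bot_ne_top]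
        simpa [Ideal.span_le] using hx
    have hA : IsDomain A := by
      subst hq0
      exact IsDomain.of_bot_isPrime A
    refine ⟨hA, ?_⟩
    have hx0 : x ≠ 0 := fun h => hxq (h ▸ q.zero_mem)
    rw [isWeaklyRegular_cons_iff']
    refine ⟨?_, ?_⟩
    · intro a b hab
      exact mul_left_cancel₀ hx0 hab
    · let e : QuotSMulTop x A ≃ₗ[A] A ⧸ Ideal.span {x} :=
        Submodule.quotEquivOfEq _ _ (by
          ext z; simp [Submodule.mem_smul_pointwise_iff_exists, Ideal.mem_span_singleton', mul_comm])
      let e' : QuotSMulTop x A ≃ₗ[A ⧸ Ideal.span {x}] A ⧸ Ideal.span {x} :=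
        e.extendScalarsOfSurjective Ideal.Quotient.mk_surjective
      exact (LinearEquiv.isWeaklyRegular_congr e' _).2 hreg

section
variable {R : Type} [CommRing R]
open IsLocalRing

lemma aux_wb2 {b : WithBot ℕ∞} {n : ℕ} (h : b + 1 ≤ (n : WithBot ℕ∞) + 1) :
    b ≤ (n : WithBot ℕ∞) := by
  induction b with
  | bot => simp
  | coe b =>
    have h2 : b + 1 ≤ (n : ℕ∞) + 1 := by exact_mod_cast h
    have h3 : b ≤ (n : ℕ∞) := (ENat.add_le_add_iff_right (by simp)).1 h2
    exact_mod_cast h3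

lemma aux_dim_lt (p q : Ideal R) [p.IsPrime] (x : R) (hx : x ∉ p) (hpq : p ≤ q) (hxq : x ∈ q) :
    ringKrullDim (R ⧸ q) + 1 ≤ ringKrullDim (R ⧸ p) := by
  have h0 : Ideal.Quotient.mk p x ∈ nonZeroDivisors (R ⧸ p) := by
    rw [mem_nonZeroDivisors_iff_ne_zero]
    rwa [Ne, Ideal.Quotient.eq_zero_iff_mem]
  refine le_trans ?_ (ringKrullDim_quotient_succ_le_of_nonZeroDivisor h0)
  gcongr
  let f : (R ⧸ p) ⧸ Ideal.span {Ideal.Quotient.mk p x} →+* R ⧸ q :=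
    Ideal.Quotient.lift _ (Ideal.Quotient.factor hpq) (by
      intro a ha
      have : Ideal.span {Ideal.Quotient.mk p x} ≤ RingHom.ker (Ideal.Quotient.factor hpq) := by
        rw [Ideal.span_singleton_le_iff_mem, RingHom.mem_ker, Ideal.Quotient.factor_mk,
          Ideal.Quotient.eq_zero_iff_mem]
        exact hxq
      exact this ha)
  exact ringKrullDim_le_of_surjective f
    (Ideal.Quotient.lift_surjective_of_surjective _ _ (Ideal.Quotient.factor_surjective hpq))

lemma aux_ext_iso {X X' : ModuleCat.{0} R} (e : X ≅ X') (Y : ModuleCat.{0} R) (i : ℕ)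
    (h : Subsingleton (Abelian.Ext X Y i)) : Subsingleton (Abelian.Ext X' Y i) := by
  suffices H : ∀ α : Abelian.Ext X' Y i, α = 0 from ⟨fun a b => by rw [H a, H b]⟩
  intro α
  have h1 : (Abelian.Ext.mk₀ e.inv).comp ((Abelian.Ext.mk₀ e.hom).comp α (zero_add i)) (zero_add i)
      = α := by
    rw [Abelian.Ext.mk₀_comp_mk₀_assoc, e.inv_hom_id, Abelian.Ext.mk₀_id_comp]
  rw [← h1, Subsingleton.elim ((Abelian.Ext.mk₀ e.hom).comp α (zero_add i)) 0,
    Abelian.Ext.comp_zero]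


lemma aux_ext_mid {S : ShortComplex (ModuleCat.{0} R)} (hS : S.ShortExact) (Y : ModuleCat.{0} R)
    (i : ℕ) (h1 : Subsingleton (Abelian.Ext S.X₁ Y i)) (h3 : Subsingleton (Abelian.Ext S.X₃ Y i)) :
    Subsingleton (Abelian.Ext S.X₂ Y i) := by
  suffices H : ∀ α : Abelian.Ext S.X₂ Y i, α = 0 from ⟨fun a b => by rw [H a, H b]⟩
  intro α
  obtain ⟨x, hx⟩ := Abelian.Ext.contravariant_sequence_exact₂ hS Y α (Subsingleton.elim _ _)
  rw [← hx, Subsingleton.elim x 0, Abelian.Ext.comp_zero]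

lemma aux_dev [IsNoetherianRing R] (i : ℕ) (d : WithBot ℕ∞) (Y : ModuleCat.{0} R)
    (H : ∀ (p : Ideal R), p.IsPrime → ringKrullDim (R ⧸ p) ≤ d →
      Subsingleton (Abelian.Ext (ModuleCat.of R (R ⧸ p)) Y i))
    (N : Type) [AddCommGroup N] [Module R N] [Module.Finite R N]
      (hN : ∀ q : Ideal R, q.IsPrime → Module.annihilator R N ≤ q → ringKrullDim (R ⧸ q) ≤ d) :
      Subsingleton (Abelian.Ext (ModuleCat.of R N) Y i) := by
  rename_i _ _ _ hfin
  revert hN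
  induction hfin using IsNoetherianRing.induction_on_isQuotientEquivQuotientPrime R with
  | subsingleton N =>
    intro _
    suffices H : ∀ α : Abelian.Ext (ModuleCat.of R N) Y i, α = 0 from
      ⟨fun a b => by rw [H a, H b]⟩
    intro α
    have hz : Limits.IsZero (ModuleCat.of R N) := ModuleCat.isZero_of_subsingleton _
    rw [← Abelian.Ext.mk₀_id_comp α, hz.eq_zero_of_src (𝟙 _), Abelian.Ext.mk₀_zero,
      Abelian.Ext.zero_comp]
  | quotient N p e =>
    intro hN
    refine aux_ext_iso e.symm.toModuleIso Y i (H p.1 p.2 (hN _ p.2 ?_))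
    rw [e.annihilator_eq, Ideal.annihilator_quotient]
  | exact N₁ N₂ N₃ f g hf hg hfg h₁ h₃ =>
    intro hN
    have hS := ModuleCat.shortComplex_shortExact
      (ModuleCat.shortComplexOfCompEqZero f g hfg.linearMap_comp_eq_zero) hfg hf hg
    exact aux_ext_mid hS Y i
      (h₁ fun q hq hle => hN q hq ((f.annihilator_le_of_injective hf).trans hle))
      (h₃ fun q hq hle => hN q hq ((g.annihilator_le_of_surjective hg).trans hle))

open Pointwise in
lemma aux_quotsmul (N : Type) [AddCommGroup N] [Module R N] (x : R) :
    Module.annihilator R N ≤ Module.annihilator R (QuotSMulTop x N) ∧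
    x ∈ Module.annihilator R (QuotSMulTop x N) := by
  constructor
  · exact LinearMap.annihilator_le_of_surjective
      (Submodule.mkQ (x • (⊤ : Submodule R N))) (Submodule.mkQ_surjective _)
  · rw [Module.mem_annihilator]
    intro m
    obtain ⟨m, rfl⟩ := Submodule.mkQ_surjective _ m
    rw [← map_smul]
    exact (Submodule.Quotient.mk_eq_zero _).2 (Submodule.smul_mem_pointwise_smul _ _ _ trivial)

set_option maxHeartbeats 1000000 in
lemma aux_isch [IsNoetherianRing R] [IsLocalRing R] (ℓ : ℕ)
    (hk : ∀ i < ℓ, Subsingleton (Abelian.Ext (ModuleCat.of R (R ⧸ maximalIdeal R))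
      (ModuleCat.of R R) i)) (d : ℕ) :
    ∀ (N : Type) [AddCommGroup N] [Module R N] [Module.Finite R N]
      (_ : ∀ q : Ideal R, q.IsPrime → Module.annihilator R N ≤ q →
        ringKrullDim (R ⧸ q) ≤ d) (i : ℕ) (_ : i + d < ℓ),
      Subsingleton (Abelian.Ext (ModuleCat.of R N) (ModuleCat.of R R) i) := by
  induction d with
  | zero =>
    intro N _ _ _ hN i hi
    refine aux_dev i _ _ ?_ N hN
    intro p hp hd
    by_cases hpm : p = maximalIdeal R
    · subst hpm; exact hk i (by omega)
    · exfalso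
      obtain ⟨x, hxm, hxp⟩ : ∃ x ∈ maximalIdeal R, x ∉ p := by
        by_contra! hc
        exact hpm (le_antisymm (le_maximalIdeal hp.ne_top) hc)
      have h1 := (aux_dim_lt p _ x hxp (le_maximalIdeal hp.ne_top) hxm).trans hd
      have h2 : 0 ≤ ringKrullDim (R ⧸ maximalIdeal R) := ringKrullDim_nonneg_of_nontrivial
      have h3 : (1 : WithBot ℕ∞) ≤ 0 := by
        calc (1 : WithBot ℕ∞) = 0 + 1 := by simp
          _ ≤ _ := by gcongr
          _ ≤ _ := h1
      exact absurd h3 (by decide)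
  | succ d ih =>
    intro N _ _ _ hN i hi
    refine aux_dev i _ _ ?_ N hN
    intro p hp hd
    by_cases hpm : p = maximalIdeal R
    · subst hpm; exact hk i (by omega)
    · obtain ⟨x, hxm, hxp⟩ : ∃ x ∈ maximalIdeal R, x ∉ p := by
        by_contra! hc
        exact hpm (le_antisymm (le_maximalIdeal hp.ne_top) hc)
      have hreg : IsSMulRegular (R ⧸ p) x := by
        intro a b hab
        obtain ⟨a, rfl⟩ := Ideal.Quotient.mk_surjective a
        obtain ⟨b, rfl⟩ := Ideal.Quotient.mk_surjective b
        have h1 : Ideal.Quotient.mk p (x * a) = Ideal.Quotient.mk p (x * b) := hab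
        rw [Ideal.Quotient.eq] at h1 ⊢
        rw [← mul_sub] at h1
        exact (hp.mem_or_mem h1).resolve_left hxp
      have hS := IsSMulRegular.smulShortComplex_shortExact (M := ModuleCat.of R (R ⧸ p)) hreg
      have hQ : Subsingleton (Abelian.Ext (ModuleCat.of R (QuotSMulTop x (R ⧸ p)))
          (ModuleCat.of R R) (i + 1)) := by
        refine ih _ ?_ (i + 1) (by omega)
        intro q hq hle
        have hpq : p ≤ q := by
          refine le_trans ?_ ((aux_quotsmul (R ⧸ p) x).1.trans hle)
          rw [Ideal.annihilator_quotient]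
        have hxq : x ∈ q := hle (aux_quotsmul (R ⧸ p) x).2
        have h1 := (aux_dim_lt p q x hxp hpq hxq).trans hd
        push_cast at h1
        exact aux_wb2 h1
      have hsurj : ∀ α : Abelian.Ext (ModuleCat.of R (R ⧸ p)) (ModuleCat.of R R) i,
          ∃ β : Abelian.Ext (ModuleCat.of R (R ⧸ p)) (ModuleCat.of R R) i, x • β = α := by
        intro α
        obtain ⟨β, hβ⟩ := Abelian.Ext.contravariant_sequence_exact₁ hS (ModuleCat.of R R) α
          (add_comm 1 i) (hQ.elim _ _)
        refine ⟨β, Eq.trans ?_ hβ⟩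
        rw [ModuleCat.smulShortComplex_f_eq_smul_id]
        have h2 : (Abelian.Ext.mk₀ (x • 𝟙 (ModuleCat.of R (R ⧸ p)))).comp β (zero_add i)
            = x • (show Abelian.Ext (ModuleCat.of R (R ⧸ p)) (ModuleCat.of R R) i from β) := by
          generalize (show Abelian.Ext (ModuleCat.of R (R ⧸ p)) (ModuleCat.of R R) i from β) = γ
          rw [Abelian.Ext.mk₀_smul, Abelian.Ext.smul_comp, Abelian.Ext.mk₀_id_comp]
        exact h2.symm
      have hf : Module.Finite R
          (Abelian.Ext (ModuleCat.of R (R ⧸ p)) (ModuleCat.of R R) i) :=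
        ModuleCat.finite_ext R _ _ i
      have htop : (⊤ : Submodule R (Abelian.Ext (ModuleCat.of R (R ⧸ p)) (ModuleCat.of R R) i))
          = ⊥ := by
        refine Submodule.eq_bot_of_le_smul_of_le_jacobson_bot (maximalIdeal R) _ hf.1 ?_ ?_
        · intro α _
          obtain ⟨β, rfl⟩ := hsurj α
          exact Submodule.smul_mem_smul hxm trivial
        · rw [IsLocalRing.jacobson_eq_maximalIdeal _ bot_ne_top]
      exact (Submodule.subsingleton_iff R).1 (subsingleton_of_bot_eq_top htop.symm)
end

section
variable {R : Type} [CommRing R]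

lemma aux_E_proj (E : ModuleCat.{0} R) (j : ℕ)
    (h : Subsingleton (Abelian.Ext E (ModuleCat.of R R) j))
    (B : Type) [AddCommGroup B] [Module R B] [Module.Finite R B] [Module.Projective R B] :
    Subsingleton (Abelian.Ext E (ModuleCat.of R B) j) := by
  suffices H : ∀ α : Abelian.Ext E (ModuleCat.of R B) j, α = 0 from
    ⟨fun a b => by rw [H a, H b]⟩
  intro α
  obtain ⟨n, f, g, -, -, hfg⟩ := Module.Finite.exists_comp_eq_id_of_projective R B
  have hid : 𝟙 (ModuleCat.of R B) = ∑ i : Fin n,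
      (ModuleCat.ofHom ((LinearMap.proj i : (Fin n → R) →ₗ[R] R) ∘ₗ g)) ≫
        ModuleCat.ofHom (f ∘ₗ (LinearMap.single R (fun _ : Fin n => R) i)) := by
    apply ModuleCat.hom_ext
    rw [ModuleCat.hom_sum]
    ext b
    have h1 := LinearMap.congr_fun hfg b
    simp only [ModuleCat.hom_id, LinearMap.id_coe, id_eq, ModuleCat.hom_comp, ModuleCat.hom_ofHom,
      LinearMap.sum_apply, LinearMap.comp_apply, LinearMap.proj_apply] at h1 ⊢
    rw [← map_sum]
    conv_lhs => rw [← h1]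
    congr 1
    ext k
    simp [LinearMap.single_apply]
  rw [← Abelian.Ext.comp_mk₀_id α, hid, Abelian.Ext.mk₀_sum, Abelian.Ext.comp_sum]
  refine Finset.sum_eq_zero fun i _ => ?_
  rw [← Abelian.Ext.mk₀_comp_mk₀, ← Abelian.Ext.comp_assoc_of_third_deg_zero,
    Subsingleton.elim (α.comp (Abelian.Ext.mk₀ (ModuleCat.ofHom ((LinearMap.proj i : (Fin n → R) →ₗ[R] R) ∘ₗ g))) (add_zero j)) 0, Abelian.Ext.zero_comp]

lemma aux_pd_ker [IsNoetherianRing R] (e : ℕ) {F B : Type} [AddCommGroup B] [Module R B] 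
    [AddCommGroup F] [Module R F] [Module.Projective R F] (f : F →ₗ[R] B)
    (hf : Function.Surjective f)
    (hB : HasProjectiveDimensionLT (ModuleCat.of R B) (e + 2)) :
    HasProjectiveDimensionLT (ModuleCat.of R (LinearMap.ker f)) (e + 1) := by
  have hS := LinearMap.shortExact_shortComplexKer hf
  have hp : Projective (ModuleCat.of R F) := (IsProjective.iff_projective F).1 inferInstance
  exact (hS.hasProjectiveDimensionLT_X₃_iff e hp).1 hB

lemma aux_E [IsNoetherianRing R] (E : ModuleCat.{0} R) (g : ℕ)
    (h : ∀ i < g, Subsingleton (Abelian.Ext E (ModuleCat.of R R) i)) (e : ℕ) :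
    ∀ (B : Type) [AddCommGroup B] [Module R B] [Module.Finite R B]
      (_ : HasProjectiveDimensionLT (ModuleCat.of R B) (e + 1)) (j : ℕ) (_ : j + e < g),
      Subsingleton (Abelian.Ext E (ModuleCat.of R B) j) := by
  induction e with
  | zero =>
    intro B _ _ _ hB j hj
    have : Module.Projective R B := (IsProjective.iff_projective B).2
      (projective_iff_hasProjectiveDimensionLT_one.2 hB)
    exact aux_E_proj E j (h j (by omega)) B
  | succ e ih =>
    intro B _ _ _ hB j hj
    obtain ⟨n, f, hf⟩ := Module.Finite.exists_fin' R B
    have hS := LinearMap.shortExact_shortComplexKer hf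
    have h1 := ih (LinearMap.ker f) (aux_pd_ker e f hf hB) (j + 1) (by omega)
    have h2 := aux_E_proj E j (h j (by omega)) (Fin n → R)
    suffices H : ∀ α : Abelian.Ext E (ModuleCat.of R B) j, α = 0 from
      ⟨fun a b => by rw [H a, H b]⟩
    intro α
    obtain ⟨x, hx⟩ := Abelian.Ext.covariant_sequence_exact₃ E hS α rfl (h1.elim _ _)
    rw [← hx, h2.elim x 0, Abelian.Ext.zero_comp]
end

section
variable {R : Type} [CommRing R]

def Fac (s : R) (Z : Type) [AddCommGroup Z] [Module R Z] : Prop :=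
  ∃ (n : ℕ) (p : Z →ₗ[R] (Fin n → R)) (q : (Fin n → R) →ₗ[R] Z), ∀ z, q (p z) = s • z

lemma Fac.mk' {s : R} {Z L : Type} [AddCommGroup Z] [Module R Z] [AddCommGroup L] [Module R L]
    [Module.Finite R L] [Module.Projective R L] (p : Z →ₗ[R] L) (q : L →ₗ[R] Z)
    (h : ∀ z, q (p z) = s • z) : Fac s Z := by
  obtain ⟨n, f, g, -, -, hfg⟩ := Module.Finite.exists_comp_eq_id_of_projective R L
  refine ⟨n, g ∘ₗ p, q ∘ₗ f, fun z => ?_⟩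
  have := LinearMap.congr_fun hfg (p z)
  simp only [LinearMap.comp_apply, LinearMap.id_apply] at this ⊢
  rw [this, h]

lemma Fac.dual {s : R} {Z : Type} [AddCommGroup Z] [Module R Z] (h : Fac s Z) :
    Fac s (Module.Dual R Z) := by
  obtain ⟨n, p, q, h⟩ := h
  refine Fac.mk' q.dualMap p.dualMap fun φ => ?_
  ext z
  simp [h]

lemma Fac.of_free [IsNoetherianRing R] (Z : Type) [AddCommGroup Z] [Module R Z] [Module.Finite R Z]
    (p : Ideal R) [hp : p.IsPrime]
    (h : Module.Free (Localization.AtPrime p) (LocalizedModule p.primeCompl Z)) :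
    ∃ s ∉ p, Fac s Z := by
  have : Module.Finite (Localization.AtPrime p) (LocalizedModule p.primeCompl Z) := inferInstance
  have := Module.finitePresentation_of_finite R Z
  let n := Module.finrank (Localization.AtPrime p) (LocalizedModule p.primeCompl Z)
  let e : LocalizedModule p.primeCompl Z ≃ₗ[R] (Fin n → Localization.AtPrime p) :=
    (Module.finBasis (Localization.AtPrime p) _).equivFun.restrictScalars R
  let f := LocalizedModule.mkLinearMap p.primeCompl Z
  let g : (Fin n → R) →ₗ[R] (Fin n → Localization.AtPrime p) :=
    LinearMap.pi fun i ↦ Algebra.linearMap R _ ∘ₗ LinearMap.proj i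
  have hg : IsLocalizedModule p.primeCompl g := inferInstance
  obtain ⟨a, s, ha⟩ := Module.FinitePresentation.exists_lift_of_isLocalizedModule p.primeCompl g
    (e.toLinearMap ∘ₗ f)
  obtain ⟨b, t, hb⟩ := Module.FinitePresentation.exists_lift_of_isLocalizedModule p.primeCompl f
    (e.symm.toLinearMap ∘ₗ g)
  have hc : f ∘ₗ (b ∘ₗ a) = f ∘ₗ ((t * s) • LinearMap.id) := by
    ext z
    have h1 := LinearMap.congr_fun ha z
    have h2 := LinearMap.congr_fun hb (a z)
    simp only [LinearMap.comp_apply, LinearMap.smul_apply, LinearMap.id_apply,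
      LinearEquiv.coe_coe] at h1 h2 ⊢
    rw [h2, h1]
    simp [mul_smul, Submonoid.smul_def]
  obtain ⟨u, hu⟩ := Module.Finite.exists_smul_of_comp_eq_of_isLocalizedModule p.primeCompl f _ _ hc
  refine ⟨(u * (t * s) : p.primeCompl), (u * (t * s)).2, n, a, (u : R) • b, fun z => ?_⟩
  have := LinearMap.congr_fun hu z
  simpa [mul_smul, Submonoid.smul_def] using this
end

section
variable {R : Type} [CommRing R]

lemma aux_split (X : Type) [AddCommGroup X] [Module R X] (B : Submodule R X)
    (h : Subsingleton (Abelian.Ext (ModuleCat.of R (X ⧸ B)) (ModuleCat.of R B) 1)) :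
    ∃ σ : (X ⧸ B) →ₗ[R] X, ∀ y, B.mkQ (σ y) = y := by
  have hfg : Function.Exact B.subtype B.mkQ := LinearMap.exact_subtype_mkQ B
  have hS := ModuleCat.shortComplex_shortExact
      (ModuleCat.shortComplexOfCompEqZero B.subtype B.mkQ hfg.linearMap_comp_eq_zero) hfg
      (Submodule.injective_subtype _) (Submodule.mkQ_surjective _)
  obtain ⟨x, hx⟩ := Abelian.Ext.covariant_sequence_exact₃ (ModuleCat.of R (X ⧸ B)) hS
    (Abelian.Ext.mk₀ (𝟙 _)) rfl (h.elim _ _)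
  obtain ⟨σ, rfl⟩ := (Abelian.Ext.mk₀_bijective _ _).2 x
  rw [Abelian.Ext.mk₀_comp_mk₀] at hx
  have h2 := (Abelian.Ext.mk₀_bijective _ _).1 hx
  refine ⟨σ.hom, fun y => ?_⟩
  exact congrArg (fun φ : ModuleCat.of R (X ⧸ B) ⟶ ModuleCat.of R (X ⧸ B) => φ.hom y) h2

lemma aux_hom_zero (E K : Type) [AddCommGroup E] [Module R E] [AddCommGroup K] [Module R K]
    (h : Subsingleton (Abelian.Ext (ModuleCat.of R E) (ModuleCat.of R R) 0))
    (σ : E →ₗ[R] Module.Dual R K) : σ = 0 := by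
  ext y k
  let φ : E →ₗ[R] R := LinearMap.applyₗ k ∘ₗ σ
  have h1 : Abelian.Ext.mk₀ (ModuleCat.ofHom φ) = Abelian.Ext.mk₀ (ModuleCat.ofHom 0) :=
    h.elim _ _
  have h2 := congrArg ModuleCat.Hom.hom ((Abelian.Ext.mk₀_bijective _ _).1 h1)
  exact LinearMap.congr_fun h2 y

lemma aux_proj_of_ext {F Z : Type} [AddCommGroup F] [Module R F] [AddCommGroup Z] [Module R Z]
    [Module.Projective R F] (f : F →ₗ[R] Z) (hf : Function.Surjective f)
    [Module.Finite R (LinearMap.ker f)] [Module.Projective R (LinearMap.ker f)]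
    (hρ : Function.Surjective (LinearMap.ker f).subtype.dualMap) : Module.Projective R Z := by
  obtain ⟨n, u, v, -, -, huv⟩ := Module.Finite.exists_comp_eq_id_of_projective R (LinearMap.ker f)
  choose G hG using fun i : Fin n => hρ (LinearMap.proj i ∘ₗ v)
  let r : F →ₗ[R] LinearMap.ker f := u ∘ₗ LinearMap.pi G
  have hr : r ∘ₗ (LinearMap.ker f).subtype = LinearMap.id := by
    ext1 k
    have h1 : LinearMap.pi G ((LinearMap.ker f).subtype k) = v k := by
      ext i
      exact LinearMap.congr_fun (hG i) k
    have h2 := LinearMap.congr_fun huv k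
    simp only [r, LinearMap.comp_apply] at h2 ⊢
    rw [h1, h2]
  have hex : Function.Exact (LinearMap.ker f).subtype f := LinearMap.exact_subtype_ker_map f
  have h0 : ∃ l, f ∘ₗ l = LinearMap.id :=
    (((Function.Exact.split_tfae' hex).out 1 0 rfl rfl).mp ⟨hf, r, hr⟩).2
  obtain ⟨l, hl⟩ := h0
  exact Module.Projective.of_split l f hl

lemma aux_G [IsNoetherianRing R] (I : Set R) (g : ℕ)
    (hI : ∀ (E : Type) [AddCommGroup E] [Module R E] [Module.Finite R E],
      (∀ s ∈ I, s ∈ Module.annihilator R E) → ∀ i < g,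
        Subsingleton (Abelian.Ext (ModuleCat.of R E) (ModuleCat.of R R) i)) (b : ℕ) :
    ∀ (a : ℕ) (Z : Type) [AddCommGroup Z] [Module R Z] [Module.Finite R Z]
      (_ : HasProjectiveDimensionLT (ModuleCat.of R Z) (b + 1))
      (_ : HasProjectiveDimensionLT (ModuleCat.of R (Module.Dual R Z)) (a + 1))
      (_ : a + b + 2 ≤ g) (_ : ∀ s ∈ I, Fac s Z), Module.Projective R Z := by
  induction b with
  | zero =>
    intro a Z _ _ _ h1 _ _ _
    exact (IsProjective.iff_projective Z).2 (projective_iff_hasProjectiveDimensionLT_one.2 h1)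
  | succ b ih =>
    intro a Z _ _ _ h1 h2 hab hfac
    obtain ⟨n, f, hf⟩ := Module.Finite.exists_fin' R Z
    have hKpd := aux_pd_ker b f hf h1
    set K := LinearMap.ker f with hK
    let ρ : Module.Dual R (Fin n → R) →ₗ[R] Module.Dual R K := K.subtype.dualMap
    -- the lifts
    have key : ∀ s ∈ I, ∃ t : (Fin n → R) →ₗ[R] K, ∀ k : K, t k = s • k := by
      intro s hs
      obtain ⟨m, p, q, hpq⟩ := hfac s hs
      obtain ⟨q', hq'⟩ := Module.projective_lifting_property f q hf
      refine ⟨LinearMap.codRestrict K (s • LinearMap.id - q' ∘ₗ p ∘ₗ f) ?_, ?_⟩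
      · intro c
        have h3 := LinearMap.congr_fun hq' (p (f c))
        simp only [LinearMap.comp_apply] at h3
        simp [hK, LinearMap.mem_ker, h3, hpq]
      · intro k
        ext1
        have : f (k : Fin n → R) = 0 := k.2
        simp [this]
    have hfacK : ∀ s ∈ I, Fac s K := by
      intro s hs
      obtain ⟨t, ht⟩ := key s hs
      exact Fac.mk' K.subtype t ht
    have hEann : ∀ s ∈ I, s ∈ Module.annihilator R (Module.Dual R K ⧸ LinearMap.range ρ) := by
      intro s hs
      obtain ⟨t, ht⟩ := key s hs
      rw [Module.mem_annihilator]
      intro y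
      obtain ⟨φ, rfl⟩ := Submodule.mkQ_surjective _ y
      rw [← map_smul]
      refine (Submodule.Quotient.mk_eq_zero _).2 ⟨φ ∘ₗ t, ?_⟩
      ext k
      have h3 : ρ (φ ∘ₗ t) k = φ (t k) := rfl
      rw [h3, ht]
      simp
    have hE := hI _ hEann
    have hρex : Function.Exact f.dualMap ρ := by
      intro φ
      constructor
      · intro h
        have hle : K ≤ LinearMap.ker φ := by
          intro k hk
          exact LinearMap.congr_fun h ⟨k, hk⟩
        refine ⟨(K.liftQ φ hle) ∘ₗ (f.quotKerEquivOfSurjective hf).symm.toLinearMap, ?_⟩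
        refine LinearMap.ext fun c => ?_
        have h3 : (f.quotKerEquivOfSurjective hf).symm (f c) = K.mkQ c := by
          rw [LinearEquiv.symm_apply_eq]
          rfl
        rw [LinearMap.dualMap_apply, LinearMap.comp_apply, LinearEquiv.coe_coe, h3]
        exact Submodule.liftQ_apply _ _ _
      · rintro ⟨ψ, rfl⟩
        ext k
        have : f (k : Fin n → R) = 0 := k.2
        simp [ρ, this]
    have hinj : Function.Injective f.dualMap := LinearMap.dualMap_injective_of_surjective hf
    have hpF : HasProjectiveDimensionLT (ModuleCat.of R (Module.Dual R (Fin n → R))) (a + 2) := by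
      have : Projective (ModuleCat.of R (Module.Dual R (Fin n → R))) :=
        (IsProjective.iff_projective _).1 inferInstance
      have := projective_iff_hasProjectiveDimensionLT_one.1 this
      exact hasProjectiveDimensionLT_of_ge _ 1 (a + 2) (by omega)
    have hpd : ∀ (B : Type) [AddCommGroup B] [Module R B]
        (r : Module.Dual R (Fin n → R) →ₗ[R] B), Function.Surjective r →
        Function.Exact f.dualMap r → HasProjectiveDimensionLT (ModuleCat.of R B) (a + 2) := by
      intro B _ _ r hr hex
      have hS := ModuleCat.shortComplex_shortExact
        (ModuleCat.shortComplexOfCompEqZero f.dualMap r hex.linearMap_comp_eq_zero) hex hinj hr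
      exact hS.hasProjectiveDimensionLT_X₃ (a + 1) h2 hpF
    have hB : HasProjectiveDimensionLT (ModuleCat.of R (LinearMap.range ρ)) (a + 2) := by
      refine hpd _ ρ.rangeRestrict ρ.surjective_rangeRestrict ?_
      intro φ
      rw [← hρex φ]
      exact Subtype.ext_iff
    have hext := aux_E _ g hE (a + 1) (LinearMap.range ρ) hB 1 (by omega)
    obtain ⟨σ, hσ⟩ := aux_split _ _ hext
    have hσ0 := aux_hom_zero _ _ (hE 0 (by omega)) σ
    have hρs : Function.Surjective ρ := by
      intro φ
      have h3 := hσ ((LinearMap.range ρ).mkQ φ)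
      rw [hσ0, LinearMap.zero_apply, map_zero] at h3
      exact (Submodule.Quotient.mk_eq_zero _).1 h3.symm
    have hKproj := ih (a + 1) K hKpd (hpd _ ρ hρs hρex) (by omega) hfacK
    exact aux_proj_of_ext f hf hρs
end

/-- Let `R` be a commutative Noetherian regular local ring of Krull dimension `ℓ`
(regularity: the maximal ideal is generated by `ℓ` elements), `c ≥ 0` an integer, and `M` a
finitely generated reflexive `R`-module which is not free and whose localization at every
prime `p` with `dim (R/p) > c` is free.  Then `pd_R M + pd_R M^∨ ≥ ℓ - 1 - c`. -/
theorem pd_add_pd_dual_ge (R : Type) [CommRing R] [IsNoetherianRing R] [IsLocalRing R]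
    (ℓ c : ℕ)
    (hdim : ringKrullDim R = ℓ)
    (hreg : ∃ s : Finset R, s.card = ℓ ∧ Ideal.span (s : Set R) = IsLocalRing.maximalIdeal R)
    (M : Type) [AddCommGroup M] [Module R M] [Module.Finite R M]
    (hrefl : Module.IsReflexive R M)
    (hnotfree : ¬ Module.Free R M)
    (hloc : ∀ (p : Ideal R) (_ : p.IsPrime), (c : WithBot ℕ∞) < ringKrullDim (R ⧸ p) →
      Module.Free (Localization.AtPrime p) (LocalizedModule p.primeCompl M)) :
    ((ℓ - 1 - c : ℕ) : ℕ∞) ≤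
      projDim R (ModuleCat.of R M) + projDim R (ModuleCat.of R (Module.Dual R M)) := by
  classical
  by_contra hcon
  rw [not_le] at hcon
  -- finite projective dimensions
  have hget : ∀ X : ModuleCat R, projDim R X ≠ ⊤ → ∃ m : ℕ, projDim R X = m ∧ pdLE R X m := by
    intro X hX
    have hne : {n : ℕ∞ | ∃ m : ℕ, n = m ∧ pdLE R X m}.Nonempty := by
      rw [Set.nonempty_iff_ne_empty]
      intro h0
      apply hX
      rw [projDim, h0, sInf_empty]
    exact csInf_mem hne
  have hlt := lt_of_lt_of_le hcon (le_top (α := ℕ∞))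
  obtain ⟨a, ha, hapd⟩ := hget (ModuleCat.of R M) (by rintro h; simp [h] at hlt)
  obtain ⟨b, hb, hbpd⟩ := hget (ModuleCat.of R (Module.Dual R M)) (by rintro h; simp [h] at hlt)
  rw [ha, hb] at hcon
  have hab : a + b < ℓ - 1 - c := by exact_mod_cast hcon
  have hM := aux_pd _ a hapd
  have hD := aux_pd _ b hbpd
  -- regularity
  obtain ⟨s, hs, hspan⟩ := hreg
  have hofl : Ideal.ofList s.toList = IsLocalRing.maximalIdeal R := by
    rw [← hspan, Ideal.ofList]
    congr 1
    ext x
    simp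
  obtain ⟨_, hwr⟩ := aux_reg ℓ s.toList (by simpa using hs) hofl hdim.ge
  have hk : ∀ i < ℓ, Subsingleton (Abelian.Ext
      (ModuleCat.of R (R ⧸ IsLocalRing.maximalIdeal R)) (ModuleCat.of R R) i) := by
    intro i hi
    refine aux_ext_k _ s.toList ?_ R hwr i (by simpa [hs] using hi)
    intro r hr
    have h1 : r ∈ Module.annihilator R (R ⧸ IsLocalRing.maximalIdeal R) := by
      rw [Ideal.annihilator_quotient, ← hofl]
      exact Ideal.subset_span hr
    exact h1
  have hfin : Module.Projective R (Module.Dual R M) := by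
    refine aux_G {s | Fac s M} (ℓ - c) ?_ b a (Module.Dual R M) hD ?_ (by omega)
      (fun s hs => Fac.dual hs)
    · intro E _ _ _ hE i hi
      refine aux_isch ℓ hk c E ?_ i (by omega)
      intro q hq hle
      by_contra hq2
      rw [not_le] at hq2
      obtain ⟨s, hsq, hsf⟩ := Fac.of_free M q (hloc q hq hq2)
      exact hsq (hle (hE s hsf))
    · exact hasProjectiveDimensionLT_of_iso (Module.evalEquiv R M).toModuleIso (a + 1)
  have hfin2 : Module.Projective R (Module.Dual R (Module.Dual R M)) := inferInstance
  have hfin3 : Module.Projective R M := Module.Projective.of_equiv (Module.evalEquiv R M).symm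
  exact hnotfree (Module.free_of_flat_of_isLocalRing)
end

section
/- Let R be a commutative Noetherian regular local ring of Krull dimension ℓ, let c ≥ 0 be an integer, and let M be a finitely generated reflexive R-module which is not free and such that M_p is a free R_p-module for every prime ideal p of R with dim(R/p) > c. If pd_R M + pd_R (M^∨) = ℓ − 1 − c, then M is d-spherical, where d = pd_R M, the module M^∨ is (ℓ − d − 1 − c)-spherical, and there is an isomorphism of R-modules Ext^a_R(M^∨, R) ≅ Ext^{ℓ−c}_R(Ext^d_R(M, R), R), where a = pd_R (M^∨) = ℓ − 1 − c − d. -/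
open CategoryTheory

/-- `M` is `d`-spherical: `pd_R M ≤ d` and `Ext^i_R(M, R) = 0` for `1 ≤ i ≤ d - 1`. -/
def Spherical (R : Type) [CommRing R] (M : ModuleCat R) (d : ℕ) : Prop :=
  pdLE R M d ∧ ∀ i : ℕ, 1 ≤ i → i ≤ d - 1 → Subsingleton (ExtGrp R M (ModuleCat.of R R) i)

section Helpers
open CategoryTheory Abelian IsLocalRing RingTheory.Sequence

theorem dim_le_quot (R : Type) [CommRing R] [IsNoetherianRing R] [IsLocalRing R] (x : R)
    (hx : x ∈ maximalIdeal R) : ringKrullDim R ≤ ringKrullDim (R ⧸ Ideal.span {x}) + 1 := by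
  have := ringKrullDim_le_ringKrullDim_quotient_add_encard (R := R) {x}
    (by simpa [IsLocalRing.ringJacobson_eq_maximalIdeal] using hx)
  simpa using this

theorem reg_aux : ∀ (n : ℕ) (R : Type) [CommRing R] [IsNoetherianRing R] [IsLocalRing R]
    (rs : List R), rs.length = n → Ideal.ofList rs = maximalIdeal R → ringKrullDim R = n →
    IsDomain R ∧ IsRegular R rs := by
  intro n
  induction n with
  | zero =>
    intro R _ _ _ rs hl hm hd
    obtain rfl := List.eq_nil_of_length_eq_zero hl
    rw [Ideal.ofList_nil] at hm
    have hf : IsField R := by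
      rw [IsLocalRing.isField_iff_maximalIdeal_eq, hm]
    exact ⟨hf.isDomain, IsRegular.nil R R⟩
  | succ n ih =>
    intro R _ _ _ rs hl hm hd
    obtain ⟨x, rs, rfl⟩ := List.exists_cons_of_length_eq_add_one hl
    have hx : x ∈ maximalIdeal R := by
      rw [← hm]; exact Ideal.subset_span (by simp)
    have hxl : Ideal.span {x} ≤ maximalIdeal R := by simpa [Ideal.span_le] using hx
    have : Nontrivial (R ⧸ Ideal.span {x}) := Ideal.Quotient.nontrivial_iff.2
      (ne_top_of_le_ne_top (Ideal.IsPrime.ne_top inferInstance) hxl)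
    have hsurj := Ideal.Quotient.mk_surjective (I := Ideal.span {x})
    have : IsLocalRing (R ⧸ Ideal.span {x}) := IsLocalRing.of_surjective' _ hsurj
    have hm' : Ideal.ofList (rs.map (Ideal.Quotient.mk (Ideal.span {x}))) = maximalIdeal (R ⧸ Ideal.span {x}) := by
      rw [← IsLocalRing.map_maximalIdeal_of_surjective _ hsurj, ← hm, Ideal.ofList_cons, Ideal.map_sup, Ideal.map_ofList]
      rw [Ideal.map_quotient_self, bot_sup_eq]
    have hl' : rs.length = n := by simpa using hl
    have hge := dim_le_quot R x hx
    have hle : ringKrullDim (R ⧸ Ideal.span {x}) ≤ n := by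
      refine (ringKrullDim_le_spanFinrank_maximalIdeal _).trans ?_
      rw [← hm']
      have := Submodule.spanFinrank_span_le_ncard_of_finite (R := R ⧸ Ideal.span {x}) (s := {r | r ∈ rs.map (Ideal.Quotient.mk (Ideal.span {x}))}) (List.finite_toSet _)
      refine (Nat.cast_le.2 this).trans ?_
      norm_cast
      classical
      have e : {r | r ∈ rs.map (Ideal.Quotient.mk (Ideal.span {x}))} = ((rs.map (Ideal.Quotient.mk (Ideal.span {x}))).toFinset : Set _) := by ext; simp
      rw [e, Set.ncard_coe_finset]
      refine (List.toFinset_card_le _).trans ?_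
      simp [hl']
    have hd' : ringKrullDim (R ⧸ Ideal.span {x}) = n := by
      refine le_antisymm hle ?_
      rw [hd] at hge
      rw [← ENat.WithBot.add_le_add_natCast_right_iff (c := 1)]
      simpa using hge
    obtain ⟨hdom, hreg⟩ := ih _ _ (by simpa using hl') hm' hd'
    have key : IsDomain R := by
      obtain ⟨l, hl⟩ := Order.le_krullDim_iff.1 hd.ge
      let q := l.head.asIdeal
      have hq : ringKrullDim (R ⧸ q) ≥ (n + 1 : ℕ) := by
        rw [ringKrullDim_quotient]
        refine Order.le_krullDim_iff.2 ⟨⟨l.length, fun i => ⟨l i, ?_⟩, ?_⟩, hl⟩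
        · exact l.head_le i
        · exact l.step
      have hqle : q ≤ maximalIdeal R := IsLocalRing.le_maximalIdeal (Ideal.IsPrime.ne_top l.head.2)
      have hxq : x ∉ q := by
        intro h
        have : ringKrullDim (R ⧸ q) ≤ ringKrullDim (R ⧸ Ideal.span {x}) :=
          ringKrullDim_le_of_surjective (Ideal.Quotient.factor (by simpa [Ideal.span_le] using h)) (Ideal.Quotient.factor_surjective _)
        have := hq.trans (this.trans hle)
        norm_cast at this
        omega
      have hsub : q ≤ Ideal.span {x} := by
        intro y hy
        by_contra hyx
        set t := Ideal.Quotient.mk (Ideal.span {x}) y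
        have ht : t ≠ 0 := by rwa [Ne, Ideal.Quotient.eq_zero_iff_mem]
        have h1 := ringKrullDim_quotient_succ_le_of_nonZeroDivisor (mem_nonZeroDivisors_of_ne_zero ht)
        have : Nontrivial (R ⧸ q) := Ideal.Quotient.nontrivial_iff.2 l.head.2.ne_top
        have : IsLocalRing (R ⧸ q) := IsLocalRing.of_surjective' _ Ideal.Quotient.mk_surjective
        have h2 := dim_le_quot (R ⧸ q) (Ideal.Quotient.mk q x) (by
          rw [← IsLocalRing.map_maximalIdeal_of_surjective _ (Ideal.Quotient.mk_surjective (I := q))]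
          exact Ideal.mem_map_of_mem _ hx)
        have h3 : ringKrullDim ((R ⧸ q) ⧸ Ideal.span {Ideal.Quotient.mk q x}) ≤ ringKrullDim ((R ⧸ Ideal.span {x}) ⧸ Ideal.span {t}) := by
          refine ringKrullDim_le_of_surjective (Ideal.Quotient.lift _ (Ideal.Quotient.lift _ ((Ideal.Quotient.mk _).comp (Ideal.Quotient.mk q)) ?_) ?_) ?_
          · intro a ha
            obtain ⟨b, rfl⟩ := Ideal.mem_span_singleton'.1 ha
            simp [Ideal.Quotient.eq_zero_iff_mem]
          · intro a ha
            obtain ⟨b, rfl⟩ := Ideal.mem_span_singleton'.1 ha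
            simp [t, Ideal.Quotient.eq_zero_iff_mem.2 hy]
          · refine Ideal.Quotient.lift_surjective_of_surjective _ _ (Ideal.Quotient.lift_surjective_of_surjective _ _ (Ideal.Quotient.mk_surjective.comp Ideal.Quotient.mk_surjective))
        rw [hd'] at h1
        have h4 : (n + 1 : ℕ) ≤ (n : WithBot ℕ∞) := by
          refine hq.le.trans (h2.trans ?_)
          exact le_trans (by gcongr) h1
        norm_cast at h4
        omega
      have hq0 : q = ⊥ := by
        refine Submodule.eq_bot_of_le_smul_of_le_jacobson_bot (Ideal.span {x}) q (IsNoetherian.noetherian q) ?_ ?_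
        · intro y hy
          obtain ⟨b, rfl⟩ := Ideal.mem_span_singleton'.1 (hsub hy)
          have := (l.head.2.mem_or_mem hy).resolve_right hxq
          rw [mul_comm]
          exact Submodule.smul_mem_smul (Ideal.subset_span rfl) this
        · rw [IsLocalRing.jacobson_eq_maximalIdeal _ bot_ne_top]; exact hxl
      have : (⊥ : Ideal R).IsPrime := hq0 ▸ l.head.2
      exact IsDomain.of_bot_isPrime R
    refine ⟨key, (isRegular_cons_iff' _ _ _).2 ⟨?_, ?_⟩⟩
    · have hx0 : x ≠ 0 := by
        rintro rfl
        have e : R ≃+* R ⧸ Ideal.span {(0 : R)} :=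
          ((Ideal.quotEquivOfEq (by simp)).trans (RingEquiv.quotientBot R)).symm
        have := ringKrullDim_eq_of_ringEquiv e
        rw [hd, hd'] at this
        norm_cast at this
        omega
      exact IsSMulRegular.of_ne_zero hx0
    · let e : QuotSMulTop x R ≃ₗ[R] R ⧸ Ideal.span {x} :=
        Submodule.quotEquivOfEq _ _ (by simp [← Submodule.ideal_span_singleton_smul])
      let e' : QuotSMulTop x R ≃ₗ[R ⧸ Ideal.span {x}] R ⧸ Ideal.span {x} :=
        LinearEquiv.extendScalarsOfSurjective hsurj e
      exact (e'.isRegular_congr _).2 hreg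

theorem extMk_smul' (R : Type) [CommRing R] {M N : ModuleCat.{0} R} (P : ProjectiveResolution M)
    {n : ℕ} (f : P.complex.X n ⟶ N) (m : ℕ) (hm : n + 1 = m) (hf : P.complex.d m n ≫ f = 0) (r : R) :
    P.extMk (r • f) m hm (by rw [Linear.comp_smul, hf, smul_zero]) = r • P.extMk f m hm hf := by
  rw [Ext.smul_eq_comp_mk₀, ProjectiveResolution.extMk_comp_mk₀]
  congr 1

noncomputable def bridgeMap (R : Type) [CommRing R] {M N : ModuleCat.{0} R} (P : ProjectiveResolution M)
    (p : ℕ) : LinearMap.ker (Linear.leftComp R N (P.complex.d (p+2) (p+1))) →ₗ[R] Abelian.Ext.{0} M N (p+1) where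
  toFun f := P.extMk f.1 (p+2) rfl f.2
  map_add' _ _ := (P.add_extMk _ _ _ _ _ _).symm
  map_smul' r _ := extMk_smul' R P _ _ _ _ r

theorem bridge (R : Type) [CommRing R] (M N : ModuleCat.{0} R) (p : ℕ) :
    Nonempty (ExtGrp R M N (p+1) ≅ ModuleCat.of R (Abelian.Ext.{0} M N (p+1))) := by
  let P := projectiveResolution M
  let S := (P.complex.linearYonedaObj R N).sc' p (p+1) (p+2)
  have e1 : ExtGrp R M N (p+1) ≅ S.homology := P.isoExt (p+1) N ≪≫
    HomologicalComplex.homologyIsoSc' _ p (p+1) (p+2) (by simp) (by simp)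
  have e2 : S.homology ≅ ModuleCat.of R
      (LinearMap.ker (S.g.hom) ⧸ LinearMap.range S.moduleCatToCycles) := S.moduleCatHomologyIso
  let φ : LinearMap.ker (S.g.hom) →ₗ[R] Abelian.Ext.{0} M N (p+1) := bridgeMap R P p
  have hφ : Function.Surjective φ := fun α => by
    obtain ⟨f, hf, rfl⟩ := P.extMk_surjective α (p+2) rfl
    exact ⟨⟨f, hf⟩, rfl⟩
  have hker : LinearMap.range S.moduleCatToCycles = LinearMap.ker φ := by
    ext f
    rw [LinearMap.mem_ker]
    refine Iff.trans ?_ (P.extMk_eq_zero_iff f.1 (p+2) rfl f.2 p rfl).symm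
    constructor
    · rintro ⟨g, rfl⟩
      exact ⟨g, rfl⟩
    · rintro ⟨g, hg⟩
      exact ⟨g, Subtype.ext hg⟩
  exact ⟨e1 ≪≫ e2 ≪≫ ((Submodule.quotEquivOfEq _ _ hker).trans (φ.quotKerEquivOfSurjective hφ)).toModuleIso⟩

/-- `Ext` in unbundled form. -/
abbrev EE (R : Type) [CommRing R] (N L : Type) [AddCommGroup N] [Module R N] [AddCommGroup L]
    [Module R L] (j : ℕ) : Type := Abelian.Ext.{0} (ModuleCat.of R N) (ModuleCat.of R L) j

section
variable {R : Type} [CommRing R] {A B C L : Type} [AddCommGroup A] [Module R A]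
  [AddCommGroup B] [Module R B] [AddCommGroup C] [Module R C] [AddCommGroup L] [Module R L]

theorem ses_mk (f : A →ₗ[R] B) (g : B →ₗ[R] C) (hf : Function.Injective f)
    (hg : Function.Surjective g) (hfg : Function.Exact f g) :
    (ModuleCat.shortComplexOfCompEqZero f g hfg.linearMap_comp_eq_zero).ShortExact := by
  have hm := (ModuleCat.mono_iff_injective (ModuleCat.ofHom f)).2 hf
  have he := (ModuleCat.epi_iff_surjective (ModuleCat.ofHom g)).2 hg
  refine { exact := ?_, mono_f := hm, epi_g := he }
  rw [ShortComplex.ShortExact.moduleCat_exact_iff_function_exact]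
  exact hfg

theorem EE_mid (f : A →ₗ[R] B) (g : B →ₗ[R] C) (hf : Function.Injective f)
    (hg : Function.Surjective g) (hfg : Function.Exact f g) (j : ℕ)
    (h1 : Subsingleton (EE R A L j)) (h2 : Subsingleton (EE R C L j)) :
    Subsingleton (EE R B L j) := by
  have key : ∀ x : EE R B L j, x = 0 := fun x => by
    obtain ⟨y, hy⟩ := Ext.contravariant_sequence_exact₂ (ses_mk f g hf hg hfg) (ModuleCat.of R L) x
      (h1.elim _ _)
    rw [← hy, h2.elim y 0]
    exact Ext.comp_zero _ _ _ _ _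
  exact ⟨fun x y => (key x).trans (key y).symm⟩

theorem EE_left (f : A →ₗ[R] B) (g : B →ₗ[R] C) (hf : Function.Injective f)
    (hg : Function.Surjective g) (hfg : Function.Exact f g) (j : ℕ)
    (h1 : Subsingleton (EE R B L j)) (h2 : Subsingleton (EE R C L (j+1))) :
    Subsingleton (EE R A L j) := by
  have key : ∀ x : EE R A L j, x = 0 := fun x => by
    obtain ⟨y, hy⟩ := Ext.contravariant_sequence_exact₁ (ses_mk f g hf hg hfg) (ModuleCat.of R L) x
      (add_comm 1 j) (h2.elim _ _)
    rw [← hy, h1.elim y 0]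
    exact Ext.comp_zero _ _ _ _ _
  exact ⟨fun x y => (key x).trans (key y).symm⟩

theorem EE_right (f : A →ₗ[R] B) (g : B →ₗ[R] C) (hf : Function.Injective f)
    (hg : Function.Surjective g) (hfg : Function.Exact f g) (j : ℕ)
    (h1 : Subsingleton (EE R A L j)) (h2 : Subsingleton (EE R B L (j+1))) :
    Subsingleton (EE R C L (j+1)) := by
  have key : ∀ x : EE R C L (j+1), x = 0 := fun x => by
    obtain ⟨y, hy⟩ := Ext.contravariant_sequence_exact₃ (ses_mk f g hf hg hfg) (ModuleCat.of R L) x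
      (h2.elim _ _) (add_comm 1 j)
    rw [← hy, h1.elim y 0]
    exact Ext.comp_zero _ _ _ _ _
  exact ⟨fun x y => (key x).trans (key y).symm⟩

theorem EE_equivL (e : A ≃ₗ[R] B) (j : ℕ) : Nonempty (EE R B L j ≃ₗ[R] EE R A L j) := by
  let i : ModuleCat.of R A ≅ ModuleCat.of R B := e.toModuleIso
  have h1 : ∀ x : EE R A L j, (Ext.mk₀ i.hom).comp
      ((Ext.mk₀ i.inv).comp x (zero_add j)) (zero_add j) = x := fun x => by
    rw [Ext.mk₀_comp_mk₀_assoc, Iso.hom_inv_id, Ext.mk₀_id_comp]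
  have h2 : ∀ x : EE R B L j, (Ext.mk₀ i.inv).comp
      ((Ext.mk₀ i.hom).comp x (zero_add j)) (zero_add j) = x := fun x => by
    rw [Ext.mk₀_comp_mk₀_assoc, Iso.inv_hom_id, Ext.mk₀_id_comp]
  refine ⟨LinearEquiv.ofBijective ((Ext.mk₀ i.hom).precompOfLinear R (ModuleCat.of R L) (zero_add j)) ⟨?_, ?_⟩⟩
  · intro x y hxy
    have : (Ext.mk₀ i.hom).comp x (zero_add j) = (Ext.mk₀ i.hom).comp y (zero_add j) := hxy
    rw [← h2 x, ← h2 y, this]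
  · intro x
    exact ⟨_, h1 x⟩

theorem EE_equiv (e : A ≃ₗ[R] B) (j : ℕ) (h : Subsingleton (EE R B L j)) : Subsingleton (EE R A L j) := by
  obtain ⟨e'⟩ := EE_equivL (L := L) e j
  exact e'.symm.toEquiv.subsingleton

theorem EE_proj [Module.Projective R A] (j : ℕ) : Subsingleton (EE R A L (j+1)) := by
  have : Projective (ModuleCat.of R A) := (IsProjective.iff_projective (R := R) A).1 inferInstance
  exact HasProjectiveDimensionLT.subsingleton (ModuleCat.of R A) 1 (j+1) (by omega) _

/-- Dimension shifting, linear. -/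
theorem EE_shift [Module.Projective R B] (f : A →ₗ[R] B) (g : B →ₗ[R] C) (hf : Function.Injective f)
    (hg : Function.Surjective g) (hfg : Function.Exact f g) (j : ℕ) :
    Nonempty (EE R A L (j+1) ≃ₗ[R] EE R C L (j+2)) := by
  have hs := ses_mk f g hf hg hfg
  refine ⟨LinearEquiv.ofBijective (hs.extClass.precompOfLinear R (ModuleCat.of R L) (add_comm 1 (j+1))) ⟨?_, ?_⟩⟩
  · rw [injective_iff_map_eq_zero]
    intro x hx
    obtain ⟨y, hy⟩ := Ext.contravariant_sequence_exact₁ hs (ModuleCat.of R L) x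
      (add_comm 1 (j+1)) hx
    rw [← hy, (EE_proj (R := R) (A := B) (L := L) j).elim y 0]
    exact Ext.comp_zero _ _ _ _ _
  · intro x
    obtain ⟨y, hy⟩ := Ext.contravariant_sequence_exact₃ hs (ModuleCat.of R L) x
      ((EE_proj (R := R) (A := B) (L := L) (j+1)).elim _ _) (add_comm 1 (j+1))
    exact ⟨y, hy⟩
end

theorem EE_smul_surj {R : Type} [CommRing R] {B L : Type} [AddCommGroup B] [Module R B]
    [AddCommGroup L] [Module R L] (x : R) (f : B →ₗ[R] B) (hfx : f = x • LinearMap.id)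
    (hx : Function.Injective f) (j : ℕ)
    (h : Subsingleton (EE R (B ⧸ LinearMap.range f) L (j+1))) (e : EE R B L j) :
    ∃ e' : EE R B L j, e = x • e' := by
  have hs := ses_mk f (LinearMap.range f).mkQ hx (Submodule.mkQ_surjective _) (LinearMap.exact_map_mkQ_range f)
  obtain ⟨y, hy⟩ := Ext.contravariant_sequence_exact₁ hs (ModuleCat.of R L) e
      (add_comm 1 j) (h.elim _ _)
  refine ⟨y, ?_⟩
  have h2 : (ModuleCat.shortComplexOfCompEqZero f (LinearMap.range f).mkQ
    (LinearMap.exact_map_mkQ_range f).linearMap_comp_eq_zero).f = x • 𝟙 (ModuleCat.of R B) := by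
    subst hfx; rfl
  rw [← hy, h2, Ext.mk₀_smul, Ext.smul_comp]
  congr 1
  exact (Ext.mk₀_id_comp y)

theorem dim_drop {R : Type} [CommRing R] (p q : Ideal R) [p.IsPrime] (hpq : p ≤ q) (x : R) (hxp : x ∉ p)
    (hxq : x ∈ q) : ringKrullDim (R ⧸ q) + 1 ≤ ringKrullDim (R ⧸ p) := by
  have h0 : (Ideal.Quotient.mk p x) ∈ nonZeroDivisors (R ⧸ p) := by
    rw [mem_nonZeroDivisors_iff_ne_zero]
    rwa [Ne, Ideal.Quotient.eq_zero_iff_mem]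
  refine le_trans ?_ (ringKrullDim_quotient_succ_le_of_nonZeroDivisor h0)
  refine add_le_add ?_ le_rfl
  refine ringKrullDim_le_of_surjective (Ideal.Quotient.lift _ (Ideal.Quotient.factor hpq) ?_) ?_
  · intro a ha
    rw [Ideal.mem_span_singleton] at ha
    obtain ⟨b, rfl⟩ := ha
    rw [map_mul, Ideal.Quotient.factor_mk, Ideal.Quotient.eq_zero_iff_mem.2 hxq, zero_mul]
  · intro y
    obtain ⟨r, rfl⟩ := Ideal.Quotient.mk_surjective y
    exact ⟨Ideal.Quotient.mk _ (Ideal.Quotient.mk _ r), by simp⟩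

theorem ischebeck (R : Type) [CommRing R] [IsNoetherianRing R] [IsLocalRing R] (rs : List R)
    (hrs : ∀ r ∈ rs, r ∈ maximalIdeal R) (hreg : IsRegular R rs) :
    ∀ (c : ℕ) (N : Type) [AddCommGroup N] [Module R N] [Module.Finite R N],
      (∀ q ∈ Module.support R N, ringKrullDim (R ⧸ q.asIdeal) ≤ c) →
      ∀ j, j + c < rs.length → Subsingleton (EE R N R j) := by
  intro c
  induction c using Nat.strong_induction_on with
  | _ c ih =>
  intro N _ _ hN
  refine IsNoetherianRing.induction_on_isQuotientEquivQuotientPrime R hN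
    (motive := fun N _ _ _ => (∀ q ∈ Module.support R N, ringKrullDim (R ⧸ q.asIdeal) ≤ c) →
      ∀ j, j + c < rs.length → Subsingleton (EE R N R j)) ?_ ?_ ?_
  · intro N _ _ _ _ _ j _
    have e : N ≃ₗ[R] PUnit.{1} := LinearEquiv.ofSubsingleton N PUnit
    refine EE_equiv e j ?_
    cases j with
    | succ j => exact EE_proj j
    | zero =>
      exact (Ext.linearEquiv₀ (R := R) (X := ModuleCat.of R PUnit.{1}) (Y := ModuleCat.of R R)).toEquiv.subsingleton_congr.2
        ⟨fun f g => by ext x; obtain rfl : x = 0 := Subsingleton.elim _ _; simp⟩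
  · intro N _ _ _ p e hsupp j hj
    rw [e.support_eq] at hsupp
    refine EE_equiv e j ?_
    have hmem : ∀ q : PrimeSpectrum R, q ∈ Module.support R (R ⧸ p.asIdeal) ↔ p.asIdeal ≤ q.asIdeal := by
      intro q
      rw [Module.mem_support_iff_of_finite, Ideal.annihilator_quotient]
    by_cases hp : p.asIdeal = maximalIdeal R
    · refine ModuleCat.subsingleton_ext_of_exists_isRegular (maximalIdeal R) (ModuleCat.of R (R ⧸ p.asIdeal)) ?_
        (ModuleCat.of R R) ?_ rs hrs hreg j (by omega)
      · intro q hq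
        have := (hmem q).1 hq
        rw [hp] at this
        exact this
      · simpa [lt_top_iff_ne_top] using (Ideal.IsPrime.ne_top (inferInstance : (maximalIdeal R).IsPrime))
    · have hle : p.asIdeal ≤ maximalIdeal R := IsLocalRing.le_maximalIdeal p.2.ne_top
      obtain ⟨x, hxm, hxp⟩ : ∃ x ∈ maximalIdeal R, x ∉ p.asIdeal := by
        by_contra! hcon
        exact hp (le_antisymm hle hcon)
      have hpd := hsupp p ((hmem p).2 le_rfl)
      have hdm := (dim_drop p.asIdeal (maximalIdeal R) hle x hxp hxm).trans hpd
      have hc : 0 < c := by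
        by_contra hc
        obtain rfl : c = 0 := by omega
        have h0 : (0 : WithBot ℕ∞) ≤ ringKrullDim (R ⧸ maximalIdeal R) := ringKrullDim_nonneg_of_nontrivial
        have : (0 : WithBot ℕ∞) + 1 ≤ (0 : ℕ) := (add_le_add h0 le_rfl).trans hdm
        have h1 : ((0 + 1 : ℕ) : WithBot ℕ∞) ≤ ((0 : ℕ) : WithBot ℕ∞) := by exact_mod_cast this
        exact absurd (Nat.cast_le.1 h1) (by decide)
      obtain ⟨c, rfl⟩ : ∃ c', c = c' + 1 := ⟨c - 1, by omega⟩
      let f : (R ⧸ p.asIdeal) →ₗ[R] (R ⧸ p.asIdeal) := x • LinearMap.id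
      have hf : Function.Injective f := by
        rw [injective_iff_map_eq_zero]
        intro y hy
        obtain ⟨r, rfl⟩ := Ideal.Quotient.mk_surjective y
        have : Ideal.Quotient.mk p.asIdeal (x * r) = 0 := hy
        rw [Ideal.Quotient.eq_zero_iff_mem] at this ⊢
        exact (p.2.mem_or_mem this).resolve_left hxp
      have hq : Subsingleton (EE R ((R ⧸ p.asIdeal) ⧸ LinearMap.range f) R (j+1)) := by
        refine ih c (by omega) _ ?_ (j+1) (by omega)
        intro q hq
        have hann := Module.annihilator_le_of_mem_support hq
        have hpq : p.asIdeal ≤ q.asIdeal := by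
          refine le_trans ?_ hann
          refine le_trans (Ideal.annihilator_quotient (I := p.asIdeal)).ge ?_
          exact (LinearMap.range f).mkQ.annihilator_le_of_surjective (Submodule.mkQ_surjective _)
        have hxq : x ∈ q.asIdeal := by
          refine hann ?_
          rw [Module.mem_annihilator]
          intro y
          obtain ⟨y, rfl⟩ := Submodule.mkQ_surjective _ y
          rw [← map_smul, Submodule.mkQ_apply, Submodule.Quotient.mk_eq_zero]
          exact ⟨y, rfl⟩
        have := (dim_drop p.asIdeal q.asIdeal hpq x hxp hxq).trans hpd
        have h3 : ringKrullDim (R ⧸ q.asIdeal) + ((1 : ℕ) : WithBot ℕ∞) ≤ (c : WithBot ℕ∞) + ((1 : ℕ) : WithBot ℕ∞) := by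
          simpa using this
        exact (ENat.WithBot.add_le_add_natCast_right_iff).1 h3
      have hfin : Module.Finite R (EE R (R ⧸ p.asIdeal) R j) := ModuleCat.finite_ext R (ModuleCat.of R (R ⧸ p.asIdeal)) (ModuleCat.of R R) j
      have := Submodule.eq_bot_of_le_smul_of_le_jacobson_bot (maximalIdeal R) (⊤ : Submodule R (EE R (R ⧸ p.asIdeal) R j)) hfin.fg_top ?_
        (by rw [IsLocalRing.jacobson_eq_maximalIdeal _ bot_ne_top])
      · exact (Submodule.subsingleton_iff R).1 (subsingleton_of_bot_eq_top this.symm)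
      · intro e _
        obtain ⟨e', rfl⟩ := EE_smul_surj x f rfl hf j hq e
        exact Submodule.smul_mem_smul hxm trivial
  · intro A _ _ _ B _ _ _ C _ _ _ f g hf hg hfg hA hC hB j hj
    rw [Module.support_of_exact hfg hf hg] at hB
    exact EE_mid f g hf hg hfg j (hA (fun q hq => hB q (Or.inl hq)) j hj) (hC (fun q hq => hB q (Or.inr hq)) j hj)

theorem fac_of_free {R : Type} [CommRing R] [IsNoetherianRing R] {M : Type} [AddCommGroup M] [Module R M]
    [Module.Finite R M] (p : Ideal R) [p.IsPrime]
    (h : Module.Free (Localization.AtPrime p) (LocalizedModule p.primeCompl M)) :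
    ∃ s ∉ p, ∃ (n : ℕ) (π : (Fin n → R) →ₗ[R] M) (σ : M →ₗ[R] (Fin n → R)),
      π ∘ₗ σ = s • LinearMap.id := by
  obtain ⟨n, π, hπ⟩ := Module.Finite.exists_fin' R M
  have := Module.finitePresentation_of_finite R M
  let S := p.primeCompl
  let mF := LocalizedModule.mkLinearMap S (Fin n → R)
  let mM := LocalizedModule.mkLinearMap S M
  let πp : LocalizedModule S (Fin n → R) →ₗ[Localization S] LocalizedModule S M := LocalizedModule.map S π
  have hπp : Function.Surjective πp := LocalizedModule.map_surjective S π hπ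
  have : Module.Projective (Localization S) (LocalizedModule S M) := 
    @Module.Projective.of_free _ _ _ _ _ h
  obtain ⟨τ, hτ⟩ := Module.projective_lifting_property πp LinearMap.id hπp
  obtain ⟨σ, s, hσ⟩ := Module.FinitePresentation.exists_lift_of_isLocalizedModule S mF
    ((τ.restrictScalars R) ∘ₗ mM)
  have h1 : mM ∘ₗ (π ∘ₗ σ) = mM ∘ₗ ((s : R) • LinearMap.id) := by
    ext x
    have h2 := LinearMap.congr_fun hσ x
    have h3 : πp (mF (σ x)) = mM (π (σ x)) := LocalizedModule.map_mk ..
    have h4 : mF (σ x) = (s : R) • τ (mM x) := h2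
    have h5 : πp (τ (mM x)) = mM x := LinearMap.congr_fun hτ _
    have h6 : πp ((s : R) • τ (mM x)) = (s : R) • πp (τ (mM x)) := LinearMap.map_smul_of_tower πp _ _
    rw [h4, h6, h5] at h3
    simpa using h3.symm
  obtain ⟨t, ht⟩ := Module.Finite.exists_smul_of_comp_eq_of_isLocalizedModule S mM _ _ h1
  refine ⟨t * s, (t * s).2, n, π, (t : R) • σ, ?_⟩
  rw [LinearMap.comp_smul, mul_smul]
  exact ht

theorem EE_smul_zero {R : Type} [CommRing R] {M F L : Type} [AddCommGroup M] [Module R M]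
    [AddCommGroup F] [Module R F] [Module.Projective R F]
    [AddCommGroup L] [Module R L] (s : R) (π : F →ₗ[R] M) (σ : M →ₗ[R] F) 
    (h : π ∘ₗ σ = s • LinearMap.id) (j : ℕ) (e : EE R M L (j+1)) : s • e = 0 := by
  have h1 : s • e = (Ext.mk₀ (s • 𝟙 (ModuleCat.of R M))).comp e (zero_add _) := by
    rw [Ext.mk₀_smul, Ext.smul_comp, Ext.mk₀_id_comp]
  have h2 : s • 𝟙 (ModuleCat.of R M) = ModuleCat.ofHom σ ≫ ModuleCat.ofHom π := by
    rw [← ModuleCat.ofHom_comp, h]; rfl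
  rw [h1, h2, ← Ext.mk₀_comp_mk₀_assoc,
    (EE_proj (R := R) (A := F) (L := L) j).elim ((Ext.mk₀ (ModuleCat.ofHom π)).comp e (zero_add _)) 0]
  exact Ext.comp_zero _ _ _ _ _

/-- main vanishing, with the factorization property -/
theorem ext_ext_vanish (R : Type) [CommRing R] [IsNoetherianRing R] [IsLocalRing R] (rs : List R)
    (hrs : ∀ r ∈ rs, r ∈ maximalIdeal R) (hreg : IsRegular R rs) (c : ℕ)
    (M : Type) [AddCommGroup M] [Module R M] [Module.Finite R M]
    (hM : ∀ (p : Ideal R) (_ : p.IsPrime), (c : WithBot ℕ∞) < ringKrullDim (R ⧸ p) → 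
      ∃ s ∉ p, ∃ (n : ℕ) (π : (Fin n → R) →ₗ[R] M) (σ : M →ₗ[R] (Fin n → R)),
      π ∘ₗ σ = s • LinearMap.id) (i j : ℕ) (hj : j + c < rs.length) :
    Subsingleton (EE R (EE R M R (i+1)) R j) := by
  have hfin : Module.Finite R (EE R M R (i+1)) := ModuleCat.finite_ext R (ModuleCat.of R M) (ModuleCat.of R R) (i+1)
  refine ischebeck R rs hrs hreg c _ ?_ j hj
  intro q hq
  by_contra! hcon
  obtain ⟨s, hs, n, π, σ, h⟩ := hM q.asIdeal q.2 hcon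
  refine hs (Module.annihilator_le_of_mem_support hq ?_)
  rw [Module.mem_annihilator]
  exact fun e => EE_smul_zero s π σ h i e

theorem fac_dual {R : Type} [CommRing R] {M : Type} [AddCommGroup M] [Module R M] (s : R)
    (h : ∃ (n : ℕ) (π : (Fin n → R) →ₗ[R] M) (σ : M →ₗ[R] (Fin n → R)),
      π ∘ₗ σ = s • LinearMap.id) :
    ∃ (n : ℕ) (π : (Fin n → R) →ₗ[R] Module.Dual R M) (σ : Module.Dual R M →ₗ[R] (Fin n → R)),
      π ∘ₗ σ = s • LinearMap.id := by
  obtain ⟨n, π, σ, h⟩ := h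
  let e : Module.Dual R (Fin n → R) ≃ₗ[R] (Fin n → R) := (Pi.basisFun R (Fin n)).toDualEquiv.symm
  refine ⟨n, σ.dualMap ∘ₗ e.symm.toLinearMap, e.toLinearMap ∘ₗ π.dualMap, ?_⟩
  ext f x
  have := LinearMap.congr_fun h x
  have h2 : π (σ x) = s • x := this
  simp [h2]

section
variable {R : Type} [CommRing R] {K F M : Type} [AddCommGroup K] [Module R K]
  [AddCommGroup F] [Module R F] [AddCommGroup M] [Module R M]

theorem dual_conn [Module.Projective R F] (f : K →ₗ[R] F) (g : F →ₗ[R] M) (hf : Function.Injective f)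
    (hg : Function.Surjective g) (hfg : Function.Exact f g) :
    ∃ δ : Module.Dual R K →ₗ[R] EE R M R 1, Function.Surjective δ ∧ Function.Exact f.dualMap δ := by
  have hs := ses_mk f g hf hg hfg
  let e₁ : Module.Dual R K ≃ₗ[R] EE R K R 0 :=
    (ModuleCat.homLinearEquiv (S := R) (M := ModuleCat.of R K) (N := ModuleCat.of R R)).symm.trans (Ext.linearEquiv₀ (R := R)).symm
  have he₁ : ∀ φ, e₁ φ = Ext.mk₀ (ModuleCat.ofHom φ) := fun φ => by
    apply (Ext.linearEquiv₀ (R := R)).injective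
    simp [e₁]
    rfl
  refine ⟨(hs.extClass.precompOfLinear R (ModuleCat.of R R) (add_comm 1 0)) ∘ₗ e₁.toLinearMap, ?_, ?_⟩
  · intro x
    obtain ⟨y, hy⟩ := Ext.contravariant_sequence_exact₃ hs (ModuleCat.of R R) x
      ((EE_proj (R := R) (A := F) (L := R) 0).elim _ _) (add_comm 1 0)
    refine ⟨e₁.symm y, ?_⟩
    simpa using hy
  · intro φ
    constructor
    · intro h
      obtain ⟨y, hy⟩ := Ext.contravariant_sequence_exact₁ hs (ModuleCat.of R R) (e₁ φ)
        (add_comm 1 0) h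
      obtain ⟨ψ, rfl⟩ := (Ext.mk₀_bijective _ _).2 y
      refine ⟨ψ.hom, ?_⟩
      apply e₁.injective
      rw [← hy, he₁, Ext.mk₀_comp_mk₀]
      rfl
    · rintro ⟨ψ, rfl⟩
      have h1 : e₁ (f.dualMap ψ) = (Ext.mk₀ (ModuleCat.ofHom f)).comp (Ext.mk₀ (ModuleCat.ofHom ψ)) (zero_add 0) := by
        rw [he₁, Ext.mk₀_comp_mk₀]; rfl
      change hs.extClass.comp (e₁ (f.dualMap ψ)) (add_comm 1 0) = 0
      rw [h1]
      exact hs.extClass_comp_assoc (Ext.mk₀ (ModuleCat.ofHom ψ))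

theorem dual_exact (f : K →ₗ[R] F) (g : F →ₗ[R] M) 
    (hg : Function.Surjective g) (hfg : Function.Exact f g) : 
    Function.Injective g.dualMap ∧ Function.Exact g.dualMap f.dualMap.rangeRestrict := by
  refine ⟨LinearMap.dualMap_injective_of_surjective hg, ?_⟩
  intro φ
  constructor
  · intro h
    have h1 : f.dualMap φ = 0 := congrArg Subtype.val h
    have h2 : LinearMap.ker g ≤ LinearMap.ker φ := by
      intro x hx
      obtain ⟨y, rfl⟩ := (hfg x).1 hx
      exact LinearMap.congr_fun h1 y
    have h3 : φ ∈ LinearMap.range g.dualMap := by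
      rw [LinearMap.range_dualMap_eq_dualAnnihilator_ker_of_surjective g hg, Submodule.mem_dualAnnihilator]
      exact fun w hw => h2 hw
    exact h3
  · rintro ⟨ψ, rfl⟩
    apply Subtype.ext
    ext x
    change ψ (g (f x)) = 0
    rw [hfg.apply_apply_eq_zero, map_zero]
end

/-- Projective dimension at most `d`, in terms of `EE`. -/
def PDle (R : Type) [CommRing R] (M : Type) [AddCommGroup M] [Module R M] (d : ℕ) : Prop :=
  ∀ (L : Type) [AddCommGroup L] [Module R L], Subsingleton (EE R M L (d+1))

theorem PDle.projective {R : Type} [CommRing R] {M : Type} [AddCommGroup M] [Module R M]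
    (h : PDle R M 0) : Module.Projective R M := by
  have : Projective (ModuleCat.of R M) := projective_iff_subsingleton_ext_one.2 fun Y => h Y
  exact (IsProjective.iff_projective (R := R) M).2 this

/-- A presentation with finite free middle term. -/
theorem exists_pres (R : Type) [CommRing R] [IsNoetherianRing R] (M : Type) [AddCommGroup M]
    [Module R M] [Module.Finite R M] : ∃ (K F : Type) (_ : AddCommGroup K) (_ : Module R K)
      (_ : AddCommGroup F) (_ : Module R F) (_ : Module.Finite R K) (_ : Module.Finite R F)
      (_ : Module.Projective R F)
      (f : K →ₗ[R] F) (g : F →ₗ[R] M), Function.Injective f ∧ Function.Surjective g ∧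
        Function.Exact f g := by
  obtain ⟨n, π, hπ⟩ := Module.Finite.exists_fin' R M
  exact ⟨LinearMap.ker π, Fin n → R, inferInstance, inferInstance, inferInstance, inferInstance,
    inferInstance, inferInstance, inferInstance, (LinearMap.ker π).subtype, π,
    Subtype.val_injective, hπ, LinearMap.exact_subtype_ker_map π⟩

theorem lemmaL (R : Type) [CommRing R] [IsNoetherianRing R] (n : ℕ) : ∀ (d : ℕ) (M : Type)
    [AddCommGroup M] [Module R M] [Module.Finite R M], PDle R M d →
    (∀ i j, j < n → Subsingleton (EE R (EE R M R (i+1)) R j)) →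
    ∀ j, j + 1 + d + 1 < n → Subsingleton (EE R (Module.Dual R M) R (j+1)) := by
  intro d
  induction d with
  | zero =>
    intro M _ _ _ hpd _ j _
    have := hpd.projective
    exact EE_proj j
  | succ d ih =>
    intro M _ _ _ hpd hE j hj
    obtain ⟨K, F, _, _, _, _, _, _, _, f, g, hf, hg, hfg⟩ := exists_pres R M
    obtain ⟨δ, hδ, hex⟩ := dual_conn f g hf hg hfg
    obtain ⟨hi, he⟩ := dual_exact f g hg hfg
    have hK : PDle R K d := fun L _ _ => by
      obtain ⟨e⟩ := EE_shift (L := L) f g hf hg hfg d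
      have := hpd L
      exact e.toEquiv.subsingleton
    have h1 := ih K hK (fun i j hj => by
      obtain ⟨e⟩ := EE_shift (L := R) f g hf hg hfg i
      exact EE_equiv e j (hE (i+1) j hj)) (j+1) (by omega)
    have h2 : Subsingleton (EE R (LinearMap.range f.dualMap) R (j+2)) := by
      refine EE_left (LinearMap.range f.dualMap).subtype δ Subtype.val_injective hδ ?_ (j+2) h1
        (hE 0 (j+3) (by omega))
      intro x
      rw [hex x]; simp
    obtain ⟨e⟩ := EE_shift (C := LinearMap.range f.dualMap) (L := R) g.dualMap f.dualMap.rangeRestrict hi f.dualMap.surjective_rangeRestrict he j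
    exact e.toEquiv.subsingleton

theorem lemmaIso (R : Type) [CommRing R] [IsNoetherianRing R] : ∀ (d : ℕ) (M : Type)
    [AddCommGroup M] [Module R M] [Module.Finite R M], PDle R M (d+1) →
    (∀ i < d, Subsingleton (EE R M R (i+1))) →
    ∀ j k, k = j + d + 3 →
      Nonempty (EE R (Module.Dual R M) R (j+1) ≃ₗ[R] EE R (EE R M R (d+1)) R k) := by
  intro d
  induction d with
  | zero =>
    rintro M _ _ _ hpd _ j _ rfl
    obtain ⟨K, F, _, _, _, _, _, _, _, f, g, hf, hg, hfg⟩ := exists_pres R M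
    obtain ⟨δ, hδ, hex⟩ := dual_conn f g hf hg hfg
    obtain ⟨hi, he⟩ := dual_exact f g hg hfg
    have hK : PDle R K 0 := fun L _ _ => by
      obtain ⟨e⟩ := EE_shift (L := L) f g hf hg hfg 0
      have := hpd L
      exact e.toEquiv.subsingleton
    have := hK.projective
    obtain ⟨e⟩ := EE_shift (C := LinearMap.range f.dualMap) (L := R) g.dualMap f.dualMap.rangeRestrict hi f.dualMap.surjective_rangeRestrict he j
    obtain ⟨e'⟩ := EE_shift (A := LinearMap.range f.dualMap) (L := R) (LinearMap.range f.dualMap).subtype δ Subtype.val_injective hδ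
      (fun x => by rw [hex x]; simp) (j+1)
    exact ⟨e.trans e'⟩
  | succ d ih =>
    rintro M _ _ _ hpd hv j k hk
    obtain ⟨K, F, _, _, _, _, _, _, _, f, g, hf, hg, hfg⟩ := exists_pres R M
    obtain ⟨δ, hδ, hex⟩ := dual_conn f g hf hg hfg
    obtain ⟨hi, he⟩ := dual_exact f g hg hfg
    have hK : PDle R K (d+1) := fun L _ _ => by
      obtain ⟨e⟩ := EE_shift (L := L) f g hf hg hfg (d+1)
      have := hpd L
      exact e.toEquiv.subsingleton
    have hsurj : Function.Surjective f.dualMap := fun x =>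
      (hex x).1 ((hv 0 (by omega)).elim _ _)
    obtain ⟨e⟩ := EE_shift (L := R) g.dualMap f.dualMap hi hsurj
      (fun x => by rw [← he x]; exact ⟨fun h => Subtype.ext h, fun h => congrArg Subtype.val h⟩) j
    obtain ⟨e1⟩ := ih K hK (fun i hi => by
      obtain ⟨e⟩ := EE_shift (L := R) f g hf hg hfg i
      have := hv (i+1) (by omega)
      exact e.toEquiv.subsingleton) (j+1) k (by omega)
    obtain ⟨e2⟩ := EE_shift (L := R) f g hf hg hfg d
    obtain ⟨e3⟩ := EE_equivL (L := R) e2 k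
    exact ⟨e.trans (e1.trans e3.symm)⟩

theorem pdLE_of_projDim {R : Type} [CommRing R] {M : ModuleCat.{0} R} {d : ℕ}
    (h : projDim R M = d) : pdLE R M d := by
  have hne : {n : ℕ∞ | ∃ m : ℕ, n = m ∧ pdLE R M m}.Nonempty := by
    by_contra hcon
    rw [Set.not_nonempty_iff_eq_empty] at hcon
    rw [projDim, hcon, sInf_empty] at h
    exact ENat.top_ne_coe d h
  obtain ⟨m, hm, hpd⟩ := csInf_mem hne
  have h1 : (d : ℕ∞) = m := h.symm.trans hm
  obtain rfl : d = m := by exact_mod_cast h1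
  exact hpd

theorem bridge_subsingleton (R : Type) [CommRing R] (M N : Type) [AddCommGroup M] [Module R M]
    [AddCommGroup N] [Module R N] (p : ℕ) :
    Subsingleton (ExtGrp R (ModuleCat.of R M) (ModuleCat.of R N) (p+1)) ↔
      Subsingleton (EE R M N (p+1)) := by
  obtain ⟨e⟩ := bridge R (ModuleCat.of R M) (ModuleCat.of R N) p
  exact e.toLinearEquiv.toEquiv.subsingleton_congr

theorem PDle_of_pdLE {R : Type} [CommRing R] {M : Type} [AddCommGroup M] [Module R M] {d : ℕ}
    (h : pdLE R (ModuleCat.of R M) d) : PDle R M d := fun L _ _ =>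
  (bridge_subsingleton R M L d).1 (h _)

end Helpers

/-- Let `R` be a commutative Noetherian regular local ring of Krull dimension `ℓ`, `c ≥ 0`, and
`M` a finitely generated reflexive non-free `R`-module, free at every prime `p` with
`dim (R/p) > c`.  If `pd_R M + pd_R M^∨ = ℓ - 1 - c` (with `pd_R M = d`, `pd_R M^∨ = a`), then
`M` is `d`-spherical, `M^∨` is `(ℓ - d - 1 - c) = a`-spherical, and
`Ext^a_R(M^∨, R) ≅ Ext^{ℓ-c}_R(Ext^d_R(M, R), R)`. -/
theorem spherical_of_pd_add_pd_dual_eq (R : Type) [CommRing R] [IsNoetherianRing R]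
    [IsLocalRing R] (ℓ c : ℕ)
    (hdim : ringKrullDim R = ℓ)
    (hreg : ∃ s : Finset R, s.card = ℓ ∧ Ideal.span (s : Set R) = IsLocalRing.maximalIdeal R)
    (M : Type) [AddCommGroup M] [Module R M] [Module.Finite R M]
    (hrefl : Module.IsReflexive R M)
    (hnotfree : ¬ Module.Free R M)
    (hloc : ∀ (p : Ideal R) (_ : p.IsPrime), (c : WithBot ℕ∞) < ringKrullDim (R ⧸ p) →
      Module.Free (Localization.AtPrime p) (LocalizedModule p.primeCompl M))
    (d a : ℕ)
    (hd : projDim R (ModuleCat.of R M) = d)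
    (ha : projDim R (ModuleCat.of R (Module.Dual R M)) = a)
    (heq : (d : ℤ) + a = (ℓ : ℤ) - 1 - c) :
    Spherical R (ModuleCat.of R M) d ∧
    Spherical R (ModuleCat.of R (Module.Dual R M)) (ℓ - d - 1 - c) ∧
    Nonempty (ExtGrp R (ModuleCat.of R (Module.Dual R M)) (ModuleCat.of R R) a ≅
      ExtGrp R (ExtGrp R (ModuleCat.of R M) (ModuleCat.of R R) d) (ModuleCat.of R R) (ℓ - c)) := by
  classical
  obtain ⟨s, hcard, hspan⟩ := hreg
  have hof : Ideal.ofList s.toList = IsLocalRing.maximalIdeal R := by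
    rw [← hspan, Ideal.ofList]
    congr 1
    ext x
    simp
  have hlen : s.toList.length = ℓ := by simp [hcard]
  obtain ⟨-, hregular⟩ := reg_aux ℓ R s.toList hlen hof hdim
  have hmem : ∀ r ∈ s.toList, r ∈ IsLocalRing.maximalIdeal R := fun r hr => by
    rw [← hof]; exact Ideal.subset_span hr
  have hd' := pdLE_of_projDim hd
  have ha' := pdLE_of_projDim ha
  have hdP : PDle R M d := PDle_of_pdLE hd'
  have haP : PDle R (Module.Dual R M) a := PDle_of_pdLE ha'
  let ev : M ≃ₗ[R] Module.Dual R (Module.Dual R M) := Module.evalEquiv R M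
  have hd0 : d ≠ 0 := by
    rintro rfl
    have := hdP.projective
    exact hnotfree Module.free_of_flat_of_isLocalRing
  have ha0 : a ≠ 0 := by
    rintro rfl
    have := haP.projective
    have : Module.Projective R M := Module.Projective.of_equiv ev.symm
    exact hnotfree Module.free_of_flat_of_isLocalRing
  have hfac : ∀ (p : Ideal R) (_ : p.IsPrime), (c : WithBot ℕ∞) < ringKrullDim (R ⧸ p) →
      ∃ s ∉ p, ∃ (n : ℕ) (π : (Fin n → R) →ₗ[R] M) (σ : M →ₗ[R] (Fin n → R)),
      π ∘ₗ σ = s • LinearMap.id := fun p hp hc => fac_of_free p (hloc p hp hc)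
  have hfac' : ∀ (p : Ideal R) (_ : p.IsPrime), (c : WithBot ℕ∞) < ringKrullDim (R ⧸ p) →
      ∃ s ∉ p, ∃ (n : ℕ) (π : (Fin n → R) →ₗ[R] Module.Dual R M)
        (σ : Module.Dual R M →ₗ[R] (Fin n → R)), π ∘ₗ σ = s • LinearMap.id := fun p hp hc => by
    obtain ⟨s, hs, h⟩ := hfac p hp hc
    exact ⟨s, hs, fac_dual s h⟩
  have hE := ext_ext_vanish R s.toList hmem hregular c M hfac
  have hE' := ext_ext_vanish R s.toList hmem hregular c (Module.Dual R M) hfac'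
  rw [hlen] at hE hE'
  have v1 := lemmaL R (ℓ - c) d M hdP (fun i j hj => hE i j (by omega))
  have v2 := lemmaL R (ℓ - c) a (Module.Dual R M) haP (fun i j hj => hE' i j (by omega))
  have v3 : ∀ j, j + 1 + a + 1 < ℓ - c → Subsingleton (EE R M R (j+1)) := fun j hj =>
    EE_equiv ev (j+1) (v2 j hj)
  have hla : ℓ - d - 1 - c = a := by omega
  refine ⟨⟨hd', ?_⟩, ⟨by rw [hla]; exact ha', ?_⟩, ?_⟩
  · intro i h1 h2
    obtain ⟨i, rfl⟩ : ∃ i', i = i' + 1 := ⟨i - 1, by omega⟩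
    exact (bridge_subsingleton R M R i).2 (v3 i (by omega))
  · intro i h1 h2
    obtain ⟨i, rfl⟩ : ∃ i', i = i' + 1 := ⟨i - 1, by omega⟩
    exact (bridge_subsingleton R (Module.Dual R M) R i).2 (v1 i (by omega))
  · obtain ⟨d, rfl⟩ : ∃ i', d = i' + 1 := ⟨d - 1, by omega⟩
    obtain ⟨a, rfl⟩ : ∃ i', a = i' + 1 := ⟨a - 1, by omega⟩
    obtain ⟨k, hk⟩ : ∃ k, ℓ - c = k + 1 := ⟨ℓ - c - 1, by omega⟩
    rw [hk]
    obtain ⟨e⟩ := lemmaIso R d M hdP (fun i hi => v3 i (by omega)) a (k+1) (by omega)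
    obtain ⟨b1⟩ := bridge R (ModuleCat.of R (Module.Dual R M)) (ModuleCat.of R R) a
    obtain ⟨b2⟩ := bridge R (ModuleCat.of R M) (ModuleCat.of R R) d
    obtain ⟨b3⟩ := bridge R (ExtGrp R (ModuleCat.of R M) (ModuleCat.of R R) (d+1))
      (ModuleCat.of R R) k
    obtain ⟨b4⟩ := EE_equivL (L := R) b2.toLinearEquiv (k+1)
    exact ⟨b1 ≪≫ (e.trans b4).toModuleIso ≪≫ b3.symm⟩
end

section
/- Let R be a commutative Noetherian regular local ring of Krull dimension ℓ and let M be a finitely generated d-spherical R-module, with 0 < d < ℓ, such that M_p is a free R_p-module for every non-maximal prime ideal p of R. Then M is an (ℓ − d)-syzygy and M^∨ = Hom_R(M, R) is a (d + 1)-syzygy. -/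
open CategoryTheory

/-- `M` is an `r`-syzygy: there is an exact sequence `0 → M → P_r → P_{r-1} → ⋯ → P_1`
with every `P_i` finitely generated free.  Here `P_i = Fin (n i) → R`, the map
`d i : P_{i+1} → P_i` for `1 ≤ i ≤ r - 1`, and `f : M → P_r`; exactness holds at `M`,
`P_r, …, P_2`. -/
def IsSyzygy (R : Type) [CommRing R] (M : Type) [AddCommGroup M] [Module R M] (r : ℕ) : Prop :=
  ∃ (n : ℕ → ℕ) (d : (i : ℕ) → (Fin (n (i + 1)) → R) →ₗ[R] (Fin (n i) → R))
    (f : M →ₗ[R] (Fin (n ((r - 1) + 1)) → R)),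
    Function.Injective f ∧
    (1 < r → LinearMap.range f = LinearMap.ker (d (r - 1))) ∧
    (∀ i : ℕ, 1 ≤ i → i + 1 ≤ r - 1 → LinearMap.range (d (i + 1)) = LinearMap.ker (d i))


open Abelian in
lemma ext_subsingleton_of_extGrp {R : Type} [CommRing R] (M N : ModuleCat.{0} R) (n : ℕ)
    (h : Subsingleton (ExtGrp R M N (n + 1))) : Subsingleton (Abelian.Ext M N (n + 1)) := by
  let P := projectiveResolution M
  have h1 : Limits.IsZero (((_root_.Ext R (ModuleCat R) (n+1)).obj (Opposite.op M)).obj N) :=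
    (ModuleCat.isZero_of_iff_subsingleton).2 h
  have h2 := h1.of_iso (P.isoExt (R := R) (n+1) N).symm
  rw [← HomologicalComplex.exactAt_iff_isZero_homology,
    HomologicalComplex.exactAt_iff' _ n (n+1) (n+2) (by simp) (by simp),
    ShortComplex.moduleCat_exact_iff] at h2
  suffices ∀ a : Abelian.Ext M N (n+1), a = 0 from ⟨fun a b => by rw [this a, this b]⟩
  intro a
  obtain ⟨f, hf, rfl⟩ := P.extMk_surjective a (n+2) rfl
  rw [P.extMk_eq_zero_iff f (n+2) rfl hf n rfl]
  obtain ⟨g, hg⟩ := h2 f hf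
  exact ⟨g, hg⟩

lemma hpd_of_pdLE {R : Type} [CommRing R] (M : ModuleCat.{0} R) (d : ℕ) (h : pdLE R M d) :
    HasProjectiveDimensionLT M (d + 1) :=
  hasProjectiveDimensionLT_of_enoughInjectives M (d+1)
    fun Y => ext_subsingleton_of_extGrp M Y d (h Y)

lemma exists_linear_shortExact {R : Type} [CommRing R] {A B C : Type} [AddCommGroup A] [AddCommGroup B]
    [AddCommGroup C] [Module R A] [Module R B] [Module R C] (f : A →ₗ[R] B) (g : B →ₗ[R] C)
    (hf : Function.Injective f) (hg : Function.Surjective g) (hfg : LinearMap.range f = LinearMap.ker g) :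
    ∃ h, (ShortComplex.mk (ModuleCat.ofHom f) (ModuleCat.ofHom g) h).ShortExact := by
  have h : ModuleCat.ofHom f ≫ ModuleCat.ofHom g = 0 := by
    ext x
    have : f x ∈ LinearMap.ker g := hfg ▸ ⟨x, rfl⟩
    simpa using this
  refine ⟨h, ?_⟩
  have e : (ShortComplex.mk (ModuleCat.ofHom f) (ModuleCat.ofHom g) h).Exact := by
    rw [ShortComplex.moduleCat_exact_iff_range_eq_ker]
    exact hfg
  exact { exact := e
          mono_f := (ModuleCat.mono_iff_injective _).2 hf
          epi_g := (ModuleCat.epi_iff_surjective _).2 hg }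

/-- extension of functionals from vanishing of Ext^1 -/
lemma extend_of_ext_one {R : Type} [CommRing R] {A B C N : Type} [AddCommGroup A] [AddCommGroup B]
    [AddCommGroup C] [AddCommGroup N] [Module R A] [Module R B] [Module R C] [Module R N]
    (f : A →ₗ[R] B) (g : B →ₗ[R] C)
    (hf : Function.Injective f) (hg : Function.Surjective g) (hfg : LinearMap.range f = LinearMap.ker g)
    (hE : Subsingleton (Abelian.Ext (ModuleCat.of R C) (ModuleCat.of R N) 1)) (φ : A →ₗ[R] N) :
    ∃ ψ : B →ₗ[R] N, ψ ∘ₗ f = φ := by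
  obtain ⟨h, hS⟩ := exists_linear_shortExact f g hf hg hfg
  obtain ⟨x, hx⟩ := Abelian.Ext.contravariant_sequence_exact₁ hS (ModuleCat.of R N)
    (Abelian.Ext.mk₀ (ModuleCat.ofHom φ)) (add_zero 1) (Subsingleton.elim _ _)
  obtain ⟨y, rfl⟩ := Abelian.Ext.homEquiv₀.symm.surjective x
  rw [Abelian.Ext.homEquiv₀_symm_apply, Abelian.Ext.mk₀_comp_mk₀] at hx
  have := (Abelian.Ext.mk₀_bijective _ _).1 hx
  refine ⟨y.hom, ?_⟩
  have := congrArg ModuleCat.Hom.hom this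
  simpa using this

lemma ext_shift {R : Type} [CommRing R] {A B C N : Type} [AddCommGroup A] [AddCommGroup B]
    [AddCommGroup C] [AddCommGroup N] [Module R A] [Module R B] [Module R C] [Module R N]
    [Module.Free R B]
    (f : A →ₗ[R] B) (g : B →ₗ[R] C)
    (hf : Function.Injective f) (hg : Function.Surjective g) (hfg : LinearMap.range f = LinearMap.ker g)
    (n : ℕ)
    (hE : Subsingleton (Abelian.Ext (ModuleCat.of R C) (ModuleCat.of R N) (n + 2))) :
    Subsingleton (Abelian.Ext (ModuleCat.of R A) (ModuleCat.of R N) (n + 1)) := by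
  obtain ⟨h, hS⟩ := exists_linear_shortExact f g hf hg hfg
  have : Projective (ModuleCat.of R B) := (IsProjective.iff_projective B).1 inferInstance
  suffices ∀ a : Abelian.Ext (ModuleCat.of R A) (ModuleCat.of R N) (n + 1), a = 0 from
    ⟨fun a b => by rw [this a, this b]⟩
  intro a
  obtain ⟨x, hx⟩ := Abelian.Ext.contravariant_sequence_exact₁ hS (ModuleCat.of R N)
    a (n₁ := n + 2) (by omega) (Subsingleton.elim _ _)
  rw [← hx, Abelian.Ext.eq_zero_of_projective x, Abelian.Ext.comp_zero]

/-- depth shift: covariant -/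
lemma ext_coshift {R : Type} [CommRing R] {A B C : Type} [AddCommGroup A] [AddCommGroup B]
    [AddCommGroup C] [Module R A] [Module R B] [Module R C] (K : ModuleCat.{0} R)
    (f : A →ₗ[R] B) (g : B →ₗ[R] C)
    (hf : Function.Injective f) (hg : Function.Surjective g) (hfg : LinearMap.range f = LinearMap.ker g)
    (n : ℕ)
    (hB : Subsingleton (Abelian.Ext K (ModuleCat.of R B) n))
    (hA : Subsingleton (Abelian.Ext K (ModuleCat.of R A) (n + 1))) :
    Subsingleton (Abelian.Ext K (ModuleCat.of R C) n) := by
  obtain ⟨h, hS⟩ := exists_linear_shortExact f g hf hg hfg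
  suffices ∀ a : Abelian.Ext K (ModuleCat.of R C) n, a = 0 from
    ⟨fun a b => by rw [this a, this b]⟩
  intro a
  obtain ⟨x, hx⟩ := Abelian.Ext.covariant_sequence_exact₃ K hS a rfl (Subsingleton.elim _ _)
  rw [← hx, Subsingleton.elim x 0, Abelian.Ext.zero_comp]

lemma ext_mid {R : Type} [CommRing R] {A B C : Type} [AddCommGroup A] [AddCommGroup B]
    [AddCommGroup C] [Module R A] [Module R B] [Module R C] (K : ModuleCat.{0} R)
    (f : A →ₗ[R] B) (g : B →ₗ[R] C)
    (hf : Function.Injective f) (hg : Function.Surjective g) (hfg : LinearMap.range f = LinearMap.ker g)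
    (n : ℕ)
    (hA : Subsingleton (Abelian.Ext K (ModuleCat.of R A) n))
    (hC : Subsingleton (Abelian.Ext K (ModuleCat.of R C) n)) :
    Subsingleton (Abelian.Ext K (ModuleCat.of R B) n) := by
  obtain ⟨h, hS⟩ := exists_linear_shortExact f g hf hg hfg
  suffices ∀ a : Abelian.Ext K (ModuleCat.of R B) n, a = 0 from
    ⟨fun a b => by rw [this a, this b]⟩
  intro a
  obtain ⟨x, hx⟩ := Abelian.Ext.covariant_sequence_exact₂ K hS a (Subsingleton.elim _ _)
  rw [← hx, Subsingleton.elim x 0, Abelian.Ext.zero_comp]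

lemma ext_pi {R : Type} [CommRing R] (K : ModuleCat.{0} R) (n : ℕ)
    (hA : Subsingleton (Abelian.Ext K (ModuleCat.of R R) n)) (m : ℕ) :
    Subsingleton (Abelian.Ext K (ModuleCat.of R (Fin m → R)) n) := by
  induction m with
  | zero =>
    suffices ∀ a : Abelian.Ext K (ModuleCat.of R (Fin 0 → R)) n, a = 0 from
      ⟨fun a b => by rw [this a, this b]⟩
    intro a
    have : (𝟙 (ModuleCat.of R (Fin 0 → R))) = 0 := by
      ext x i; exact i.elim0
    rw [← a.comp_mk₀_id, this, Abelian.Ext.mk₀_zero, Abelian.Ext.comp_zero]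
  | succ m ih =>
    refine ext_mid K (LinearMap.single R (fun _ : Fin (m+1) => R) 0)
      (LinearMap.funLeft R R (Fin.succ : Fin m → Fin (m+1))) ?_ ?_ ?_ n hA ih
    · exact Pi.single_injective (M := fun _ : Fin (m+1) => R) 0
    · exact LinearMap.funLeft_surjective_of_injective _ _ _ (Fin.succ_injective m)
    · ext x
      simp only [LinearMap.mem_range, LinearMap.mem_ker]
      constructor
      · rintro ⟨y, rfl⟩
        ext i
        simp [LinearMap.funLeft_apply]
      · intro h
        refine ⟨x 0, ?_⟩
        ext i
        refine Fin.cases ?_ (fun j => ?_) i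
        · simp
        · have := congrFun h j
          simp [LinearMap.funLeft_apply] at this
          simp [this]

lemma syz_one {R : Type} [CommRing R] {A : Type} [AddCommGroup A] [Module R A] (n : ℕ)
    (f : A →ₗ[R] (Fin n → R)) (hf : Function.Injective f) : IsSyzygy R A 1 :=
  ⟨fun _ => n, fun _ => 0, f, hf, by omega, by intros; omega⟩

lemma syz_succ {R : Type} [CommRing R] {A B : Type} [AddCommGroup A] [Module R A]
    [AddCommGroup B] [Module R B] (m : ℕ) (ι : A →ₗ[R] (Fin m → R)) (g : (Fin m → R) →ₗ[R] B)
    (hι : Function.Injective ι) (hg : Function.Surjective g)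
    (hex : LinearMap.range ι = LinearMap.ker g) (r : ℕ) (hr : 1 ≤ r) (hB : IsSyzygy R B r) :
    IsSyzygy R A (r + 1) := by
  obtain ⟨n, d, f, hf, h1, h2⟩ := hB
  obtain ⟨r, rfl⟩ : ∃ k, r = k + 1 := ⟨r - 1, by omega⟩
  change B →ₗ[R] (Fin (n (r + 1)) → R) at f
  change 1 < r + 1 → LinearMap.range f = LinearMap.ker (d r) at h1
  change ∀ i : ℕ, 1 ≤ i → i + 1 ≤ r → LinearMap.range (d (i + 1)) = LinearMap.ker (d i) at h2
  let N : ℕ → ℕ := fun i => if i ≤ r + 1 then n i else m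
  have hN : ∀ i, i ≤ r + 1 → N i = n i := fun i hi => if_pos hi
  have hN' : ∀ i, ¬ i ≤ r + 1 → N i = m := fun i hi => if_neg hi
  let c : ∀ {a b : ℕ}, a = b → (Fin a → R) ≃ₗ[R] (Fin b → R) :=
    fun h => LinearEquiv.funCongrLeft R R (finCongr h.symm)
  have cc : ∀ {a b : ℕ} (h : a = b), c h.symm = (c h).symm := by
    intro a b h; subst h; rfl
  let D : (i : ℕ) → (Fin (N (i + 1)) → R) →ₗ[R] (Fin (N i) → R) := fun i =>
    if h : i + 1 ≤ r + 1 then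
      (c (hN i (by omega))).symm.toLinearMap ∘ₗ d i ∘ₗ (c (hN (i+1) h)).toLinearMap
    else if h' : i = r + 1 then
      (c ((hN i (by omega)).trans (by rw [h']))).symm.toLinearMap ∘ₗ (f ∘ₗ g) ∘ₗ
        (c (hN' (i+1) h)).toLinearMap
    else 0
  have hD1 : ∀ i (h : i + 1 ≤ r + 1), D i =
      (c (hN i (by omega))).symm.toLinearMap ∘ₗ d i ∘ₗ (c (hN (i+1) h)).toLinearMap :=
    fun i h => dif_pos h
  have hD2 : D (r + 1) = (c (hN (r+1) le_rfl)).symm.toLinearMap ∘ₗ (f ∘ₗ g) ∘ₗ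
        (c (hN' (r+1+1) (by omega))).toLinearMap := by
    simp only [D]
    rw [dif_neg (by omega), dif_pos trivial]
  refine ⟨N, D, (c (hN' (r+1+1) (by omega))).symm.toLinearMap ∘ₗ ι, ?_, ?_, ?_⟩
  · rw [LinearMap.coe_comp]
    exact (LinearEquiv.injective _).comp hι
  · intro _
    change _ = LinearMap.ker (D (r+1))
    rw [hD2]
    ext x
    have hx : g (c (hN' (r+1+1) (by omega)) x) = 0 ↔ ∃ y, ι y = c (hN' (r+1+1) (by omega)) x := by
      rw [← LinearMap.mem_ker, ← hex]; rfl
    simp only [LinearMap.mem_range, LinearMap.mem_ker, LinearMap.comp_apply, LinearEquiv.coe_coe,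
      LinearEquiv.symm_apply_eq, map_zero, map_eq_zero_iff f hf, hx]
  · intro i hi hi2
    by_cases h : i = r
    · subst h
      rw [hD2, hD1 i le_rfl]
      have h1' := h1 (by omega)
      ext x
      have hx : d i (c (hN (i+1) (by omega)) x) = 0 ↔ ∃ y, f y = c (hN (i+1) (by omega)) x := by
        rw [← LinearMap.mem_ker, ← h1']; rfl
      simp only [LinearMap.mem_range, LinearMap.mem_ker, LinearMap.comp_apply, LinearEquiv.coe_coe,
        LinearEquiv.symm_apply_eq, map_zero, hx]
      constructor
      · rintro ⟨y, hy⟩; exact ⟨_, hy⟩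
      · rintro ⟨y, hy⟩
        obtain ⟨z, rfl⟩ := hg y
        exact ⟨(c (hN' (i+1+1) (by omega))).symm z, by simpa using hy⟩
    · rw [hD1 i (by omega), hD1 (i+1) (by omega)]
      have h2' := h2 i hi (by omega)
      ext x
      have hx : d i (c (hN (i+1) (by omega)) x) = 0 ↔
          ∃ y, d (i+1) y = c (hN (i+1) (by omega)) x := by
        rw [← LinearMap.mem_ker, ← h2']; rfl
      simp only [LinearMap.mem_range, LinearMap.mem_ker, LinearMap.comp_apply, LinearEquiv.coe_coe,
        LinearEquiv.symm_apply_eq, map_zero, hx]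
      constructor
      · rintro ⟨y, hy⟩; exact ⟨_, hy⟩
      · rintro ⟨y, hy⟩
        exact ⟨(c (hN (i+1+1) (by omega))).symm y, by simpa using hy⟩

/-- multiplication by some `s ∉ p` factors through a finite free module -/
def LFP (R : Type) [CommRing R] [IsLocalRing R] (M : Type) [AddCommGroup M] [Module R M] : Prop :=
  ∀ p : Ideal R, p.IsPrime → p ≠ IsLocalRing.maximalIdeal R → ∃ s : R, s ∉ p ∧
    ∃ (n : ℕ) (a : M →ₗ[R] (Fin n → R)) (b : (Fin n → R) →ₗ[R] M), ∀ x, b (a x) = s • x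

lemma LFP_of_free {R : Type} [CommRing R] [IsNoetherianRing R] [IsLocalRing R]
    {M : Type} [AddCommGroup M] [Module R M] [Module.Finite R M]
    (hloc : ∀ (p : Ideal R) (_ : p.IsPrime), p ≠ IsLocalRing.maximalIdeal R →
      Module.Free (Localization.AtPrime p) (LocalizedModule p.primeCompl M)) : LFP R M := by
  intro p hp hpm
  have hfree := hloc p hp hpm
  have hfp : Module.FinitePresentation R M := Module.finitePresentation_of_finite R M
  let S := p.primeCompl
  let Rp := Localization.AtPrime p
  let Mp := LocalizedModule p.primeCompl M
  have : Module.Finite Rp Mp := inferInstance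
  let B := Module.finBasis Rp Mp
  set n := Module.finrank Rp Mp
  let fM : M →ₗ[R] Mp := LocalizedModule.mkLinearMap S M
  let fR : (Fin n → R) →ₗ[R] (Fin n → Rp) := LinearMap.pi fun i => Algebra.linearMap R Rp ∘ₗ LinearMap.proj i
  have hfR : IsLocalizedModule S fR := by
    have : IsLocalizedModule S (Algebra.linearMap R Rp) := inferInstance
    exact IsLocalizedModule.pi S (fun _ : Fin n => Algebra.linearMap R Rp)
  let e : Mp ≃ₗ[R] (Fin n → Rp) := B.equivFun.restrictScalars R
  obtain ⟨a, s, ha⟩ := Module.FinitePresentation.exists_lift_of_isLocalizedModule S fR (e.toLinearMap ∘ₗ fM)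
  obtain ⟨b, t, hb⟩ := Module.FinitePresentation.exists_lift_of_isLocalizedModule S fM (e.symm.toLinearMap ∘ₗ fR)
  obtain ⟨u, hu⟩ := Module.Finite.exists_smul_of_comp_eq_of_isLocalizedModule S fM
    (b ∘ₗ a) ((t * s) • LinearMap.id) (by
      ext x
      have h1 := fun y => LinearMap.congr_fun hb y
      have h2 := LinearMap.congr_fun ha x
      simp only [LinearMap.comp_apply, LinearMap.smul_apply] at h1 h2 ⊢
      rw [h1, h2]
      simp [mul_smul, Submonoid.smul_def])
  refine ⟨(u * (t * s) : S), (u * (t*s) : S).2, n, a, (u : R) • b, fun x => ?_⟩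
  have := LinearMap.congr_fun hu x
  simpa [mul_smul, Submonoid.smul_def] using this

lemma torsionless {R : Type} [CommRing R] [IsNoetherianRing R] [IsLocalRing R]
    {M : Type} [AddCommGroup M] [Module R M] (h : LFP R M)
    (hk : ∀ x : M, (∀ r ∈ IsLocalRing.maximalIdeal R, r • x = 0) → x = 0)
    (x : M) (hx : ∀ φ : M →ₗ[R] R, φ x = 0) : x = 0 := by
  by_contra hx0
  let T : Submodule R M := ⨅ φ : M →ₗ[R] R, LinearMap.ker φ
  have hxT : x ∈ T := by simpa [T] using hx
  have : Nontrivial T := ⟨⟨x, hxT⟩, 0, fun h => hx0 (by simpa using h)⟩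
  obtain ⟨p, hp⟩ := associatedPrimes.nonempty R T
  have hpp := hp.isPrime
  obtain ⟨y, hy⟩ := ((isAssociatedPrime_iff_exists_injective_linearMap p T).1 hp).2
  let z : T := y 1
  have hz0 : z ≠ 0 := by
    intro h0
    have : (1 : R ⧸ p) = 0 := hy (by rw [map_zero]; exact h0)
    exact one_ne_zero this
  have hann : ∀ r : R, r • z = 0 ↔ r ∈ p := by
    intro r
    rw [show r • z = y (Ideal.Quotient.mk p r) by
      simp only [z]; rw [← map_smul]; congr 1; rw [Algebra.smul_def, mul_one]; rfl]
    rw [map_eq_zero_iff y hy, Ideal.Quotient.eq_zero_iff_mem]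
  by_cases hpm : p = IsLocalRing.maximalIdeal R
  · subst hpm
    apply hz0
    apply Subtype.ext
    exact hk _ fun r hr => congrArg Subtype.val ((hann r).2 hr)
  · obtain ⟨s, hs, n, a, b, hab⟩ := h p hpp hpm
    apply hs
    rw [← hann]
    apply Subtype.ext
    change s • (z : M) = 0
    rw [← hab]
    have hz : a (z : M) = 0 := by
      ext i
      have hz2 := z.2
      simp only [T, Submodule.mem_iInf, LinearMap.mem_ker] at hz2
      exact hz2 (LinearMap.proj i ∘ₗ a)
    rw [hz, map_zero]

lemma hpd_ker {R : Type} [CommRing R] {A B C : Type} [AddCommGroup A] [AddCommGroup B]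
    [AddCommGroup C] [Module R A] [Module R B] [Module R C] [Module.Free R B]
    (f : A →ₗ[R] B) (g : B →ₗ[R] C)
    (hf : Function.Injective f) (hg : Function.Surjective g)
    (hfg : LinearMap.range f = LinearMap.ker g) (n : ℕ) :
    HasProjectiveDimensionLT (ModuleCat.of R C) (n + 2) ↔
    HasProjectiveDimensionLT (ModuleCat.of R A) (n + 1) := by
  obtain ⟨h, hS⟩ := exists_linear_shortExact f g hf hg hfg
  have : Projective (ModuleCat.of R B) := (IsProjective.iff_projective B).1 inferInstance
  exact hS.hasProjectiveDimensionLT_X₃_iff n this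

lemma free_of_hpd {R : Type} [CommRing R] [IsNoetherianRing R] [IsLocalRing R]
    {M : Type} [AddCommGroup M] [Module R M] [Module.Finite R M]
    (h : HasProjectiveDimensionLT (ModuleCat.of R M) 1) :
    ∃ n, Nonempty (M ≃ₗ[R] (Fin n → R)) := by
  have h1 := projective_iff_hasProjectiveDimensionLT_one.2 h
  have : Module.Projective R M := (IsProjective.iff_projective M).2 h1
  have : Module.Free R M := Module.free_of_flat_of_isLocalRing
  exact ⟨_, ⟨(Module.finBasis R M).equivFun⟩⟩

lemma ext_of_hpd {R : Type} [CommRing R] [IsNoetherianRing R] [IsLocalRing R]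
    (K : ModuleCat.{0} R) (ℓ : ℕ)
    (hK : ∀ i < ℓ, Subsingleton (Abelian.Ext K (ModuleCat.of R R) i)) (d : ℕ) :
    ∀ (M : Type) [AddCommGroup M] [Module R M] [Module.Finite R M],
    HasProjectiveDimensionLT (ModuleCat.of R M) (d + 1) → ∀ i, i + d < ℓ →
    Subsingleton (Abelian.Ext K (ModuleCat.of R M) i) := by
  induction d with
  | zero =>
    intro M _ _ _ h i hi
    obtain ⟨n, ⟨e⟩⟩ := free_of_hpd h
    refine ext_coshift K (0 : (Fin 0 → R) →ₗ[R] (Fin n → R)) e.symm.toLinearMap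
      (fun _ _ _ => Subsingleton.elim _ _) e.symm.surjective (by simp) i (ext_pi K i (hK i (by omega)) n) ?_
    suffices ∀ a : Abelian.Ext K (ModuleCat.of R (Fin 0 → R)) (i+1), a = 0 from
      ⟨fun a b => by rw [this a, this b]⟩
    intro a
    have : (𝟙 (ModuleCat.of R (Fin 0 → R))) = 0 := by
      ext x i; exact i.elim0
    rw [← a.comp_mk₀_id, this, Abelian.Ext.mk₀_zero, Abelian.Ext.comp_zero]
  | succ d ih =>
    intro M _ _ _ h i hi
    obtain ⟨m, π, hπ⟩ := Module.Finite.exists_fin' R M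
    have hex : LinearMap.range (LinearMap.ker π).subtype = LinearMap.ker π := by simp
    have h' := (hpd_ker _ π (LinearMap.ker π).injective_subtype hπ hex d).1 h
    exact ext_coshift K _ π (LinearMap.ker π).injective_subtype hπ hex i
      (ext_pi K i (hK i (by omega)) m) (ih _ h' (i+1) (by omega))

lemma soc_zero {R : Type} [CommRing R] [IsLocalRing R]
    {M : Type} [AddCommGroup M] [Module R M]
    (h : Subsingleton (Abelian.Ext (ModuleCat.of R (R ⧸ IsLocalRing.maximalIdeal R))
      (ModuleCat.of R M) 0)) (x : M)
    (hx : ∀ r ∈ IsLocalRing.maximalIdeal R, r • x = 0) : x = 0 := by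
  let φ : (R ⧸ IsLocalRing.maximalIdeal R) →ₗ[R] M :=
    Submodule.liftQ _ (LinearMap.toSpanSingleton R M x) (by
      intro r hr; simpa using hx r hr)
  have h1 : ModuleCat.ofHom φ = 0 := by
    apply (Abelian.Ext.mk₀_bijective _ _).1
    exact Subsingleton.elim _ _
  have h2 : φ = 0 := by
    have := congrArg ModuleCat.Hom.hom h1
    simpa using this
  have h3 : φ (Submodule.Quotient.mk 1) = x := by
    simp only [φ]
    erw [Submodule.liftQ_apply]
    simp
  rw [← h3, h2]; rfl

lemma part_one {R : Type} [CommRing R] [IsNoetherianRing R] [IsLocalRing R] (ℓ : ℕ)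
    (hK : ∀ i < ℓ, Subsingleton (Abelian.Ext
      (ModuleCat.of R (R ⧸ IsLocalRing.maximalIdeal R)) (ModuleCat.of R R) i)) (r : ℕ) :
    ∀ (d : ℕ) (M : Type) [AddCommGroup M] [Module R M] [Module.Finite R M],
    HasProjectiveDimensionLT (ModuleCat.of R M) (d + 1) → LFP R M → d + (r + 1) = ℓ →
    IsSyzygy R M (r + 1) := by
  induction r with
  | zero =>
    intro d M _ _ _ h hL hd
    have hs := ext_of_hpd _ ℓ hK d M h 0 (by omega)
    have ht := torsionless hL (soc_zero hs)
    obtain ⟨m, g, hg⟩ := Module.Finite.exists_fin' R (Module.Dual R M)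
    refine syz_one m (LinearMap.pi fun i => g (Pi.single i 1)) ?_
    rw [injective_iff_map_eq_zero]
    intro x hx
    apply ht
    intro φ
    obtain ⟨v, rfl⟩ := hg φ
    have : (g v) = ∑ i, v i • g (Pi.single i 1) := by
      conv_lhs => rw [pi_eq_sum_univ' v]
      simp [← Pi.single_apply]
    rw [this]
    simp only [LinearMap.sum_apply, LinearMap.smul_apply]
    refine Finset.sum_eq_zero fun i _ => ?_
    have := congrFun hx i
    simp at this
    simp [this]
  | succ r ih =>
    intro d M _ _ _ h hL hd
    have hs := ext_of_hpd _ ℓ hK d M h 0 (by omega)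
    have ht := torsionless hL (soc_zero hs)
    obtain ⟨m, g, hg⟩ := Module.Finite.exists_fin' R (Module.Dual R M)
    let ι : M →ₗ[R] (Fin m → R) := LinearMap.pi fun i => g (Pi.single i 1)
    have hext : ∀ φ : M →ₗ[R] R, ∃ ψ : (Fin m → R) →ₗ[R] R, ∀ x, ψ (ι x) = φ x := by
      intro φ
      obtain ⟨v, rfl⟩ := hg φ
      refine ⟨∑ i, v i • LinearMap.proj i, fun x => ?_⟩
      have : (g v) = ∑ i, v i • g (Pi.single i 1) := by
        conv_lhs => rw [pi_eq_sum_univ' v]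
        simp [← Pi.single_apply]
      rw [this]
      simp [LinearMap.sum_apply, ι]
    have hι : Function.Injective ι := by
      rw [injective_iff_map_eq_zero]
      intro x hx
      apply ht
      intro φ
      obtain ⟨ψ, hψ⟩ := hext φ
      rw [← hψ, hx, map_zero]
    let π := (LinearMap.range ι).mkQ
    have hπ : Function.Surjective π := Submodule.mkQ_surjective _
    have hex : LinearMap.range ι = LinearMap.ker π := (Submodule.ker_mkQ _).symm
    refine syz_succ m ι π hι hπ hex (r+1) (by omega) ?_
    refine ih (d + 1) _ ((hpd_ker ι π hι hπ hex d).2 h) ?_ (by omega)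
    intro p hp hpm
    obtain ⟨s, hs, n, a, b, hab⟩ := hL p hp hpm
    have : ∃ a' : (Fin m → R) →ₗ[R] (Fin n → R), ∀ x, a' (ι x) = a x := by
      choose ψ hψ using fun i => hext (LinearMap.proj i ∘ₗ a)
      refine ⟨LinearMap.pi ψ, fun x => ?_⟩
      ext i
      simp [hψ]
    obtain ⟨a', ha'⟩ := this
    let u : (Fin m → R) →ₗ[R] (Fin m → R) := s • LinearMap.id - ι ∘ₗ b ∘ₗ a'
    let w := Submodule.liftQ (LinearMap.range ι) u (by
      rintro _ ⟨x, rfl⟩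
      simp [u, ha', hab])
    refine ⟨s, hs, m, w, π, fun x => ?_⟩
    obtain ⟨y, rfl⟩ := hπ x
    have h1 : w (π y) = u y := Submodule.liftQ_apply _ _ _
    rw [h1]
    have h2 : ∀ z, π (ι z) = 0 := fun z => by
      rw [← LinearMap.mem_ker, ← hex]; exact ⟨z, rfl⟩
    simp [u, h2]

lemma part_two {R : Type} [CommRing R] [IsNoetherianRing R] [IsLocalRing R] (d : ℕ) :
    ∀ (M : Type) [AddCommGroup M] [Module R M] [Module.Finite R M],
    HasProjectiveDimensionLT (ModuleCat.of R M) (d + 2) →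
    (∀ i, i + 1 ≤ d → Subsingleton (Abelian.Ext (ModuleCat.of R M) (ModuleCat.of R R) (i + 1))) →
    IsSyzygy R (Module.Dual R M) (d + 2) := by
  induction d with
  | zero =>
    intro M _ _ _ h hE
    obtain ⟨m, π, hπ⟩ := Module.Finite.exists_fin' R M
    have hex : LinearMap.range (LinearMap.ker π).subtype = LinearMap.ker π := by simp
    have h' := (hpd_ker _ π (LinearMap.ker π).injective_subtype hπ hex 0).1 h
    obtain ⟨k, ⟨e⟩⟩ := free_of_hpd h'
    let E := (Pi.basisFun R (Fin m)).dualBasis.equivFun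
    let E' := (Pi.basisFun R (Fin k)).dualBasis.equivFun
    let ρ : Module.Dual R (Fin m → R) →ₗ[R] Module.Dual R (LinearMap.ker π) :=
      (LinearMap.ker π).subtype.dualMap
    let G := (ρ ∘ₗ E.symm.toLinearMap).rangeRestrict
    refine syz_succ (B := ↥(LinearMap.range (ρ ∘ₗ E.symm.toLinearMap))) m
      (E.toLinearMap ∘ₗ π.dualMap) G ?_ ?_ ?_ 1 le_rfl ?_
    · rw [LinearMap.coe_comp]
      exact E.injective.comp (LinearMap.dualMap_injective_of_surjective hπ)
    · exact LinearMap.surjective_rangeRestrict _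
    · rw [LinearMap.ker_rangeRestrict, LinearMap.ker_comp, LinearMap.range_comp,
        LinearMap.range_dualMap_eq_dualAnnihilator_ker_of_surjective _ hπ]
      simp only [ρ]
      rw [LinearMap.ker_dualMap_eq_dualAnnihilator_range, hex]
      exact Submodule.map_equiv_eq_comap_symm E _
    · refine syz_one k (E'.toLinearMap ∘ₗ e.symm.toLinearMap.dualMap ∘ₗ Submodule.subtype _) ?_
      simp only [LinearMap.coe_comp]
      exact E'.injective.comp ((LinearMap.dualMap_injective_of_surjective e.symm.surjective).comp
        (Submodule.injective_subtype _))
  | succ d ih =>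
    intro M _ _ _ h hE
    obtain ⟨m, π, hπ⟩ := Module.Finite.exists_fin' R M
    have hex : LinearMap.range (LinearMap.ker π).subtype = LinearMap.ker π := by simp
    have h' := (hpd_ker _ π (LinearMap.ker π).injective_subtype hπ hex _).1 h
    let E := (Pi.basisFun R (Fin m)).dualBasis.equivFun
    let ρ : Module.Dual R (Fin m → R) →ₗ[R] Module.Dual R (LinearMap.ker π) :=
      (LinearMap.ker π).subtype.dualMap
    refine syz_succ m (E.toLinearMap ∘ₗ π.dualMap) (ρ ∘ₗ E.symm.toLinearMap) ?_ ?_ ?_ (d+2)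
      (by omega) (ih _ h' ?_)
    · rw [LinearMap.coe_comp]
      exact E.injective.comp (LinearMap.dualMap_injective_of_surjective hπ)
    · rw [LinearMap.coe_comp]
      refine Function.Surjective.comp ?_ E.symm.surjective
      intro φ
      obtain ⟨ψ, hψ⟩ := extend_of_ext_one _ π (LinearMap.ker π).injective_subtype hπ hex
        (hE 0 (by omega)) φ
      exact ⟨ψ, hψ⟩
    · rw [LinearMap.ker_comp, LinearMap.range_comp,
        LinearMap.range_dualMap_eq_dualAnnihilator_ker_of_surjective _ hπ]
      simp only [ρ]
      rw [LinearMap.ker_dualMap_eq_dualAnnihilator_range, hex]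
      exact Submodule.map_equiv_eq_comap_symm E _
    · intro i hi
      exact ext_shift _ π (LinearMap.ker π).injective_subtype hπ hex i (hE (i+1) (by omega))

lemma reg_seq (n : ℕ) : ∀ (S : Type) [CommRing S] [IsNoetherianRing S] [IsLocalRing S]
    (s : Fin n → S), Ideal.span (Set.range s) = IsLocalRing.maximalIdeal S →
    (n : WithBot ℕ∞) ≤ ringKrullDim S →
    IsDomain S ∧ ∃ rs : List S, rs.length = n ∧ (∀ r ∈ rs, r ∈ IsLocalRing.maximalIdeal S) ∧
      RingTheory.Sequence.IsWeaklyRegular S rs := by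
  induction n with
  | zero =>
    intro S _ _ _ s hs hn
    refine ⟨?_, [], rfl, by simp, RingTheory.Sequence.IsWeaklyRegular.nil S S⟩
    rw [Set.range_eq_empty, Ideal.span_empty] at hs
    exact (IsLocalRing.isField_iff_maximalIdeal_eq.2 hs.symm).isDomain
  | succ n ih =>
    intro S _ _ _ s hs hn
    set m := IsLocalRing.maximalIdeal S with hm
    have hht : m.height ≠ 0 := by
      intro h
      rw [← IsLocalRing.maximalIdeal_height_eq_ringKrullDim, ← hm, h] at hn
      norm_cast at hn
    have hmin : ∀ P ∈ minimalPrimes S, ¬ m ≤ P := by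
      intro P hP hle
      have : P.IsPrime := hP.1.1
      have hPm : P = m := le_antisymm (IsLocalRing.le_maximalIdeal this.ne_top) hle
      rw [hPm] at hP
      exact hht (Ideal.height_eq_zero_iff.2 hP)
    have hsq : ¬ m ≤ m ^ 2 := by
      intro h
      have : m = ⊥ := by
        refine Submodule.eq_bot_of_le_smul_of_le_jacobson_bot m m (IsNoetherian.noetherian m) ?_ ?_
        · rw [smul_eq_mul, ← pow_two]; exact h
        · rw [IsLocalRing.jacobson_eq_maximalIdeal _ bot_ne_top]
      apply hht
      rw [this]
      exact Ideal.height_bot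
    obtain ⟨x, hxm, hx⟩ : ∃ x ∈ m, x ∉ ⋃ i ∈ insert (m ^ 2) (minimalPrimes S), ((id i : Ideal S) : Set S) := by
      by_contra! hcon
      obtain ⟨P, hP, hle⟩ := (Ideal.subset_union_prime_finite (f := id)
        ((minimalPrimes.finite_of_isNoetherianRing S).insert (m ^ 2)) (m ^ 2) (m ^ 2)
        (fun i hi h1 _ => (by
          rcases hi with hi | hi
          · exact absurd hi h1
          · exact hi.1.1)) (I := m)).1 hcon
      rcases hP with rfl | hP
      · exact hsq hle
      · exact hmin P hP hle
    simp only [Set.mem_iUnion, not_exists, id] at hx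
    have hx2 : x ∉ m ^ 2 := hx _ (Set.mem_insert _ _)
    have hxP : ∀ P ∈ minimalPrimes S, x ∉ P := fun P hP => hx P (Set.mem_insert_of_mem _ hP)
    let I := Ideal.span {x}
    have hI : I ≤ m := by rwa [Ideal.span_singleton_le_iff_mem]
    have hItop : I ≠ ⊤ := fun h => (IsLocalRing.maximalIdeal.isMaximal S).ne_top (top_le_iff.1 (h ▸ hI))
    have : Nontrivial (S ⧸ I) := Ideal.Quotient.nontrivial_iff.mpr hItop
    have : IsLocalRing (S ⧸ I) :=
      IsLocalRing.of_surjective' (Ideal.Quotient.mk I) Ideal.Quotient.mk_surjective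
    have : IsLocalHom (Ideal.Quotient.mk I) :=
      IsLocalHom.of_surjective (Ideal.Quotient.mk I) Ideal.Quotient.mk_surjective
    have hmap : m.map (Ideal.Quotient.mk I) = IsLocalRing.maximalIdeal (S ⧸ I) := by
      ext y
      obtain ⟨y, rfl⟩ := Ideal.Quotient.mk_surjective y
      have hI' : IsLocalRing.maximalIdeal S ⊔ I = IsLocalRing.maximalIdeal S := sup_eq_left.mpr hI
      simp [hI', hm]
    obtain ⟨a, ha⟩ : ∃ a : Fin (n + 1) → S, ∑ i, a i • s i = x :=
      Submodule.mem_span_range_iff_exists_fun S |>.1 (by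
        change x ∈ Ideal.span (Set.range s); rw [hs]; exact hxm)
    obtain ⟨j, hj⟩ : ∃ j, IsUnit (a j) := by
      by_contra! hcon
      apply hx2
      rw [← ha, pow_two]
      refine Ideal.sum_mem _ fun i _ => Ideal.mul_mem_mul ?_ ?_
      · exact (IsLocalRing.mem_maximalIdeal _).2 (hcon i)
      · rw [← hs]; exact Ideal.subset_span ⟨i, rfl⟩
    have hspan : Ideal.span (Set.range (fun i => Ideal.Quotient.mk I (s (j.succAbove i)))) =
        IsLocalRing.maximalIdeal (S ⧸ I) := by
      rw [← hmap, ← hs, Ideal.map_span]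
      apply le_antisymm
      · rw [Ideal.span_le]
        rintro _ ⟨i, rfl⟩
        exact Ideal.subset_span ⟨_, ⟨_, rfl⟩, rfl⟩
      · rw [Ideal.span_le]
        rintro _ ⟨_, ⟨i, rfl⟩, rfl⟩
        rcases Fin.eq_self_or_eq_succAbove j i with rfl | ⟨k, rfl⟩
        · have h0 : Ideal.Quotient.mk I x = 0 :=
            Ideal.Quotient.eq_zero_iff_mem.2 (Ideal.mem_span_singleton_self x)
          rw [← ha, Fin.sum_univ_succAbove _ i] at h0
          simp only [map_add, map_sum, smul_eq_mul, map_mul] at h0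
          have h1 : Ideal.Quotient.mk I (a i) * Ideal.Quotient.mk I (s i) ∈ Ideal.span
              (Set.range (fun k => Ideal.Quotient.mk I (s (i.succAbove k)))) := by
            rw [eq_neg_of_add_eq_zero_left h0]
            exact neg_mem (Ideal.sum_mem _ fun k _ =>
              Ideal.mul_mem_left _ _ (Ideal.subset_span ⟨k, rfl⟩))
          exact (Ideal.unit_mul_mem_iff_mem _ (hj.map _)).1 h1
        · exact Ideal.subset_span ⟨k, rfl⟩
    have hdim : (n : WithBot ℕ∞) ≤ ringKrullDim (S ⧸ I) := by
      have h := ringKrullDim_le_ringKrullDim_quotient_add_card ({x} : Finset S) (by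
        rw [IsLocalRing.ringJacobson_eq_maximalIdeal, Finset.coe_singleton, Set.singleton_subset_iff]
        exact hxm)
      rw [Finset.coe_singleton, Finset.card_singleton] at h
      have h2 := hn.trans h
      push_cast at h2
      exact ENat.WithBot.add_le_add_one_right_iff.1 h2
    obtain ⟨hdom, rs, hlen, hmem, hreg⟩ := ih (S ⧸ I) _ hspan hdim
    have hIp : I.IsPrime := (Ideal.Quotient.isDomain_iff_prime I).1 hdom
    have hSdom : IsDomain S := by
      obtain ⟨P, hP, hPI⟩ := Ideal.exists_minimalPrimes_le (J := I) (bot_le : (⊥ : Ideal S) ≤ I)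
      have hPp : P.IsPrime := hP.1.1
      have : P = ⊥ := by
        refine Submodule.eq_bot_of_le_smul_of_le_jacobson_bot I P (IsNoetherian.noetherian P) ?_ ?_
        · intro y hy
          obtain ⟨c, rfl⟩ := Ideal.mem_span_singleton'.1 (hPI hy)
          rw [mul_comm, smul_eq_mul]
          exact Ideal.mul_mem_mul (Ideal.mem_span_singleton_self x)
            ((hPp.mem_or_mem hy).resolve_right (hxP P hP))
        · rw [IsLocalRing.jacobson_eq_maximalIdeal _ bot_ne_top]; exact hI
      subst this
      exact IsDomain.of_bot_isPrime S
    refine ⟨hSdom, ?_⟩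
    choose g hg using (Ideal.Quotient.mk_surjective (I := I))
    have hrs : (rs.map g).map (Ideal.Quotient.mk I) = rs := by
      rw [List.map_map]
      conv_rhs => rw [← List.map_id rs]
      exact List.map_congr_left fun y _ => hg y
    refine ⟨x :: rs.map g, by simp [hlen], ?_, ?_⟩
    · intro r hr
      rcases List.mem_cons.1 hr with rfl | hr
      · exact hxm
      · obtain ⟨y, hy, rfl⟩ := List.mem_map.1 hr
        have := hmem y hy
        rw [← hg y] at this
        exact (IsLocalRing.mem_maximalIdeal _).2 fun hu =>
          (IsLocalRing.mem_maximalIdeal _).1 this (hu.map _)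
    · refine RingTheory.Sequence.IsWeaklyRegular.cons ?_ ?_
      · have hx0 : x ≠ 0 := fun h => hx2 (h ▸ zero_mem _)
        exact fun a b hab => mul_left_cancel₀ hx0 hab
      · have h1 : RingTheory.Sequence.IsWeaklyRegular (S ⧸ I) (rs.map g) := by
          rw [← RingTheory.Sequence.isWeaklyRegular_map_algebraMap_iff (S ⧸ I)]
          rw [Ideal.Quotient.algebraMap_eq, hrs]
          exact hreg
        let e : QuotSMulTop x S ≃ₗ[S] (S ⧸ I) := Submodule.quotEquivOfEq _ _ (by
          ext y
          simp [Submodule.mem_smul_pointwise_iff_exists, I, Ideal.mem_span_singleton', mul_comm])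
        exact (e.isWeaklyRegular_congr _).2 h1

lemma hK_of_reg {R : Type} [CommRing R] [IsNoetherianRing R] [IsLocalRing R] (ℓ : ℕ)
    (hdim : ringKrullDim R = ℓ)
    (hreg : ∃ s : Finset R, s.card = ℓ ∧ Ideal.span (s : Set R) = IsLocalRing.maximalIdeal R) :
    ∀ i < ℓ, Subsingleton (Abelian.Ext
      (ModuleCat.of R (R ⧸ IsLocalRing.maximalIdeal R)) (ModuleCat.of R R) i) := by
  obtain ⟨s, hs, hspan⟩ := hreg
  let e := s.equivFinOfCardEq hs
  obtain ⟨-, rs, hlen, hmem, hw⟩ := reg_seq ℓ R (fun i => (e.symm i : R)) (by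
    rw [← hspan]
    congr 1
    ext y
    constructor
    · rintro ⟨i, rfl⟩; exact (e.symm i).2
    · intro hy; exact ⟨e ⟨y, hy⟩, by simp⟩) hdim.ge
  rw [← IsLocalRing.isRegular_iff_isWeaklyRegular_of_subset_maximalIdeal hmem] at hw
  rw [← hlen]
  refine ModuleCat.subsingleton_ext_of_exists_isRegular (IsLocalRing.maximalIdeal R) _ ?_ _ ?_ rs
    hmem hw
  · change Module.support R (R ⧸ IsLocalRing.maximalIdeal R) ⊆ _
    rw [Module.support_eq_zeroLocus, Ideal.annihilator_quotient]
  · change IsLocalRing.maximalIdeal R • (⊤ : Ideal R) < ⊤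
    rw [smul_eq_mul, Ideal.mul_top]
    exact lt_top_iff_ne_top.2 (IsLocalRing.maximalIdeal.isMaximal R).ne_top
/-- Let `R` be a commutative Noetherian regular local ring of Krull dimension `ℓ` and `M` a
finitely generated `d`-spherical `R`-module, `0 < d < ℓ`, which is free at every non-maximal
prime.  Then `M` is an `(ℓ - d)`-syzygy and `M^∨ = Hom_R(M, R)` is a `(d + 1)`-syzygy. -/
theorem isSyzygy_of_spherical (R : Type) [CommRing R] [IsNoetherianRing R] [IsLocalRing R]
    (ℓ d : ℕ)
    (hdim : ringKrullDim R = ℓ)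
    (hreg : ∃ s : Finset R, s.card = ℓ ∧ Ideal.span (s : Set R) = IsLocalRing.maximalIdeal R)
    (M : Type) [AddCommGroup M] [Module R M] [Module.Finite R M]
    (hsph : Spherical R (ModuleCat.of R M) d)
    (hd0 : 0 < d) (hdl : d < ℓ)
    (hloc : ∀ (p : Ideal R) (_ : p.IsPrime), p ≠ IsLocalRing.maximalIdeal R →
      Module.Free (Localization.AtPrime p) (LocalizedModule p.primeCompl M)) :
    IsSyzygy R M (ℓ - d) ∧ IsSyzygy R (Module.Dual R M) (d + 1) := by
  have hpd := hpd_of_pdLE _ d hsph.1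
  have hK := hK_of_reg ℓ hdim hreg
  constructor
  · obtain ⟨r, rfl⟩ : ∃ r, ℓ = d + (r + 1) := ⟨ℓ - d - 1, by omega⟩
    rw [Nat.add_sub_cancel_left]
    exact part_one _ hK r d M hpd (LFP_of_free hloc) rfl
  · obtain ⟨d, rfl⟩ : ∃ k, d = k + 1 := ⟨d - 1, by omega⟩
    exact part_two d M hpd (fun i hi =>
      ext_subsingleton_of_extGrp _ _ i (hsph.2 (i + 1) (by omega) (by omega)))
end

section
/- Let R be a commutative Noetherian regular local ring of Krull dimension ℓ that contains a field K with char K = 0 or char K ≥ ℓ, and let M be a finitely generated d-spherical R-module with pd_R M = d such that M_p is a free R_p-module for every non-maximal prime ideal p of R. Then for every integer p ≥ 1 with p·d < ℓ − 1, the exterior power ⋀^p_R M is a reflexive R-module. -/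
open CategoryTheory

theorem hasPD_of_pdLE (R : Type) [CommRing R] (M : ModuleCat R) (n : ℕ) (h : pdLE R M n) :
    HasProjectiveDimensionLT M (n + 1) := by
  apply hasProjectiveDimensionLT_of_enoughInjectives
  intro Y
  have hs : Subsingleton (ExtGrp R M Y (n + 1)) := h Y
  let P := ProjectiveResolution.of M
  have e : ExtGrp R M Y (n+1) ≅ (P.complex.linearYonedaObj R Y).homology (n+1) := P.isoExt (n+1) Y
  have hz : Limits.IsZero ((P.complex.linearYonedaObj R Y).homology (n+1)) :=
    (ModuleCat.isZero_of_subsingleton _).of_iso e.symm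
  rw [← HomologicalComplex.exactAt_iff_isZero_homology,
    HomologicalComplex.exactAt_iff' _ n (n+1) (n+2) (by simp) (by simp)] at hz
  rw [ShortComplex.moduleCat_exact_iff] at hz
  suffices ∀ x : Abelian.Ext M Y (n+1), x = 0 from ⟨fun a b => by rw [this a, this b]⟩
  intro x
  obtain ⟨f, hf, rfl⟩ := P.extMk_surjective x (n+2) rfl
  obtain ⟨g, hg⟩ := hz f hf
  rw [P.extMk_eq_zero_iff f (n+2) rfl hf n rfl]
  exact ⟨g, hg⟩

section RegularPart

set_option linter.unusedSectionVars false
set_option linter.deprecated false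

open IsLocalRing

variable {R : Type} [CommRing R] [IsNoetherianRing R] [IsLocalRing R]

theorem dim_le_add_card (I : Ideal R) (s : Finset R)
    (h : I ⊔ Ideal.span (s : Set R) ≤ maximalIdeal R) :
    ringKrullDim (R ⧸ I) ≤ ringKrullDim (R ⧸ (I ⊔ Ideal.span (s : Set R))) + s.card := by
  classical
  have hI : I ≤ maximalIdeal R := le_sup_left.trans h
  have hne : I ≠ ⊤ := fun h' => (maximalIdeal.isMaximal R).ne_top (top_le_iff.mp (h' ▸ hI))
  have : Nontrivial (R ⧸ I) := Ideal.Quotient.nontrivial_iff.mpr hne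
  have : IsLocalRing (R ⧸ I) := IsLocalRing.of_surjective' (Ideal.Quotient.mk I)
    Ideal.Quotient.mk_surjective
  have key := ringKrullDim_le_ringKrullDim_add_card (R := R ⧸ I)
    (S := s.image (Ideal.Quotient.mk I)) (by
      intro y hy
      simp only [Finset.coe_image, Set.mem_image] at hy
      obtain ⟨x, hx, rfl⟩ := hy
      have hxm : x ∈ maximalIdeal R := h (le_sup_right (a := I) (Ideal.subset_span hx))
      simp only [SetLike.mem_coe, mem_maximalIdeal, mem_nonunits_iff]
      intro hu
      have hloc : IsLocalHom (Ideal.Quotient.mk I) :=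
        IsLocalHom.of_surjective _ Ideal.Quotient.mk_surjective
      exact hxm (isUnit_of_map_unit (Ideal.Quotient.mk I) x hu))
  refine key.trans ?_
  have he : Ideal.span ((s.image (Ideal.Quotient.mk I) : Finset (R ⧸ I)) : Set (R ⧸ I))
      = (Ideal.span (s : Set R)).map (Ideal.Quotient.mk I) := by
    rw [Ideal.map_span, Finset.coe_image]
  rw [he, ringKrullDim_eq_of_ringEquiv (DoubleQuot.quotQuotEquivQuotSup I (Ideal.span (s : Set R)))]
  gcongr
  exact_mod_cast Finset.card_image_le

/-- `R ⧸ J` is regular of dimension `j`. -/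
def RegQ (J : Ideal R) (j : ℕ) : Prop :=
  ringKrullDim (R ⧸ J) = j ∧ ∃ s : Finset R, s.card = j ∧
    J ⊔ Ideal.span (s : Set R) = maximalIdeal R

theorem dim_quot_maximal : ringKrullDim (R ⧸ maximalIdeal R) = 0 := by
  let := Ideal.Quotient.field (maximalIdeal R)
  exact ringKrullDim_eq_zero_of_field _

theorem RegQ.step {J : Ideal R} {j : ℕ} (h : RegQ J (j + 1)) :
    ∃ x ∈ maximalIdeal R, RegQ (J ⊔ Ideal.span {x}) j := by
  classical
  obtain ⟨hd, s, hs, hm⟩ := h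
  obtain ⟨x, hx⟩ : s.Nonempty := by rw [← Finset.card_pos]; omega
  have hsp : (J ⊔ Ideal.span {x}) ⊔ Ideal.span ((s.erase x : Finset R) : Set R)
      = maximalIdeal R := by
    rw [sup_assoc, ← Ideal.span_union, ← hm]
    congr 2
    ext y
    simp only [Finset.coe_erase, Set.singleton_union, Set.insert_sdiff_singleton, Set.mem_insert_iff,
      Finset.mem_coe]
    constructor
    · rintro (rfl | h)
      · exact hx
      · exact h
    · exact Or.inr
  refine ⟨x, hm ▸ (le_sup_right (a := J) (Ideal.subset_span hx)), ?_, s.erase x,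
    by rw [Finset.card_erase_of_mem hx, hs]; rfl, hsp⟩
  apply le_antisymm
  · have := dim_le_add_card (J ⊔ Ideal.span {x}) (s.erase x) hsp.le
    rw [hsp, dim_quot_maximal, Finset.card_erase_of_mem hx, hs] at this
    simpa using this
  · have := dim_le_add_card J {x} (by
      rw [Finset.coe_singleton]
      exact le_sup_left.trans hsp.le)
    rw [hd, Finset.coe_singleton, Finset.card_singleton] at this
    push_cast at this
    exact (ENat.WithBot.add_le_add_natCast_right_iff (c := 1)).mp (by exact_mod_cast this)

theorem dim_quot_lt_of_prime {P Q : Ideal R} [P.IsPrime] (h : P < Q) :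
    ringKrullDim (R ⧸ Q) + 1 ≤ ringKrullDim (R ⧸ P) := by
  obtain ⟨hle, x, hx, hxP⟩ := SetLike.lt_iff_le_and_exists.mp h
  exact ringKrullDim_succ_le_of_surjective (Ideal.Quotient.factor hle)
    (Ideal.Quotient.factor_surjective hle) (r := Ideal.Quotient.mk P x)
    (mem_nonZeroDivisors_of_ne_zero (by simpa [Ideal.Quotient.eq_zero_iff_mem] using hxP))
    (by simpa [Ideal.Quotient.eq_zero_iff_mem] using hx)

theorem exists_prime_dim {J : Ideal R} {j : ℕ} (hd : ringKrullDim (R ⧸ J) = j) :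
    ∃ q : Ideal R, q.IsPrime ∧ J ≤ q ∧ ringKrullDim (R ⧸ q) = j := by
  rw [ringKrullDim_quotient] at hd
  obtain ⟨l, hl⟩ := Order.le_krullDim_iff.mp hd.ge
  refine ⟨l.head.1.asIdeal, l.head.1.2, l.head.2, le_antisymm ?_ ?_⟩
  · rw [← hd, ← ringKrullDim_quotient]
    exact ringKrullDim_le_of_surjective (Ideal.Quotient.factor (l.head.2))
      (Ideal.Quotient.factor_surjective _)
  · rw [ringKrullDim_quotient]
    apply Order.le_krullDim_iff.mpr
    refine ⟨⟨l.length, fun i => ⟨(l i).1, ?_⟩, ?_⟩, hl⟩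
    · have : l.head ≤ l i := l.monotone (Fin.zero_le i)
      exact this
    · intro i
      exact l.step i

theorem RegQ.isPrime {j : ℕ} : ∀ {J : Ideal R}, RegQ J j → J.IsPrime := by
  induction j with
  | zero =>
    rintro J ⟨_, s, hs, hm⟩
    rw [Finset.card_eq_zero] at hs
    subst hs
    simp at hm
    rw [hm]; infer_instance
  | succ j ih =>
    intro J h
    obtain ⟨x, hxm, hJ'⟩ := h.step
    have hP : (J ⊔ Ideal.span {x}).IsPrime := ih hJ'
    obtain ⟨q, hq, hJq, hqd⟩ := exists_prime_dim h.1
    have hxq : x ∉ q := by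
      intro hx
      have hle : J ⊔ Ideal.span {x} ≤ q := sup_le hJq (by simpa [Ideal.span_le] using hx)
      have := ringKrullDim_le_of_surjective (Ideal.Quotient.factor hle)
        (Ideal.Quotient.factor_surjective _)
      rw [hqd, hJ'.1] at this
      have : j + 1 ≤ j := by exact_mod_cast this
      omega
    have hqJ' : q ≤ J ⊔ Ideal.span {x} := by
      by_contra hcon
      have hlt : J ⊔ Ideal.span {x} < q ⊔ Ideal.span {x} := by
        refine lt_of_le_of_ne (sup_le_sup_right hJq _) fun he => hcon ?_
        rw [he]; exact le_sup_left
      have h1 := dim_quot_lt_of_prime hlt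
      have h2 := dim_le_add_card q {x} (by
        rw [Finset.coe_singleton]
        exact sup_le (le_maximalIdeal hq.ne_top) (by simpa [Ideal.span_le] using hxm))
      rw [hqd, Finset.coe_singleton, Finset.card_singleton] at h2
      rw [hJ'.1] at h1
      have h3 := h2.trans h1
      have : j + 1 ≤ j := by exact_mod_cast h3
      omega
    have : q ≤ J := by
      apply Submodule.le_of_le_smul_of_le_jacobson_bot (I := Ideal.span {x})
        (IsNoetherian.noetherian q)
      · rw [Ideal.span_le, Set.singleton_subset_iff]
        exact maximalIdeal_le_jacobson _ hxm
      · intro y hy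
        obtain ⟨a, ha, b, hb, rfl⟩ := Submodule.mem_sup.mp (hqJ' hy)
        obtain ⟨z, rfl⟩ := Ideal.mem_span_singleton'.mp hb
        have hzx : z * x ∈ q := by
          have := q.sub_mem hy (hJq ha)
          simpa using this
        have hz : z ∈ q := (hq.mem_or_mem hzx).resolve_right hxq
        refine Submodule.add_mem_sup ha ?_
        rw [mul_comm]
        exact Submodule.smul_mem_smul (Ideal.mem_span_singleton_self x) hz
    rw [le_antisymm hJq this]; exact hq

end RegularPart

section DepthPart

open IsLocalRing

variable {R : Type} [CommRing R] [IsLocalRing R]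

/-- `depth N ≥ c`, via vanishing of `Ext`. -/
def DepthGE (R : Type) [CommRing R] [IsLocalRing R] (N : Type) [AddCommGroup N] [Module R N]
    (c : ℕ) : Prop :=
  ∀ i < c, ∀ e : Abelian.Ext (ModuleCat.of R (ResidueField R)) (ModuleCat.of R N) i, e = 0

variable {A B C : Type} [AddCommGroup A] [Module R A] [AddCommGroup B] [Module R B]
  [AddCommGroup C] [Module R C]

theorem DepthGE.mono {c c' : ℕ} (h : DepthGE R A c) (hc : c' ≤ c) : DepthGE R A c' :=
  fun i hi => h i (by omega)

theorem mkShortExact (f : A →ₗ[R] B) (g : B →ₗ[R] C) (hf : Function.Injective f)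
    (hg : Function.Surjective g) (hfg : Function.Exact f g) :
    (ShortComplex.mk (ModuleCat.ofHom f) (ModuleCat.ofHom g) (by
      rw [← ModuleCat.ofHom_comp, hfg.linearMap_comp_eq_zero]; rfl)).ShortExact where
  exact := by
    rw [ShortComplex.ShortExact.moduleCat_exact_iff_function_exact]
    exact hfg
  mono_f := (ModuleCat.mono_iff_injective _).mpr hf
  epi_g := (ModuleCat.epi_iff_surjective _).mpr hg

theorem DepthGE.right {c : ℕ} (f : A →ₗ[R] B) (g : B →ₗ[R] C) (hf : Function.Injective f)
    (hg : Function.Surjective g) (hfg : Function.Exact f g)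
    (hA : DepthGE R A (c + 1)) (hB : DepthGE R B c) : DepthGE R C c := by
  intro i hi e
  obtain ⟨x₂, hx₂⟩ := Abelian.Ext.covariant_sequence_exact₃ _ (mkShortExact f g hf hg hfg) e rfl
    (hA (i + 1) (by omega) _)
  rw [← hx₂, hB i hi x₂, Abelian.Ext.zero_comp]

theorem DepthGE.middle {c : ℕ} (f : A →ₗ[R] B) (g : B →ₗ[R] C) (hf : Function.Injective f)
    (hg : Function.Surjective g) (hfg : Function.Exact f g)
    (hA : DepthGE R A c) (hC : DepthGE R C c) : DepthGE R B c := by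
  intro i hi e
  obtain ⟨x₂, hx₂⟩ := Abelian.Ext.covariant_sequence_exact₂ _ (mkShortExact f g hf hg hfg) e
    (hC i hi _)
  rw [← hx₂, hA i hi x₂, Abelian.Ext.zero_comp]

theorem DepthGE.equiv {c : ℕ} (f : A ≃ₗ[R] B) (hA : DepthGE R A c) : DepthGE R B c := by
  intro i hi e
  have h1 : e.comp (Abelian.Ext.mk₀ (ModuleCat.ofHom (f.symm : B →ₗ[R] A))) (add_zero i) = 0 :=
    hA i hi _
  have h2 : (e.comp (Abelian.Ext.mk₀ (ModuleCat.ofHom (f.symm : B →ₗ[R] A))) (add_zero i)).comp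
      (Abelian.Ext.mk₀ (ModuleCat.ofHom (f : A →ₗ[R] B))) (add_zero i) = 0 := by
    rw [h1, Abelian.Ext.zero_comp]
  rw [Abelian.Ext.comp_assoc_of_second_deg_zero, Abelian.Ext.mk₀_comp_mk₀,
    ← ModuleCat.ofHom_comp] at h2
  have h3 : ((f : A →ₗ[R] B) ∘ₗ (f.symm : B →ₗ[R] A)) = LinearMap.id := by ext; simp
  rw [h3] at h2
  simpa using h2

theorem smul_ext_eq_zero {x : R} (hx : x ∈ maximalIdeal R) {N : ModuleCat.{0} R} {i : ℕ}
    (e : Abelian.Ext (ModuleCat.of R (ResidueField R)) N i) : x • e = 0 := by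
  have h0 : x • 𝟙 (ModuleCat.of R (ResidueField R)) = 0 := by
    ext y
    change x • y = 0
    rw [Algebra.smul_def]
    have : algebraMap R (ResidueField R) x = 0 := by
      change residue R x = 0
      rwa [residue_eq_zero_iff]
    rw [this, zero_mul]
  have : x • e = (Abelian.Ext.mk₀ (x • 𝟙 (ModuleCat.of R (ResidueField R)))).comp e
      (zero_add i) := by simp [Abelian.Ext.mk₀_smul]
  rw [this, h0]
  simp

theorem DepthGE.of_regular {c : ℕ} {x : R} (hx : x ∈ maximalIdeal R)
    (hreg : Function.Injective (LinearMap.lsmul R A x)) (g : A →ₗ[R] C)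
    (hg : Function.Surjective g) (hfg : Function.Exact (LinearMap.lsmul R A x) g)
    (hC : DepthGE R C c) : DepthGE R A (c + 1) := by
  intro i hi e
  have hS := mkShortExact _ g hreg hg hfg
  have hf : ModuleCat.ofHom (LinearMap.lsmul R A x) = x • 𝟙 (ModuleCat.of R A) := rfl
  have h0 : e.comp (Abelian.Ext.mk₀ (ModuleCat.ofHom (LinearMap.lsmul R A x))) (add_zero i) = 0 := by
    rw [hf, Abelian.Ext.mk₀_smul, Abelian.Ext.comp_smul, smul_ext_eq_zero hx]
  cases i with
  | zero =>
    have : Mono (ModuleCat.ofHom (LinearMap.lsmul R A x)) := (ModuleCat.mono_iff_injective _).mpr hreg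
    apply Abelian.Ext.postcomp_mk₀_injective_of_mono _ (ModuleCat.ofHom (LinearMap.lsmul R A x))
    rw [map_zero]
    exact h0
  | succ i =>
    obtain ⟨x₃, hx₃⟩ := Abelian.Ext.covariant_sequence_exact₁ _ hS e h0 rfl
    rw [← hx₃, hC i (by omega) x₃, Abelian.Ext.zero_comp]

theorem depthGE_one_iff : DepthGE R A 1 ↔ ∀ y : A, (∀ r ∈ maximalIdeal R, r • y = 0) → y = 0 := by
  constructor
  · intro h y hy
    let φ : ResidueField R →ₗ[R] A :=
      Submodule.liftQ (maximalIdeal R) (LinearMap.toSpanSingleton R A y) (by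
        intro r hr
        simpa using hy r hr)
    have h1 := h 0 (by omega) (Abelian.Ext.mk₀ (ModuleCat.ofHom φ))
    rw [Abelian.Ext.mk₀_eq_zero_iff] at h1
    have h2 : φ = 0 := by
      have := congrArg ModuleCat.Hom.hom h1
      simpa using this
    have h3 : φ (Submodule.Quotient.mk 1) = y := by
      change (1 : R) • y = y
      simp
    rw [← h3, h2]; rfl
  · intro h i hi e
    obtain rfl : i = 0 := by omega
    obtain ⟨f, rfl⟩ := (Abelian.Ext.mk₀_bijective _ _).2 e
    have : f = 0 := by
      ext y
      apply h
      intro r hr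
      rw [← map_smul]
      have : r • y = 0 := by
        change r • (y : ResidueField R) = 0
        rw [Algebra.smul_def]
        have : algebraMap R (ResidueField R) r = 0 := by
          change residue R r = 0
          rwa [residue_eq_zero_iff]
        rw [this, zero_mul]
      rw [this, map_zero]
    rw [this]; simp

theorem DepthGE.eq_zero_of_torsion [IsNoetherianRing R] (h : DepthGE R A 1) (z : A)
    (hz : ∀ p : Ideal R, p.IsPrime → p ≠ maximalIdeal R → ∃ s ∉ p, s • z = 0) : z = 0 := by
  by_contra hne
  rw [depthGE_one_iff] at h
  have hz' : (⟨z, Submodule.mem_span_singleton_self z⟩ : Submodule.span R {z}) ≠ 0 :=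
    fun h => hne (congrArg Subtype.val h)
  obtain ⟨p, hp, -⟩ := exists_le_isAssociatedPrime_of_isNoetherianRing R _ hz'
  rw [isAssociatedPrime_iff] at hp
  obtain ⟨hpp, ⟨w, hw⟩, hpw⟩ := hp
  obtain ⟨a, rfl⟩ := Submodule.mem_span_singleton.mp hw
  have hmem : ∀ r : R, r ∈ p ↔ r • (a • z) = 0 := by
    intro r
    rw [hpw, Submodule.mem_colon_singleton, Submodule.mem_bot]
    exact Subtype.ext_iff
  by_cases hpm : p = maximalIdeal R
  · have h0 : a • z = 0 := h _ fun r hr => (hmem r).mp (hpm ▸ hr)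
    exact hpp.ne_top ((Ideal.eq_top_iff_one _).mpr ((hmem 1).mpr (by rw [h0, smul_zero])))
  · obtain ⟨s, hs, hsz⟩ := hz p hpp hpm
    exact hs ((hmem s).mpr (by rw [smul_comm, hsz, smul_zero]))

theorem DepthGE.pi {c : ℕ} (h : DepthGE R A c) (n : ℕ) : DepthGE R (Fin n → A) c := by
  induction n with
  | zero =>
    intro i hi e
    have : Limits.IsZero (ModuleCat.of R (Fin 0 → A)) := ModuleCat.isZero_of_subsingleton _
    have h1 : e = e.comp (Abelian.Ext.mk₀ (𝟙 _)) (add_zero i) := by simp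
    rw [h1, this.eq_of_src (𝟙 _) 0]
    simp
  | succ n ih =>
    have : DepthGE R (A × (Fin n → A)) c :=
      DepthGE.middle (LinearMap.inl R A (Fin n → A)) (LinearMap.snd R A (Fin n → A))
        LinearMap.inl_injective LinearMap.snd_surjective Function.Exact.inl_snd h ih
    exact this.equiv (Fin.consLinearEquiv R (fun _ => A))

end DepthPart

section RegularDepth

open IsLocalRing

variable {R : Type} [CommRing R] [IsNoetherianRing R] [IsLocalRing R]

theorem RegQ.depth {j : ℕ} : ∀ {J : Ideal R}, RegQ J j → DepthGE R (R ⧸ J) j := by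
  induction j with
  | zero => intro J _ i hi; omega
  | succ j ih =>
    intro J h
    obtain ⟨x, hx, h'⟩ := h.step
    have hJ := h.isPrime
    have hxJ : x ∉ J := by
      intro hxJ
      have he : J ⊔ Ideal.span {x} = J :=
        sup_eq_left.mpr ((Ideal.span_singleton_le_iff_mem J).mpr hxJ)
      rw [he] at h'
      have h1 := h.1.symm.trans h'.1
      have h2 : j + 1 = j := by exact_mod_cast h1
      omega
    refine DepthGE.of_regular (C := R ⧸ (J ⊔ Ideal.span {x})) hx ?_
      (Submodule.factor (le_sup_left : J ≤ J ⊔ Ideal.span {x})) ?_ ?_ (ih h')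
    · rw [injective_iff_map_eq_zero]
      intro a
      obtain ⟨r, rfl⟩ := Ideal.Quotient.mk_surjective a
      intro ha
      have ha' : Ideal.Quotient.mk J (x * r) = 0 := ha
      rw [Ideal.Quotient.eq_zero_iff_mem] at ha' ⊢
      exact (hJ.mem_or_mem ha').resolve_left hxJ
    · exact Submodule.factor_surjective _
    · intro a
      obtain ⟨r, rfl⟩ := Ideal.Quotient.mk_surjective a
      constructor
      · intro hr
        have hr' : Ideal.Quotient.mk (J ⊔ Ideal.span {x}) r = 0 := hr
        rw [Ideal.Quotient.eq_zero_iff_mem, Submodule.mem_sup] at hr'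
        obtain ⟨u, hu, v, hv, rfl⟩ := hr'
        obtain ⟨t, rfl⟩ := Ideal.mem_span_singleton'.mp hv
        refine ⟨Ideal.Quotient.mk J t, ?_⟩
        change Ideal.Quotient.mk J (x * t) = _
        rw [Ideal.Quotient.eq]
        have : x * t - (u + t * x) = -u := by ring
        rw [this]
        exact neg_mem hu
      · rintro ⟨b, hb⟩
        obtain ⟨t, rfl⟩ := Ideal.Quotient.mk_surjective b
        rw [← hb]
        change Ideal.Quotient.mk (J ⊔ Ideal.span {x}) (x * t) = 0
        rw [Ideal.Quotient.eq_zero_iff_mem]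
        exact Ideal.mul_mem_right _ _ (Ideal.mem_sup_right (Ideal.mem_span_singleton_self x))

theorem depth_regular (ℓ : ℕ) (hdim : ringKrullDim R = ℓ)
    (hreg : ∃ s : Finset R, s.card = ℓ ∧ Ideal.span (s : Set R) = maximalIdeal R) :
    DepthGE R R ℓ := by
  have h : RegQ (⊥ : Ideal R) ℓ := by
    refine ⟨?_, ?_⟩
    · rw [ringKrullDim_eq_of_ringEquiv (RingEquiv.quotientBot R), hdim]
    · obtain ⟨s, hs, h⟩ := hreg
      exact ⟨s, hs, by rw [bot_sup_eq, h]⟩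
  exact h.depth.equiv (Submodule.quotEquivOfEqBot ⊥ rfl)

end RegularDepth

section LocFree

open IsLocalRing TensorProduct

/-- `N` is a direct summand of a free module, up to denominators, at each non-maximal prime. -/
def LF (R : Type) [CommRing R] [IsLocalRing R] (N : Type) [AddCommGroup N] [Module R N] : Prop :=
  ∀ p : Ideal R, p.IsPrime → p ≠ maximalIdeal R → ∃ s ∉ p, ∃ n : ℕ,
    ∃ (α : N →ₗ[R] (Fin n → R)) (β : (Fin n → R) →ₗ[R] N), ∀ x, β (α x) = s • x

variable {R : Type} [CommRing R] [IsLocalRing R]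
variable {A B : Type} [AddCommGroup A] [Module R A] [AddCommGroup B] [Module R B]

theorem LF.equiv (h : LF R A) (e : A ≃ₗ[R] B) : LF R B := by
  intro p hp hm
  obtain ⟨s, hs, n, α, β, hx⟩ := h p hp hm
  refine ⟨s, hs, n, α ∘ₗ e.symm.toLinearMap, e.toLinearMap ∘ₗ β, fun x => ?_⟩
  simp [hx]

theorem LF.self : LF R R := by
  intro p hp hm
  refine ⟨1, fun h => hp.ne_top ((Ideal.eq_top_iff_one _).mpr h), 1,
    (LinearEquiv.funUnique (Fin 1) R R).symm.toLinearMap,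
    (LinearEquiv.funUnique (Fin 1) R R).toLinearMap, fun x => ?_⟩
  simp

theorem LF.tensor (hA : LF R A) (hB : LF R B) : LF R (A ⊗[R] B) := by
  intro p hp hm
  obtain ⟨s, hs, n, α, β, hx⟩ := hA p hp hm
  obtain ⟨t, ht, k, γ, δ, hy⟩ := hB p hp hm
  let e : ((Fin n → R) ⊗[R] (Fin k → R)) ≃ₗ[R] (Fin (n * k) → R) :=
    (((Pi.basisFun R (Fin n)).tensorProduct (Pi.basisFun R (Fin k))).reindex
      finProdFinEquiv).equivFun
  refine ⟨s * t, fun h => (hp.mem_or_mem h).elim hs ht, n * k,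
    e.toLinearMap ∘ₗ TensorProduct.map α γ, TensorProduct.map β δ ∘ₗ e.symm.toLinearMap,
    fun x => ?_⟩
  have : TensorProduct.map β δ (TensorProduct.map α γ x) = (s * t) • x := by
    induction x with
    | zero => simp
    | add x y hx hy => simp only [map_add, smul_add, hx, hy]
    | tmul x y => rw [TensorProduct.map_tmul, TensorProduct.map_tmul, hx, hy, TensorProduct.smul_tmul_smul]
  simpa using this

theorem LF.of_localized [IsNoetherianRing R] [Module.Finite R A]
    (hloc : ∀ (p : Ideal R) (_ : p.IsPrime), p ≠ IsLocalRing.maximalIdeal R →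
      Module.Free (Localization.AtPrime p) (LocalizedModule p.primeCompl A)) : LF R A := by
  intro p hp hm
  have hfree := hloc p hp hm
  have : Module.FinitePresentation R A := Module.finitePresentation_of_finite R A
  have : Nontrivial (Localization.AtPrime p) := inferInstance
  let b := Module.finBasis (Localization.AtPrime p) (LocalizedModule p.primeCompl A)
  set n := Module.finrank (Localization.AtPrime p) (LocalizedModule p.primeCompl A)
  let e : LocalizedModule p.primeCompl A ≃ₗ[R] (Fin n → Localization.AtPrime p) :=
    b.equivFun.restrictScalars R
  let f : (Fin n → R) →ₗ[R] (Fin n → Localization.AtPrime p) :=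
    LinearMap.pi fun i => Algebra.linearMap R (Localization.AtPrime p) ∘ₗ LinearMap.proj i
  have hf : IsLocalizedModule p.primeCompl f := inferInstance
  let mk := LocalizedModule.mkLinearMap p.primeCompl A
  obtain ⟨α, s₁, h₁⟩ := Module.FinitePresentation.exists_lift_of_isLocalizedModule
    p.primeCompl f (e.toLinearMap ∘ₗ mk)
  obtain ⟨β, s₂, h₂⟩ := Module.FinitePresentation.exists_lift_of_isLocalizedModule
    p.primeCompl mk (e.symm.toLinearMap ∘ₗ f)
  have h3 : mk ∘ₗ (β ∘ₗ α) = mk ∘ₗ ((s₂ * s₁ : R) • LinearMap.id) := by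
    ext x
    have e1 := LinearMap.congr_fun h₁ x
    have e2 := LinearMap.congr_fun h₂ (α x)
    simp only [LinearMap.comp_apply, LinearMap.smul_apply] at e1 e2 ⊢
    rw [e2, e1]
    simp [Submonoid.smul_def, mul_smul]
  obtain ⟨t, ht⟩ := Module.Finite.exists_smul_of_comp_eq_of_isLocalizedModule p.primeCompl mk _ _ h3
  refine ⟨(t * (s₂ * s₁) : R), (t * (s₂ * s₁)).2, n, α, (t : R) • β, fun x => ?_⟩
  have := LinearMap.congr_fun ht x
  simpa [Submonoid.smul_def, mul_smul] using this

end LocFree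

section TensorDepth

open IsLocalRing TensorProduct

variable {R : Type} [CommRing R] [IsNoetherianRing R] [IsLocalRing R]
variable {N : Type} [AddCommGroup N] [Module R N]

theorem depth_free_tensor {F : Type} [AddCommGroup F] [Module R F] [Module.Finite R F]
    [Module.Free R F] {c : ℕ} (hN : DepthGE R N c) : DepthGE R (F ⊗[R] N) c := by
  have e : (F ⊗[R] N) ≃ₗ[R] (Fin (Module.finrank R F) → N) :=
    TensorProduct.comm R F N ≪≫ₗ
      TensorProduct.congr (LinearEquiv.refl R N) (Module.finBasis R F).equivFun ≪≫ₗ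
      TensorProduct.piScalarRight R R N (Fin (Module.finrank R F))
  exact (hN.pi _).equiv e.symm

theorem free_of_pd {M : Type} [AddCommGroup M] [Module R M] [Module.Finite R M]
    (h : HasProjectiveDimensionLT (ModuleCat.of R M) 1) : Module.Free R M := by
  have h1 : Projective (ModuleCat.of R M) :=
    projective_iff_hasProjectiveDimensionLT_one.mpr h
  have h2 : Module.Projective R M := (IsProjective.iff_projective M).mpr h1
  exact Module.free_of_flat_of_isLocalRing

theorem rTensor_injective_of_LF {M F : Type} [AddCommGroup M] [Module R M] [AddCommGroup F]
    [Module R F] (f : M →ₗ[R] F) (hf : Function.Injective f) (hN : LF R N)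
    (hd : DepthGE R (M ⊗[R] N) 1) : Function.Injective (f.rTensor N) := by
  rw [injective_iff_map_eq_zero]
  intro z hz
  apply hd.eq_zero_of_torsion
  intro p hp hm
  obtain ⟨s, hs, n, α, β, hx⟩ := hN p hp hm
  refine ⟨s, hs, ?_⟩
  have h1 : (f.rTensor (Fin n → R)) (α.lTensor M z) = 0 := by
    have : (f.rTensor (Fin n → R)) (α.lTensor M z) = α.lTensor F (f.rTensor N z) := by
      rw [← LinearMap.comp_apply, ← LinearMap.comp_apply, LinearMap.rTensor_comp_lTensor,
        LinearMap.lTensor_comp_rTensor]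
    rw [this, hz, map_zero]
  have h2 : α.lTensor M z = 0 :=
    (injective_iff_map_eq_zero _).mp (Module.Flat.rTensor_preserves_injective_linearMap f hf) _ h1
  have h3 : β.lTensor M (α.lTensor M z) = s • z := by
    rw [← LinearMap.comp_apply, ← LinearMap.lTensor_comp]
    have : β ∘ₗ α = s • LinearMap.id := by ext x; simp [hx]
    rw [this, LinearMap.lTensor_smul]
    simp
  rw [← h3, h2, map_zero]

theorem depth_tensor (hN : LF R N) (a : ℕ) : ∀ (M : Type) [AddCommGroup M] [Module R M]
    [Module.Finite R M] (_ : HasProjectiveDimensionLT (ModuleCat.of R M) (a + 1)) (c : ℕ)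
    (_ : DepthGE R N (c + a)), DepthGE R (M ⊗[R] N) c := by
  induction a with
  | zero =>
    intro M _ _ _ h c hc
    have := free_of_pd h
    exact depth_free_tensor hc
  | succ a ih =>
    intro M _ _ _ h c hc
    obtain ⟨n, f, hf⟩ := Module.Finite.exists_fin' R M
    have hS : (ShortComplex.mk (ModuleCat.ofHom (LinearMap.ker f).subtype) (ModuleCat.ofHom f) _).ShortExact :=
      mkShortExact (LinearMap.ker f).subtype f (Submodule.subtype_injective _) hf
        (LinearMap.exact_subtype_ker_map f)
    have hp : Projective (ModuleCat.of R (Fin n → R)) :=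
      (IsProjective.iff_projective (Fin n → R)).mp inferInstance
    have hk : HasProjectiveDimensionLT (ModuleCat.of R (LinearMap.ker f)) (a + 1) :=
      (hS.hasProjectiveDimensionLT_X₃_iff a hp).mp h
    have hd : DepthGE R (LinearMap.ker f ⊗[R] N) (c + 1) :=
      ih (LinearMap.ker f) hk (c + 1) (hc.mono (by omega))
    refine DepthGE.right ((LinearMap.ker f).subtype.rTensor N) (f.rTensor N)
      (rTensor_injective_of_LF _ (Submodule.subtype_injective _) hN (hd.mono (by omega)))
      (LinearMap.rTensor_surjective N hf) (rTensor_exact N (LinearMap.exact_subtype_ker_map f) hf)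
      hd (depth_free_tensor (hc.mono (by omega)))

theorem reflexive_of_depth (hR : DepthGE R R 1) (hN : LF R N) (hd : DepthGE R N 2) :
    Module.IsReflexive R N := by
  have hinj : Function.Injective (Module.Dual.eval R N) := by
    rw [injective_iff_map_eq_zero]
    intro z hz
    apply (hd.mono (by omega : 1 ≤ 2)).eq_zero_of_torsion
    intro p hp hm
    obtain ⟨s, hs, n, α, β, hx⟩ := hN p hp hm
    refine ⟨s, hs, ?_⟩
    have h2 : α z = 0 := by
      ext i
      exact LinearMap.congr_fun hz (LinearMap.proj i ∘ₗ α)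
    rw [← hx, h2, map_zero]
  have hB : DepthGE R (Module.Dual R (Module.Dual R N)) 1 := by
    rw [depthGE_one_iff] at hR ⊢
    intro y hy
    ext φ
    apply hR
    intro r hr
    exact LinearMap.congr_fun (hy r hr) φ
  have hC : DepthGE R (Module.Dual R (Module.Dual R N) ⧸ LinearMap.range (Module.Dual.eval R N)) 1 :=
    DepthGE.right _ (LinearMap.range (Module.Dual.eval R N)).mkQ hinj
      (Submodule.mkQ_surjective _) (LinearMap.exact_map_mkQ_range _) hd hB
  refine ⟨hinj, fun c => ?_⟩
  have h0 : (LinearMap.range (Module.Dual.eval R N)).mkQ c = 0 := by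
    apply hC.eq_zero_of_torsion
    intro p hp hm
    obtain ⟨s, hs, n, α, β, hx⟩ := hN p hp hm
    refine ⟨s, hs, ?_⟩
    rw [← map_smul, Submodule.mkQ_apply, Submodule.Quotient.mk_eq_zero]
    obtain ⟨v, hv⟩ := (Module.bijective_dual_eval R (Fin n → R)).2 (α.dualMap.dualMap c)
    refine ⟨β v, ?_⟩
    ext φ
    have h1 := LinearMap.congr_fun hv (β.dualMap φ)
    have h2 : α.dualMap (β.dualMap φ) = s • φ := by
      ext x
      simp [hx]
    simp only [LinearMap.dualMap_apply, Module.Dual.eval_apply, h2, map_smul] at h1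
    simpa using h1
  rwa [Submodule.mkQ_apply, Submodule.Quotient.mk_eq_zero] at h0

theorem tensorPower_good {M : Type} [AddCommGroup M] [Module R M] [Module.Finite R M] (d : ℕ)
    (h : HasProjectiveDimensionLT (ModuleCat.of R M) (d + 1)) (hM : LF R M) (p : ℕ) :
    LF R (⨂[R]^p M) ∧ ∀ c, DepthGE R R (c + p * d) → DepthGE R (⨂[R]^p M) c := by
  induction p with
  | zero =>
    have e : R ≃ₗ[R] (⨂[R]^0 M) := (PiTensorProduct.isEmptyEquiv (Fin 0)).symm
    exact ⟨LF.self.equiv e, fun c hc => (hc.mono (by omega)).equiv e⟩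
  | succ p ih =>
    have e1 : M ≃ₗ[R] (⨂[R]^1 M) := (PiTensorProduct.subsingletonEquiv (R := R) (s := fun _ : Fin 1 => M) 0).symm
    have e : (M ⊗[R] (⨂[R]^p M)) ≃ₗ[R] (⨂[R]^(p + 1) M) :=
      TensorProduct.comm R _ _ ≪≫ₗ TensorProduct.congr (LinearEquiv.refl R _) e1 ≪≫ₗ
        TensorPower.mulEquiv
    refine ⟨(hM.tensor ih.1).equiv e, fun c hc => ?_⟩
    refine (depth_tensor ih.1 d M h c (ih.2 (c + d) (hc.mono ?_))).equiv e
    rw [Nat.succ_mul]; omega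

end TensorDepth

section ExteriorSummand

open TensorProduct

theorem exteriorPower_reflexive_of_tensorPower {R M : Type} [CommRing R] [AddCommGroup M]
    [Module R M] (p : ℕ) (hp : IsUnit ((p.factorial : ℕ) : R))
    [Module.IsReflexive R (⨂[R]^p M)] : Module.IsReflexive R (⋀[R]^p M) := by
  obtain ⟨u, hu⟩ := hp
  let i : (⋀[R]^p M) →ₗ[R] (⨂[R]^p M) := (↑u⁻¹ : R) •
    exteriorPower.alternatingMapLinearEquiv
      (MultilinearMap.alternatization (PiTensorProduct.tprod R (s := fun _ : Fin p => M)))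
  let s : (⨂[R]^p M) →ₗ[R] (⋀[R]^p M) :=
    PiTensorProduct.lift (exteriorPower.ιMulti R p (M := M)).toMultilinearMap
  refine Module.IsReflexive.of_split i s ?_
  apply exteriorPower.linearMap_ext
  ext v : 1
  simp only [LinearMap.compAlternatingMap_apply, LinearMap.comp_apply, LinearMap.id_apply, i, s,
    exteriorPower.alternatingMapLinearEquiv_apply_ιMulti, LinearMap.smul_apply, map_smul,
    MultilinearMap.alternatization_apply, map_sum, MultilinearMap.domDomCongr_apply]
  have : ∀ σ : Equiv.Perm (Fin p), (PiTensorProduct.lift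
      (exteriorPower.ιMulti R p (M := M)).toMultilinearMap)
      ((Equiv.Perm.sign σ) • (PiTensorProduct.tprod R fun i => v (σ i)))
      = exteriorPower.ιMulti R p v := by
    intro σ
    rw [map_zsmul_unit]
    rw [PiTensorProduct.lift.tprod]
    have h := (exteriorPower.ιMulti R p (M := M)).map_perm v σ
    have h' : (exteriorPower.ιMulti R p (M := M)).toMultilinearMap (fun i => v (σ i))
      = Equiv.Perm.sign σ • exteriorPower.ιMulti R p v := h
    rw [h', smul_smul, Int.units_mul_self, one_smul]
  simp only [_root_.smul_apply, MultilinearMap.domDomCongr_apply, this]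
  rw [Finset.sum_const, Finset.card_univ, Fintype.card_perm, Fintype.card_fin,
    ← Nat.cast_smul_eq_nsmul R, ← hu, smul_smul, Units.inv_mul, one_smul]

theorem factorial_isUnit {R K : Type} [CommRing R] [Field K] [Algebra K R] (p ℓ : ℕ)
    (hchar : ringChar K = 0 ∨ ℓ ≤ ringChar K) (hp : p < ℓ) : IsUnit ((p.factorial : ℕ) : R) := by
  have h : ((p.factorial : ℕ) : K) ≠ 0 := by
    intro h0
    rw [ringChar.spec] at h0
    rcases hchar with h | h
    · rw [h, zero_dvd_iff] at h0
      exact p.factorial_ne_zero h0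
    · rcases CharP.char_is_prime_or_zero K (ringChar K) with hq | hq
      · have := (hq.dvd_factorial).mp h0
        omega
      · omega
  have := (isUnit_iff_ne_zero.mpr h).map (algebraMap K R)
  rwa [map_natCast] at this

end ExteriorSummand

/-- Let `R` be a commutative Noetherian regular local ring of Krull dimension `ℓ` containing a
field `K` with `char K = 0` or `char K ≥ ℓ`, and let `M` be a finitely generated `d`-spherical
`R`-module with `pd_R M = d`, free at every non-maximal prime.  Then for every `p ≥ 1` with
`p·d < ℓ - 1`, the exterior power `⋀^p M` is reflexive. -/
theorem exteriorPower_reflexive (R : Type) [CommRing R] [IsNoetherianRing R] [IsLocalRing R]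
    (K : Type) [Field K] [Algebra K R]
    (ℓ d : ℕ)
    (hchar : ringChar K = 0 ∨ ℓ ≤ ringChar K)
    (hdim : ringKrullDim R = ℓ)
    (hreg : ∃ s : Finset R, s.card = ℓ ∧ Ideal.span (s : Set R) = IsLocalRing.maximalIdeal R)
    (M : Type) [AddCommGroup M] [Module R M] [Module.Finite R M]
    (hsph : Spherical R (ModuleCat.of R M) d)
    (hpd : projDim R (ModuleCat.of R M) = d)
    (hloc : ∀ (p : Ideal R) (_ : p.IsPrime), p ≠ IsLocalRing.maximalIdeal R →
      Module.Free (Localization.AtPrime p) (LocalizedModule p.primeCompl M)) :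
    ∀ p : ℕ, 1 ≤ p → p * d < ℓ - 1 → Module.IsReflexive R (⋀[R]^p M) := by

  intro p hp1 hpd'
  have hP := hasPD_of_pdLE R (ModuleCat.of R M) d hsph.1
  rcases Nat.eq_zero_or_pos d with rfl | hd
  · have := free_of_pd hP
    infer_instance
  · have hR := depth_regular ℓ hdim hreg
    have hM : LF R M := LF.of_localized hloc
    obtain ⟨h1, h2⟩ := tensorPower_good d hP hM p
    have hle : p ≤ p * d := Nat.le_mul_of_pos_right p hd
    have : Module.IsReflexive R (PiTensorProduct R fun _ : Fin p => M) :=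
      reflexive_of_depth (hR.mono (by omega)) h1 (h2 2 (hR.mono (by omega)))
    exact exteriorPower_reflexive_of_tensorPower p (factorial_isUnit (K := K) p ℓ hchar (by omega))
end

section
/- Let R be a commutative ring, let α ∈ R be a non-zerodivisor, set R'' = R/(α), and let M be an R''-module (viewed also as an R-module via the quotient map). Then Hom_R(M, R) = 0, and for every integer q ≥ 0 there is an isomorphism Ext^q_{R''}(M, R'') ≅ Ext^{q+1}_R(M, R). -/
open CategoryTheory

open CochainComplex.HomComplex in
lemma extMk_zero_iff {C : Type*} [Category C] [Abelian C] [HasExt C] {X Y : C}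
    (P : ProjectiveResolution X) (f : P.complex.X 0 ⟶ Y) (m : ℕ) (hm : 0 + 1 = m)
    (hf : P.complex.d m 0 ≫ f = 0) : P.extMk f m hm hf = 0 ↔ f = 0 := by
  constructor
  · intro h
    simp only [← P.extEquivCohomologyClass.apply_eq_iff_eq,
      ProjectiveResolution.extEquivCohomologyClass_extMk,
      ProjectiveResolution.extEquivCohomologyClass_zero,
      CohomologyClass.mk_eq_zero_iff] at h
    rw [Cocycle.toSingleMk_mem_coboundaries_iff _ _ _ _ _ 1 (by simp)] at h
    obtain ⟨g, hg⟩ := h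
    have hz : Limits.IsZero (P.cochainComplex.X 1) :=
      P.cochainComplex.isZero_of_isStrictlyLE 0 1 (by simp)
    rw [hz.eq_of_src g 0, Limits.comp_zero] at hg
    rw [← cancel_epi (P.cochainComplexXIso (-(0:ℕ)) 0 rfl).hom]
    simpa using hg.symm
  · rintro rfl
    simp

noncomputable def homologyIsoOf {A : Type} [CommRing A] (S : ShortComplex (ModuleCat.{0} A))
    (N : Type) [AddCommGroup N] [Module A N] (φ : LinearMap.ker S.g.hom →ₗ[A] N)
    (hs : Function.Surjective φ) (hk : LinearMap.ker φ = LinearMap.range S.moduleCatToCycles) :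
    S.homology ≅ ModuleCat.of A N :=
  S.moduleCatHomologyIso ≪≫
    ((Submodule.quotEquivOfEq _ _ hk.symm).trans (φ.quotKerEquivOfSurjective hs)).toModuleIso

lemma smul_extMk' {A : Type} [CommRing A] {X Y : ModuleCat.{0} A}
    (P : ProjectiveResolution X) {n : ℕ} (f : P.complex.X n ⟶ Y) (m : ℕ) (hm : n + 1 = m)
    (hf : P.complex.d m n ≫ f = 0) (r : A) (hf' : P.complex.d m n ≫ (r • f) = 0) :
    P.extMk (r • f) m hm hf' = r • P.extMk f m hm hf := by
  rw [Abelian.Ext.smul_eq_comp_mk₀, P.extMk_comp_mk₀]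
  congr 1

lemma extMk_eq_zero_iff'' {C : Type*} [Category C] [Abelian C] [HasExt C] {X Y : C}
    (P : ProjectiveResolution X) {n : ℕ} (f : P.complex.X n ⟶ Y) (m : ℕ) (hm : n + 1 = m)
    (hf : P.complex.d m n ≫ f = 0) : P.extMk f m hm hf = 0 ↔
      ∃ g : P.complex.X ((ComplexShape.up ℕ).prev n) ⟶ Y, P.complex.d n _ ≫ g = f := by
  cases n with
  | zero =>
    rw [extMk_zero_iff]
    have : P.complex.d 0 ((ComplexShape.up ℕ).prev 0) = 0 := P.complex.shape _ _ (by simp)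
    simp only [this, Limits.zero_comp, exists_const]
    exact eq_comm
  | succ n => exact P.extMk_eq_zero_iff (n := n+1) f m hm _ _ (by simp)

lemma bridge_s5 (A : Type) [CommRing A] (X Y : ModuleCat.{0} A) (n : ℕ) :
    Nonempty (ExtGrp A X Y n ≅ ModuleCat.of A (Abelian.Ext.{0} X Y n)) := by
  let P := projectiveResolution X
  let m := (ComplexShape.up ℕ).next n
  have hm : n + 1 = m := by simp [m]
  let K := P.complex.linearYonedaObj A Y
  have hg (f : P.complex.X n ⟶ Y) (hf : f ∈ LinearMap.ker (K.sc n).g.hom) : P.complex.d m n ≫ f = 0 := hf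
  let φ : LinearMap.ker (K.sc n).g.hom →ₗ[A] Abelian.Ext.{0} X Y n :=
    { toFun := fun f => P.extMk (n := n) f.1 m hm (hg _ f.2)
      map_add' := fun f g => (P.add_extMk (n := n) f.1 g.1 m hm _ _).symm
      map_smul' := fun r f => smul_extMk' P (n := n) f.1 m hm (hg _ f.2) r (hg _ (r • f).2) }
  refine ⟨P.isoExt n Y ≪≫ homologyIsoOf (K.sc n) _ φ ?_ ?_⟩
  · intro e
    obtain ⟨f, hf, rfl⟩ := P.extMk_surjective e m hm
    exact ⟨⟨f, hf⟩, rfl⟩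
  · ext ⟨f, hf⟩
    rw [LinearMap.mem_ker, LinearMap.mem_range]
    change P.extMk (n := n) f m hm (hg _ hf) = 0 ↔ _
    have key : (∃ y, (K.sc n).moduleCatToCycles y = ⟨f, hf⟩) ↔
      ∃ g : P.complex.X ((ComplexShape.up ℕ).prev n) ⟶ Y, P.complex.d n _ ≫ g = f :=
      ⟨fun ⟨y, hy⟩ => ⟨y, congrArg Subtype.val hy⟩, fun ⟨y, hy⟩ => ⟨y, Subtype.ext hy⟩⟩
    rw [key]
    exact extMk_eq_zero_iff'' P (n := n) f m hm _

section
variable {R : Type} [CommRing R] (α : R)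

/-- The quotient ring. -/
abbrev QB : Type := R ⧸ Ideal.span {α}

/-- Restriction of scalars. -/
noncomputable abbrev FB : ModuleCat.{0} (QB α) ⥤ ModuleCat.{0} R :=
  ModuleCat.restrictScalars (Ideal.Quotient.mk (Ideal.span {α}))

lemma alpha_smul (X : ModuleCat.{0} (QB α)) (x : (FB α).obj X) : α • x = 0 := by
  have : α • x = ((Ideal.Quotient.mk (Ideal.span {α}) α : QB α) • (show X from x) : X) := rfl
  rw [this, Ideal.Quotient.eq_zero_iff_mem.2 (Ideal.mem_span_singleton_self α)]
  exact zero_smul _ (show X from x)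

lemma alpha_id (X : ModuleCat.{0} (QB α)) : α • 𝟙 ((FB α).obj X) = 0 := by
  ext x
  exact alpha_smul α X x

lemma alpha_comp (N : ModuleCat.{0} R) (X : ModuleCat.{0} (QB α)) (g : N ⟶ (FB α).obj X) :
    (α • 𝟙 N) ≫ g = 0 := by
  rw [Linear.smul_comp, Category.id_comp]
  ext x
  exact alpha_smul α X (g.hom x)

lemma hom_zero (hα : ∀ x : R, α * x = 0 → x = 0) (X : ModuleCat.{0} (QB α))
    (g : (FB α).obj X ⟶ ModuleCat.of R R) : g = 0 := by
  ext x
  apply hα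
  change α • g.hom x = 0
  rw [← map_smul, alpha_smul, map_zero]

instance : (FB α).Full where
  map_surjective {X Y} g := by
    refine ⟨ModuleCat.ofHom { toFun := fun x => g.hom x, map_add' := fun x y => g.hom.map_add x y,
                              map_smul' := ?_ }, rfl⟩
    intro b x
    obtain ⟨r, rfl⟩ := Ideal.Quotient.mk_surjective b
    exact g.hom.map_smul r x

/-- the quotient map on the free module on `I`. -/
noncomputable def freeMap (I : Type) : ModuleCat.of R (I →₀ R) ⟶
    (FB α).obj (ModuleCat.of (QB α) (I →₀ QB α)) :=
  ModuleCat.ofHom (Y := (FB α).obj (ModuleCat.of (QB α) (I →₀ QB α)))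
    { toFun := fun x => Finsupp.mapRange (Ideal.Quotient.mk (Ideal.span {α})) (map_zero _) x
      map_add' := fun x y => Finsupp.mapRange_add (fun a b => map_add _ a b) x y
      map_smul' := fun r x => by
        refine Finsupp.ext fun i => ?_
        rw [Finsupp.mapRange_apply]
        exact map_mul (Ideal.Quotient.mk (Ideal.span {α})) r (x i) }

/-- the quotient map. -/
noncomputable def ringMap : ModuleCat.of R R ⟶ (FB α).obj (ModuleCat.of (QB α) (QB α)) :=
  ModuleCat.ofHom (Y := (FB α).obj (ModuleCat.of (QB α) (QB α)))
    { toFun := fun x => Ideal.Quotient.mk (Ideal.span {α}) x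
      map_add' := fun x y => map_add _ x y
      map_smul' := fun r x => map_mul (Ideal.Quotient.mk (Ideal.span {α})) r x }

/-- multiplication by α on the free module on `I`. -/
noncomputable def freeSeq (I : Type) : ShortComplex (ModuleCat.{0} R) where
  X₁ := ModuleCat.of R (I →₀ R)
  X₂ := ModuleCat.of R (I →₀ R)
  X₃ := (FB α).obj (ModuleCat.of (QB α) (I →₀ QB α))
  f := α • 𝟙 _
  g := freeMap α I
  zero := alpha_comp α _ _ (freeMap α I)

lemma freeSeq_shortExact (hα : ∀ x : R, α * x = 0 → x = 0) (I : Type) :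
    (freeSeq α I).ShortExact where
  exact := by
    rw [ShortComplex.moduleCat_exact_iff]
    intro (x : I →₀ R) hx
    have h (i : I) : ∃ c, x i = α * c := by
      have := DFunLike.congr_fun (show Finsupp.mapRange
        (Ideal.Quotient.mk (Ideal.span {α})) (map_zero _) x = 0 from hx) i
      rw [Finsupp.mapRange_apply] at this
      exact Ideal.mem_span_singleton.1 (Ideal.Quotient.eq_zero_iff_mem.1 this)
    choose c hc using h
    let y : I →₀ R := Finsupp.onFinset x.support c fun i hi => by
      rw [Finsupp.mem_support_iff]
      intro h0
      exact hi (hα _ (by rw [← hc, h0]))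
    have hy : α • y = x := Finsupp.ext fun i => (hc i).symm
    exact ⟨y, hy⟩
  mono_f := by
    rw [ModuleCat.mono_iff_injective]
    intro (x : I →₀ R) (y : I →₀ R) h
    have h' : α • x = α • y := h
    have h2 : x = y := by
      refine Finsupp.ext fun i => ?_
      have h3 : α * x i = α * y i := DFunLike.congr_fun h' i
      exact sub_eq_zero.1 (hα _ (by rw [mul_sub, h3, sub_self]))
    exact h2
  epi_g := by
    rw [ModuleCat.epi_iff_surjective]
    exact Finsupp.mapRange_surjective _ (map_zero _) Ideal.Quotient.mk_surjective

lemma free_pd (hα : ∀ x : R, α * x = 0 → x = 0) (I : Type) :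
    HasProjectiveDimensionLT ((FB α).obj (ModuleCat.of (QB α) (I →₀ QB α))) 2 := by
  have : Projective (ModuleCat.of R (I →₀ R)) :=
    (IsProjective.iff_projective _).1 inferInstance
  have h1 : HasProjectiveDimensionLT (ModuleCat.of R (I →₀ R)) 1 := inferInstance
  exact (freeSeq_shortExact α hα I).hasProjectiveDimensionLT_X₃ 1 h1
    (hasProjectiveDimensionLT_of_ge (ModuleCat.of R (I →₀ R)) 1 2 (by simp))

/-- `R → R → R/α` -/
noncomputable def ringSeq : ShortComplex (ModuleCat.{0} R) where
  X₁ := ModuleCat.of R R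
  X₂ := ModuleCat.of R R
  X₃ := (FB α).obj (ModuleCat.of (QB α) (QB α))
  f := α • 𝟙 _
  g := ringMap α
  zero := alpha_comp α _ _ (ringMap α)

lemma ringSeq_shortExact (hα : ∀ x : R, α * x = 0 → x = 0) :
    (ringSeq α).ShortExact where
  exact := by
    rw [ShortComplex.moduleCat_exact_iff]
    intro (x : R) hx
    obtain ⟨c, hc⟩ := Ideal.mem_span_singleton.1 (Ideal.Quotient.eq_zero_iff_mem.1
      (show Ideal.Quotient.mk (Ideal.span {α}) x = 0 from hx))
    exact ⟨(c : R), hc.symm⟩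
  mono_f := by
    rw [ModuleCat.mono_iff_injective]
    intro (x : R) (y : R) h
    have h' : α * x = α * y := h
    have h2 : x = y := sub_eq_zero.1 (hα _ (by rw [mul_sub, h', sub_self]))
    exact h2
  epi_g := by
    rw [ModuleCat.epi_iff_surjective]
    exact Ideal.Quotient.mk_surjective (I := Ideal.span {α})

open Abelian

/-- The class of `R → R → R/α`. -/
noncomputable def delta (hα : ∀ x : R, α * x = 0 → x = 0) :
    Ext.{0} ((FB α).obj (ModuleCat.of (QB α) (QB α))) (ModuleCat.of R R) 1 :=
  (ringSeq_shortExact α hα).extClass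

/-- The comparison map. -/
noncomputable def extCmp (hα : ∀ x : R, α * x = 0 → x = 0) (X : ModuleCat.{0} (QB α)) (n : ℕ) :
    Ext.{0} X (ModuleCat.of (QB α) (QB α)) n →+
      Ext.{0} ((FB α).obj X) (ModuleCat.of R R) (n + 1) :=
  ((delta α hα).postcomp ((FB α).obj X) (rfl : n + 1 = n + 1)).comp
    ((FB α).mapExtAddHom X (ModuleCat.of (QB α) (QB α)) n)

lemma extCmp_apply (hα : ∀ x : R, α * x = 0 → x = 0) (X : ModuleCat.{0} (QB α)) (n : ℕ)
    (e : Ext.{0} X (ModuleCat.of (QB α) (QB α)) n) :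
    extCmp α hα X n e = (e.mapExactFunctor (FB α)).comp (delta α hα) rfl := rfl

lemma extCmp_smul (hα : ∀ x : R, α * x = 0 → x = 0) (X : ModuleCat.{0} (QB α)) (n : ℕ) (r : R)
    (e : Ext.{0} X (ModuleCat.of (QB α) (QB α)) n) :
    extCmp α hα X n ((Ideal.Quotient.mk (Ideal.span {α}) r : QB α) • e) = r • extCmp α hα X n e := by
  rw [extCmp_apply, extCmp_apply, Ext.smul_eq_comp_mk₀, Ext.mapExactFunctor_comp,
    Ext.mapExactFunctor_mk₀, ← Ext.smul_comp, Ext.smul_eq_comp_mk₀ _ r]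
  rfl

lemma extCmp_bijective_zero (hα : ∀ x : R, α * x = 0 → x = 0) (X : ModuleCat.{0} (QB α)) :
    Function.Bijective (extCmp α hα X 0) := by
  constructor
  · rw [injective_iff_map_eq_zero]
    intro e he
    obtain ⟨f, rfl⟩ := (Ext.mk₀_bijective _ _).2 e
    rw [extCmp_apply, Ext.mapExactFunctor_mk₀] at he
    obtain ⟨x, hx⟩ := Ext.covariant_sequence_exact₃ _ (ringSeq_shortExact α hα) _ _ he
    obtain ⟨x, rfl⟩ := (Ext.mk₀_bijective _ _).2 x
    have h0 : x = 0 := hom_zero α hα X x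
    rw [h0, Ext.mk₀_zero, Ext.zero_comp] at hx
    have hx : Ext.mk₀ ((FB α).map f) = 0 := hx.symm
    rw [Ext.mk₀_eq_zero_iff] at hx
    have : f = 0 := (FB α).map_injective (by rw [hx, Functor.map_zero])
    rw [this, Ext.mk₀_zero]
  · intro y
    have hy : y.comp (Ext.mk₀ (ringSeq α).f) (add_zero 1) = 0 := by
      change y.comp (Ext.mk₀ (α • 𝟙 (ModuleCat.of R R))) (add_zero 1) = 0
      have h2 : α • y = (Ext.mk₀ (α • 𝟙 ((FB α).obj X))).comp y (zero_add 1) := by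
        simp [Ext.mk₀_smul]
      rw [← Ext.smul_eq_comp_mk₀, h2, alpha_id, Ext.mk₀_zero, Ext.zero_comp]
    obtain ⟨x, hx⟩ := Ext.covariant_sequence_exact₁ _ (ringSeq_shortExact α hα) y hy
      (rfl : 0 + 1 = 0 + 1)
    obtain ⟨x, rfl⟩ := (Ext.mk₀_bijective _ _).2 x
    obtain ⟨f, rfl⟩ := (FB α).map_surjective (X := X) (Y := ModuleCat.of (QB α) (QB α)) x
    refine ⟨Ext.mk₀ f, ?_⟩
    rw [extCmp_apply, Ext.mapExactFunctor_mk₀]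
    exact hx

lemma extCmp_bijective (hα : ∀ x : R, α * x = 0 → x = 0) (X : ModuleCat.{0} (QB α)) (n : ℕ) :
    Function.Bijective (extCmp α hα X n) := by
  induction n generalizing X with
  | zero => exact extCmp_bijective_zero α hα X
  | succ n hn =>
    let p : (X →₀ QB α) →ₗ[QB α] X := Finsupp.linearCombination _ id
    let S : ShortComplex (ModuleCat.{0} (QB α)) := p.shortComplexKer
    have hS : S.ShortExact :=
      LinearMap.shortExact_shortComplexKer (Finsupp.linearCombination_id_surjective _ _)
    have hP : Projective S.X₂ :=
      (IsProjective.iff_projective (R := QB α) (X →₀ QB α)).1 inferInstance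
    have hpd : HasProjectiveDimensionLT (S.map (FB α)).X₂ 2 := free_pd α hα X
    have hS' := hS.map_of_exact (FB α)
    exact AddMonoidHom.bijective_of_surjective_of_bijective_of_right_exact
      ((Ext.mk₀ S.f).precomp _ (zero_add n)) (hS.extClass.precomp _ (add_comm 1 n))
      ((Ext.mk₀ (S.map (FB α)).f).precomp _ (zero_add (n + 1)))
      (hS'.extClass.precomp _ (add_comm 1 (n + 1)))
      (extCmp α hα S.X₂ n) (extCmp α hα S.X₁ n) (extCmp α hα S.X₃ (n + 1))
      (by
        ext e
        change (Ext.mk₀ ((FB α).map S.f)).comp ((e.mapExactFunctor (FB α)).comp (delta α hα) rfl)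
            (zero_add (n + 1)) = (((Ext.mk₀ S.f).comp e (zero_add n)).mapExactFunctor (FB α)).comp
            (delta α hα) rfl
        rw [Ext.mapExactFunctor_comp, Ext.mapExactFunctor_mk₀]
        exact (Ext.comp_assoc _ _ _ _ _ (by lia)).symm)
      (by
        ext e
        change hS'.extClass.comp ((e.mapExactFunctor (FB α)).comp (delta α hα) rfl)
            (add_comm 1 (n + 1)) = ((hS.extClass.comp e (add_comm 1 n)).mapExactFunctor (FB α)).comp
            (delta α hα) rfl
        rw [Ext.mapExactFunctor_comp, Ext.mapExactFunctor_extClass]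
        exact (Ext.comp_assoc _ _ _ _ _ (by lia)).symm)
      ((ShortComplex.ab_exact_iff_function_exact _).1
        (Ext.contravariant_sequence_exact₁' hS _ n (n + 1) (add_comm 1 n)))
      ((ShortComplex.ab_exact_iff_function_exact _).1
        (Ext.contravariant_sequence_exact₁' hS' _ (n + 1) (n + 2) (add_comm 1 (n + 1))))
      (hn _).surjective (hn _)
      (fun x₃ ↦ Ext.contravariant_sequence_exact₃ hS _ x₃
        (Ext.eq_zero_of_projective _) (add_comm 1 n))
      (fun y₃ ↦ Ext.contravariant_sequence_exact₃ hS' _ y₃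
        (Ext.eq_zero_of_hasProjectiveDimensionLT _ 2 (by lia)) (add_comm 1 (n + 1)))

end

/-- Let `R` be a commutative ring, `α ∈ R` a non-zerodivisor, `R'' = R/(α)`, and `M` an
`R''`-module, viewed also as an `R`-module by restriction of scalars.  Then `Hom_R(M, R) = 0`
and `Ext^q_{R''}(M, R'') ≅ Ext^{q+1}_R(M, R)` (as `R`-modules) for every `q ≥ 0`. -/
theorem ext_quotient_shift (R : Type) [CommRing R] (α : R)
    (hα : ∀ x : R, α * x = 0 → x = 0)
    (M : Type) [AddCommGroup M] [Module (R ⧸ Ideal.span {α}) M] :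
    (∀ g : (ModuleCat.restrictScalars (Ideal.Quotient.mk (Ideal.span {α}))).obj
        (ModuleCat.of (R ⧸ Ideal.span {α}) M) ⟶ ModuleCat.of R R, g = 0) ∧
    ∀ q : ℕ, Nonempty (
      (ModuleCat.restrictScalars (Ideal.Quotient.mk (Ideal.span {α}))).obj
        (ExtGrp (R ⧸ Ideal.span {α}) (ModuleCat.of (R ⧸ Ideal.span {α}) M)
          (ModuleCat.of (R ⧸ Ideal.span {α}) (R ⧸ Ideal.span {α})) q)
      ≅ ExtGrp R ((ModuleCat.restrictScalars (Ideal.Quotient.mk (Ideal.span {α}))).obj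
          (ModuleCat.of (R ⧸ Ideal.span {α}) M)) (ModuleCat.of R R) (q + 1)) := by
  refine ⟨fun g => hom_zero α hα (ModuleCat.of _ M) g, fun q => ?_⟩
  obtain ⟨e₁⟩ := bridge_s5 (R ⧸ Ideal.span {α}) (ModuleCat.of (R ⧸ Ideal.span {α}) M)
          (ModuleCat.of (R ⧸ Ideal.span {α}) (R ⧸ Ideal.span {α})) q
  obtain ⟨e₂⟩ := bridge_s5 R ((FB α).obj (ModuleCat.of (R ⧸ Ideal.span {α}) M))
    (ModuleCat.of R R) (q + 1)
  let X := ModuleCat.of (R ⧸ Ideal.span {α}) M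
  let c := extCmp α hα X q
  let l : (FB α).obj (ModuleCat.of (QB α) (Abelian.Ext.{0} X (ModuleCat.of (QB α) (QB α)) q))
      →ₗ[R] Abelian.Ext.{0} ((FB α).obj X) (ModuleCat.of R R) (q + 1) :=
    { toFun := fun x => c x
      map_add' := fun x y => c.map_add x y
      map_smul' := fun r x => extCmp_smul α hα X q r x }
  exact ⟨(FB α).mapIso e₁ ≪≫
    (LinearEquiv.ofBijective l (extCmp_bijective α hα X q)).toModuleIso ≪≫ e₂.symm⟩
end
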